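/- A set A ≤_T ∅′ is ML-cuppable if and only if A is not K-trivial. -/

import Mathlib

open MeasureTheory ENNReal

/-! ### Cantor space and the uniform (coin-flipping) measure -/

/-- The binary digits of a real number in `[0,1)`, giving a point of Cantor space. -/
noncomputable def binaryDigits (x : ℝ) : ℕ → Bool :=
  fun n => decide (⌊x * 2 ^ (n + 1)⌋ % 2 = 1)

/-- The uniform (Lebesgue / coin-flipping) measure on Cantor space `2^ω`,
obtained as the pushforward of Lebesgue measure on `[0,1)` under binary expansion. -/
noncomputable def μCantor : Measure (ℕ → Bool) :=
  Measure.map binaryDigits (volume.restrict (Set.Ico (0 : ℝ) 1))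

/-- `σ` is an initial segment of the infinite sequence `X`. -/
def IsPrefixOf (σ : List Bool) (X : ℕ → Bool) : Prop :=
  ∀ i : Fin σ.length, X i = σ.get i

/-- The cylinder determined by a finite binary string. -/
def cylinder (σ : List Bool) : Set (ℕ → Bool) := {X | IsPrefixOf σ X}

/-- The open set generated by a set of finite binary strings. -/
def openOf (S : Set (List Bool)) : Set (ℕ → Bool) := ⋃ σ ∈ S, cylinder σ

/-- The density of a set `P` above the string `τ`: `μ([τ] ∩ P) · 2^{|τ|}`. -/
noncomputable def dens (τ : List Bool) (P : Set (ℕ → Bool)) : ℝ≥0∞ :=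
  μCantor (cylinder τ ∩ P) * 2 ^ τ.length

/-- The length-`n` initial segment of `X`, as a finite binary string. -/
def strPrefix (X : ℕ → Bool) (n : ℕ) : List Bool := (List.range n).map X

/-- A set of strings is prefix-free if no element is a proper prefix of another. -/
def PrefixFreeSet (S : Set (List Bool)) : Prop :=
  ∀ σ ∈ S, ∀ τ ∈ S, σ <+: τ → σ = τ

/-- The weight `∑_{σ ∈ S} 2^{-|σ|}` of a set of strings. -/
noncomputable def weight (S : Set (List Bool)) : ℝ≥0∞ :=
  ∑' σ : S, 2⁻¹ ^ (σ : List Bool).length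

/-- A set of strings is bounded if its weight is finite. -/
def BoundedStr (S : Set (List Bool)) : Prop := weight S < ⊤

/-- The tail `X(·+k)` of an infinite binary sequence. -/
def tailSeq (X : ℕ → Bool) (k : ℕ) : ℕ → Bool := fun n => X (n + k)

/-! ### Oracle computability -/

/-- The `e`-th computably enumerable set of naturals (the domain of the `e`-th
partial computable function). -/
def WEnum (e n : ℕ) : Prop := ((Denumerable.ofNat Nat.Partrec.Code e).eval n).Dom

/-- `OracleComputes e X n m` holds if the `e`-th Turing functional with oracle `X`
outputs `m` on input `n`; a Turing functional is presented by the c.e. set `W_e`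
of coded axioms `(σ, n, m)`, and `Γ_e^X(n) = m` iff some initial segment `σ` of `X`
has `(σ, n, m) ∈ W_e`. -/
def OracleComputes (e : ℕ) (X : ℕ → Bool) (n m : ℕ) : Prop :=
  ∃ σ : List Bool, IsPrefixOf σ X ∧
    WEnum e (Nat.pair (Encodable.encode σ) (Nat.pair n m))

def natOfBool (b : Bool) : ℕ := cond b 1 0

/-- `f : ℕ → ℕ` is computable with oracle `A`: some Turing functional with oracle `A`
has graph exactly `f`. -/
def FnComputableIn (f : ℕ → ℕ) (A : ℕ → Bool) : Prop :=
  ∃ e, ∀ n m, OracleComputes e A n m ↔ m = f n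

/-- Turing reducibility `B ≤_T A` for subsets of `ω` (as elements of Cantor space). -/
def TuringLE (B A : ℕ → Bool) : Prop := FnComputableIn (fun n => natOfBool (B n)) A

/-- Turing equivalence. -/
def TuringEquiv (A B : ℕ → Bool) : Prop := TuringLE A B ∧ TuringLE B A

/-- The Turing join `A ⊕ B`. -/
def joinSet (A B : ℕ → Bool) : ℕ → Bool :=
  fun n => if n % 2 = 0 then A (n / 2) else B (n / 2)

open Classical in
/-- The Turing jump `A′ = {e : Γ_e^A(e)↓}`. -/
noncomputable def jump (A : ℕ → Bool) : ℕ → Bool :=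
  fun e => decide (∃ m, OracleComputes e A e m)

/-- The empty oracle. -/
def emptyOracle : ℕ → Bool := fun _ => false

/-- The halting problem `∅′`. -/
noncomputable def zeroJump : ℕ → Bool := jump emptyOracle

/-- A set is computable iff it is Turing reducible to the empty oracle. -/
def ComputableSet (A : ℕ → Bool) : Prop := TuringLE A emptyOracle

/-- A set of naturals is c.e. in `A`. -/
def CeIn (A : ℕ → Bool) (S : Set ℕ) : Prop :=
  ∃ e, ∀ n, n ∈ S ↔ ∃ m, OracleComputes e A n m

/-- A set of strings is c.e. in `A`. -/
def CeStrIn (A : ℕ → Bool) (S : Set (List Bool)) : Prop :=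
  ∃ e, ∀ σ : List Bool, σ ∈ S ↔ ∃ m, OracleComputes e A (Encodable.encode σ) m

/-- A c.e. set of strings. -/
def CeStr (S : Set (List Bool)) : Prop := CeStrIn emptyOracle S

/-! ### Π⁰₁ classes, Martin-Löf randomness, K-triviality -/

/-- A `Π⁰₁(A)` class: the complement of the union of cylinders over an `A`-c.e.
set of strings. -/
def Pi01In (A : ℕ → Bool) (P : Set (ℕ → Bool)) : Prop :=
  ∃ S : Set (List Bool), CeStrIn A S ∧ P = (openOf S)ᶜ

/-- A `Π⁰₁` class. -/
def Pi01 (P : Set (ℕ → Bool)) : Prop := Pi01In emptyOracle P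

/-- The `n`-th level of the `e`-th `A`-effective sequence of open sets. -/
def testLevel (e : ℕ) (A : ℕ → Bool) (n : ℕ) : Set (ℕ → Bool) :=
  openOf {σ | ∃ m, OracleComputes e A (Nat.pair n (Encodable.encode σ)) m}

/-- A Martin-Löf test relative to `A`: a uniformly `A`-c.e. sequence of open sets
`G n` with `μ(G n) ≤ 2^{-n}`. -/
def MLTestIn (A : ℕ → Bool) (G : ℕ → Set (ℕ → Bool)) : Prop :=
  (∃ e, ∀ n, G n = testLevel e A n) ∧ ∀ n, μCantor (G n) ≤ 2⁻¹ ^ n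

/-- `X` is Martin-Löf random relative to `A`: it passes every `A`-Martin-Löf test. -/
def MLRandomIn (A X : ℕ → Bool) : Prop :=
  ∀ G : ℕ → Set (ℕ → Bool), MLTestIn A G → ∃ n, X ∉ G n

/-- `X` is Martin-Löf random. -/
def MLRandom (X : ℕ → Bool) : Prop := MLRandomIn emptyOracle X

/-- The domain of the `e`-th machine, viewed as a set of binary strings. -/
def machineDom (e : ℕ) : Set (List Bool) :=
  {σ | ((Denumerable.ofNat Nat.Partrec.Code e).eval (Encodable.encode σ)).Dom}

/-- The `e`-th machine is prefix-free. -/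
def PrefixFreeMachine (e : ℕ) : Prop := PrefixFreeSet (machineDom e)

/-- Prefix-free Kolmogorov complexity (defined, up to an additive constant, as the
least `|σ| + 2e + 2` over prefix-free machines `e` and programs `σ` producing `x`). -/
noncomputable def Kcpx (x : ℕ) : ℕ :=
  sInf {k | ∃ e, ∃ σ : List Bool, PrefixFreeMachine e ∧
    x ∈ (Denumerable.ofNat Nat.Partrec.Code e).eval (Encodable.encode σ) ∧
    k = σ.length + 2 * e + 2}

/-- `K(n)` means `K(1^n)`. -/
noncomputable def KofNat (n : ℕ) : ℕ := Kcpx (Encodable.encode (List.replicate n true))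

/-- `A` is K-trivial: `K(A↾n) ≤ K(n) + c` for some constant `c`. -/
def KTrivial (A : ℕ → Bool) : Prop :=
  ∃ c, ∀ n, Kcpx (Encodable.encode (strPrefix A n)) ≤ KofNat n + c

/-- A set `A` is ML-cuppable if some incomplete Martin-Löf random `X <_T ∅′`
joins it above `∅′`. -/
def MLCuppable (A : ℕ → Bool) : Prop :=
  ∃ X : ℕ → Bool, MLRandom X ∧ TuringLE X zeroJump ∧ ¬ TuringLE zeroJump X ∧
    TuringLE zeroJump (joinSet A X)


section

/-! ### Automation for computability -/
section CompLib
variable {α β γ δ : Type} [Primcodable α] [Primcodable β] [Primcodable γ] [Primcodable δ]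

attribute [fun_prop] Computable
attribute [fun_prop] Computable.id Computable.const Computable.comp

theorem c1 {f : β → γ} (hf : Primrec f) {g : α → β} (h : Computable g) :
    Computable (fun x => f (g x)) := hf.to_comp.comp h
theorem c2 {f : β → γ → δ} (hf : Primrec₂ f) {g : α → β} {g' : α → γ} (h : Computable g)
    (h' : Computable g') : Computable (fun x => f (g x) (g' x)) := Computable₂.comp hf.to_comp h h'

@[fun_prop] theorem cFst {f : α → β × γ} (h : Computable f) : Computable (fun x => (f x).1) :=
  Computable.fst.comp h
@[fun_prop] theorem cSnd {f : α → β × γ} (h : Computable f) : Computable (fun x => (f x).2) :=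
  Computable.snd.comp h
@[fun_prop] theorem cPair {f : α → β} {g : α → γ} (h : Computable f) (h' : Computable g) :
    Computable (fun x => (f x, g x)) := Computable.pair h h'
@[fun_prop] theorem cAdd {f g : α → ℕ} (h : Computable f) (h' : Computable g) :
    Computable (fun x => f x + g x) := c2 Primrec.nat_add h h'
@[fun_prop] theorem cSub {f g : α → ℕ} (h : Computable f) (h' : Computable g) :
    Computable (fun x => f x - g x) := c2 Primrec.nat_sub h h'
@[fun_prop] theorem cMul {f g : α → ℕ} (h : Computable f) (h' : Computable g) :
    Computable (fun x => f x * g x) := c2 Primrec.nat_mul h h'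
@[fun_prop] theorem cDiv {f g : α → ℕ} (h : Computable f) (h' : Computable g) :
    Computable (fun x => f x / g x) := c2 Primrec.nat_div h h'
@[fun_prop] theorem cMod {f g : α → ℕ} (h : Computable f) (h' : Computable g) :
    Computable (fun x => f x % g x) := c2 Primrec.nat_mod h h'
@[fun_prop] theorem cMax {f g : α → ℕ} (h : Computable f) (h' : Computable g) :
    Computable (fun x => max (f x) (g x)) := c2 Primrec.nat_max h h'
@[fun_prop] theorem cMin {f g : α → ℕ} (h : Computable f) (h' : Computable g) :
    Computable (fun x => min (f x) (g x)) := c2 Primrec.nat_min h h'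
@[fun_prop] theorem cSucc {f : α → ℕ} (h : Computable f) : Computable (fun x => Nat.succ (f x)) :=
  c1 Primrec.succ h
@[fun_prop] theorem cNPair {f g : α → ℕ} (h : Computable f) (h' : Computable g) :
    Computable (fun x => Nat.pair (f x) (g x)) := c2 Primrec₂.natPair h h'
@[fun_prop] theorem cUnpair {f : α → ℕ} (h : Computable f) :
    Computable (fun x => Nat.unpair (f x)) := c1 Primrec.unpair h
attribute [fun_prop] ComputablePred
theorem cpOf {p : α → Prop} {f : α → Bool} (hf : Computable f) (h : ∀ x, p x ↔ f x = true) :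
    ComputablePred p := by
  rw [ComputablePred.computable_iff]
  exact ⟨f, hf, funext fun x => propext (h x)⟩
@[fun_prop] theorem cDecide {p : α → Prop} [∀ x, Decidable (p x)] (h : ComputablePred p) :
    Computable (fun x => decide (p x)) := by
  obtain ⟨f, hf, h⟩ := ComputablePred.computable_iff.1 h
  subst h
  exact hf.of_eq fun x => by simp
@[fun_prop] theorem cpLe {f g : α → ℕ} (h : Computable f)
    (h' : Computable g) : ComputablePred (fun x => f x ≤ g x) :=
  cpOf (Computable₂.comp (Primrec.nat_le.decide.to_comp) h h') fun x => by simp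
@[fun_prop] theorem cpLt {f g : α → ℕ} (h : Computable f)
    (h' : Computable g) : ComputablePred (fun x => f x < g x) :=
  cpOf (Computable₂.comp (Primrec.nat_lt.decide.to_comp) h h') fun x => by simp
@[fun_prop] theorem cpEq {f g : α → β} (h : Computable f)
    (h' : Computable g) : ComputablePred (fun x => f x = g x) :=
  cpOf (Computable₂.comp (Primrec.eq (α := ℕ).decide.to_comp) (Computable.encode.comp h)
      (Computable.encode.comp h')) fun x => by simp
@[fun_prop] theorem cBAnd {f g : α → Bool} (h : Computable f) (h' : Computable g) :
    Computable (fun x => f x && g x) := c2 Primrec.and h h'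
@[fun_prop] theorem cBOr {f g : α → Bool} (h : Computable f) (h' : Computable g) :
    Computable (fun x => f x || g x) := c2 Primrec.or h h'
@[fun_prop] theorem cBNot {f : α → Bool} (h : Computable f) :
    Computable (fun x => !(f x)) := c1 Primrec.not h
@[fun_prop] theorem cpConst {p : Prop} : ComputablePred (fun _ : α => p) := by
  classical
  exact cpOf (Computable.const (decide p)) fun x => by simp
@[fun_prop] theorem cpAnd {p q : α → Prop} (h : ComputablePred p)
    (h' : ComputablePred q) : ComputablePred (fun x => p x ∧ q x) := by
  classical
  exact cpOf (cBAnd (cDecide h) (cDecide h')) fun x => by simp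
@[fun_prop] theorem cpOr {p q : α → Prop} (h : ComputablePred p)
    (h' : ComputablePred q) : ComputablePred (fun x => p x ∨ q x) := by
  classical
  exact cpOf (cBOr (cDecide h) (cDecide h')) fun x => by simp
@[fun_prop] theorem cpNot {p : α → Prop} (h : ComputablePred p) :
    ComputablePred (fun x => ¬ p x) := by
  classical
  exact cpOf (cBNot (cDecide h)) fun x => by simp
@[fun_prop] theorem cIte {c : α → Prop} [DecidablePred c] {f g : α → β}
    (hc : ComputablePred c) (h : Computable f) (h' : Computable g) :
    Computable (fun x => if c x then f x else g x) :=
  (Computable.cond (cDecide hc) h h').of_eq (fun x => by by_cases h : c x <;> simp [h])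
@[fun_prop] theorem cCond {c : α → Bool} {f g : α → β}
    (hc : Computable c) (h : Computable f) (h' : Computable g) :
    Computable (fun x => cond (c x) (f x) (g x)) := Computable.cond hc h h'
@[fun_prop] theorem cRec {n : α → ℕ} {b : α → β} {s : α → ℕ → β → β} (hn : Computable n)
    (hb : Computable b) (hs : Computable (fun p : α × ℕ × β => s p.1 p.2.1 p.2.2)) :
    Computable (fun x => Nat.rec (motive := fun _ => β) (b x) (s x) (n x)) :=
  Computable.nat_rec (h := fun a p => s a p.1 p.2) hn hb hs
@[fun_prop] theorem cIter {n : α → ℕ} {b : α → β} {s : α → β → β} (hn : Computable n)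
    (hb : Computable b) (hs : Computable (fun p : α × β => s p.1 p.2)) :
    Computable (fun x => (s x)^[n x] (b x)) := by
  have : Computable (fun x => Nat.rec (motive := fun _ => β) (b x) (fun _ v => s x v) (n x)) := by
    apply cRec hn hb
    exact hs.comp (g := fun p : α × ℕ × β => (p.1, p.2.2)) (by fun_prop)
  refine this.of_eq fun x => ?_
  generalize n x = k
  induction k with
  | zero => rfl
  | succ k ih => rw [Function.iterate_succ_apply', ← ih]
@[fun_prop] theorem cPow {f g : α → ℕ} (h : Computable f) (h' : Computable g) :
    Computable (fun x => f x ^ g x) := by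
  have : Computable fun x => (fun y => y * f x)^[g x] 1 := by fun_prop
  refine this.of_eq fun x => ?_
  generalize g x = k
  induction k with
  | zero => rfl
  | succ k ih => rw [Function.iterate_succ_apply', ih, pow_succ]
/-! options -/
@[fun_prop] theorem cSome {f : α → β} (h : Computable f) : Computable (fun x => some (f x)) :=
  c1 Primrec.option_some h
@[fun_prop] theorem cElim {o : α → Option β} {b : α → γ} {f : α → β → γ} (ho : Computable o)
    (hb : Computable b) (hf : Computable (fun p : α × β => f p.1 p.2)) :
    Computable (fun x => (o x).elim (b x) (f x)) :=
  (Computable.option_casesOn (g := f) ho hb hf).of_eq fun x => by cases o x <;> rfl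
@[fun_prop] theorem cGetD {o : α → Option β} {b : α → β} (ho : Computable o)
    (hb : Computable b) : Computable (fun x => (o x).getD (b x)) := c2 Primrec.option_getD ho hb
@[fun_prop] theorem cIsSome {o : α → Option β} (ho : Computable o) :
    Computable (fun x => (o x).isSome) := c1 Primrec.option_isSome ho
@[fun_prop] theorem cOMap {o : α → Option β} {f : α → β → γ} (ho : Computable o)
    (hf : Computable (fun p : α × β => f p.1 p.2)) :
    Computable (fun x => (o x).map (f x)) := by
  have : Computable (fun x => (o x).elim none (fun b => some (f x b))) := by fun_prop
  exact this.of_eq fun x => by cases o x <;> rfl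
@[fun_prop] theorem cOBind {o : α → Option β} {f : α → β → Option γ} (ho : Computable o)
    (hf : Computable (fun p : α × β => f p.1 p.2)) :
    Computable (fun x => (o x).bind (f x)) := by
  have : Computable (fun x => (o x).elim none (fun b => (f x b))) := by fun_prop
  exact this.of_eq fun x => by cases o x <;> rfl
/-! lists -/
@[fun_prop] theorem cLen {l : α → List β} (h : Computable l) : Computable (fun x => (l x).length) :=
  c1 Primrec.list_length h
@[fun_prop] theorem cCons {f : α → β} {l : α → List β} (h : Computable f) (h' : Computable l) :
    Computable (fun x => f x :: l x) := c2 Primrec.list_cons h h'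
@[fun_prop] theorem cAppend {f : α → List β} {l : α → List β} (h : Computable f)
    (h' : Computable l) : Computable (fun x => f x ++ l x) := c2 Primrec.list_append h h'
@[fun_prop] theorem cReverse {l : α → List β} (h : Computable l) :
    Computable (fun x => (l x).reverse) := c1 Primrec.list_reverse h
@[fun_prop] theorem cTail {l : α → List β} (h : Computable l) :
    Computable (fun x => (l x).tail) := c1 Primrec.list_tail h
@[fun_prop] theorem cHead {l : α → List β} (h : Computable l) :
    Computable (fun x => (l x).head?) := c1 Primrec.list_head? h
@[fun_prop] theorem cTake {n : α → ℕ} {l : α → List β} (hn : Computable n) (h : Computable l) :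
    Computable (fun x => (l x).take (n x)) := c2 Primrec.list_take hn h
@[fun_prop] theorem cDrop {n : α → ℕ} {l : α → List β} (hn : Computable n) (h : Computable l) :
    Computable (fun x => (l x).drop (n x)) := c2 Primrec.list_drop hn h
@[fun_prop] theorem cGet {n : α → ℕ} {l : α → List β} (h : Computable l) (hn : Computable n) :
    Computable (fun x => (l x)[n x]?) := c2 Primrec.list_getElem? h hn
@[fun_prop] theorem cLGetD {n : α → ℕ} {l : α → List β} {d : α → β} (h : Computable l)
    (hn : Computable n) (hd : Computable d) : Computable (fun x => (l x).getD (n x) (d x)) := by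
  have : Computable (fun x => ((l x)[n x]?).getD (d x)) := by fun_prop
  exact this.of_eq fun x => by simp
@[fun_prop] theorem cRange {n : α → ℕ} (hn : Computable n) :
    Computable (fun x => List.range (n x)) := c1 Primrec.list_range hn
@[fun_prop] theorem cFoldl {l : α → List β} {b : α → γ} {s : α → γ → β → γ} (h : Computable l)
    (hb : Computable b) (hs : Computable (fun p : α × γ × β => s p.1 p.2.1 p.2.2)) :
    Computable (fun x => (l x).foldl (s x) (b x)) := by
  have h1 : Computable (fun x => Nat.rec (motive := fun _ => γ) (b x)
      (fun i acc => ((l x)[i]?).elim acc (fun c => s x acc c)) (l x).length) := by fun_prop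
  refine h1.of_eq fun x => ?_
  have : ∀ n, Nat.rec (motive := fun _ => γ) (b x)
      (fun i acc => ((l x)[i]?).elim acc (fun c => s x acc c)) n =
      ((l x).take n).foldl (s x) (b x) := by
    intro n
    induction n with
    | zero => simp
    | succ n ih =>
      simp only [ih, List.take_add_one, List.foldl_append]
      cases (l x)[n]? <;> simp
  rw [this, List.take_length]
@[fun_prop] theorem cMap {l : α → List β} {f : α → β → γ} (h : Computable l)
    (hf : Computable (fun p : α × β => f p.1 p.2)) : Computable (fun x => (l x).map (f x)) := by
  have : Computable (fun x => (l x).foldl (fun acc b => acc ++ [f x b]) []) := by fun_prop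
  refine this.of_eq fun x => ?_
  induction (l x) using List.reverseRecOn with
  | nil => rfl
  | append_singleton l a ih => rw [List.foldl_append, ih]; simp
@[fun_prop] theorem cFilter {l : α → List β} {f : α → β → Bool} (h : Computable l)
    (hf : Computable (fun p : α × β => f p.1 p.2)) : Computable (fun x => (l x).filter (f x)) := by
  have : Computable (fun x => (l x).foldl
    (fun acc b => cond (f x b) (acc ++ [b]) acc) []) := by fun_prop
  refine this.of_eq fun x => ?_
  induction (l x) using List.reverseRecOn with
  | nil => rfl
  | append_singleton l a ih =>
    rw [List.foldl_append, ih, List.filter_append]; cases hh : f x a <;> simp [hh]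
@[fun_prop] theorem cCountP {l : α → List β} {f : α → β → Bool} (h : Computable l)
    (hf : Computable (fun p : α × β => f p.1 p.2)) : Computable (fun x => (l x).countP (f x)) := by
  have : Computable (fun x => ((l x).filter (f x)).length) := by fun_prop
  exact this.of_eq fun x => by rw [List.countP_eq_length_filter]
@[fun_prop] theorem cAny {l : α → List β} {f : α → β → Bool} (h : Computable l)
    (hf : Computable (fun p : α × β => f p.1 p.2)) : Computable (fun x => (l x).any (f x)) := by
  have : Computable (fun x => decide (0 < (l x).countP (f x))) := by fun_prop
  exact this.of_eq fun x => by rw [Bool.eq_iff_iff]; simp [List.countP_pos_iff]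
@[fun_prop] theorem cAll {l : α → List β} {f : α → β → Bool} (h : Computable l)
    (hf : Computable (fun p : α × β => f p.1 p.2)) : Computable (fun x => (l x).all (f x)) := by
  have : Computable (fun x => !(l x).any (fun b => !(f x b))) := by fun_prop
  exact this.of_eq fun x => by rw [List.all_eq_not_any_not]
@[fun_prop] theorem cFlatMap {l : α → List β} {f : α → β → List γ} (h : Computable l)
    (hf : Computable (fun p : α × β => f p.1 p.2)) : Computable (fun x => (l x).flatMap (f x)) := by
  have : Computable (fun x => (l x).foldl (fun acc b => acc ++ f x b) []) := by fun_prop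
  refine this.of_eq fun x => ?_
  induction (l x) using List.reverseRecOn with
  | nil => rfl
  | append_singleton l a ih => rw [List.foldl_append, ih]; simp
@[fun_prop] theorem cSum {l : α → List ℕ} (h : Computable l) : Computable (fun x => (l x).sum) := by
  have : Computable (fun x => (l x).foldl (fun acc b => acc + b) 0) := by fun_prop
  refine this.of_eq fun x => ?_
  induction (l x) using List.reverseRecOn with
  | nil => rfl
  | append_singleton l a ih => rw [List.foldl_append, ih]; simp
@[fun_prop] theorem cFind {l : α → List β} {f : α → β → Bool} (h : Computable l)
    (hf : Computable (fun p : α × β => f p.1 p.2)) : Computable (fun x => (l x).find? (f x)) := by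
  have : Computable (fun x => ((l x).filter (f x)).head?) := by fun_prop
  exact this.of_eq fun x => by rw [List.head?_filter]
@[fun_prop] theorem cReplicate {n : α → ℕ} {b : α → β} (h : Computable n) (hb : Computable b) :
    Computable (fun x => List.replicate (n x) (b x)) := by
  have : Computable (fun x => (List.range (n x)).map (fun _ => b x)) := by fun_prop
  exact this.of_eq fun x => by simp
/-! coding -/
@[fun_prop] theorem cEncode {f : α → β} (h : Computable f) :
    Computable (fun x => Encodable.encode (f x)) := Computable.encode.comp h
@[fun_prop] theorem cDecode {f : α → ℕ} (h : Computable f) :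
    Computable (fun x => (Encodable.decode (f x) : Option β)) := Computable.decode.comp h
@[fun_prop] theorem cEvaln {k : α → ℕ} {c : α → Nat.Partrec.Code} {n : α → ℕ} (hk : Computable k)
    (hc : Computable c) (hn : Computable n) :
    Computable (fun x => Nat.Partrec.Code.evaln (k x) (c x) (n x)) :=
  c1 (f := fun a : (ℕ × Nat.Partrec.Code) × ℕ => Nat.Partrec.Code.evaln a.1.1 a.1.2 a.2)
    Nat.Partrec.Code.primrec_evaln ((hk.pair hc).pair hn)
@[fun_prop] theorem cCode {f : α → ℕ} (h : Computable f) :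
    Computable (fun x => (Denumerable.ofNat Nat.Partrec.Code (f x))) :=
  c1 (Primrec.ofNat Nat.Partrec.Code) h

/-- all binary strings of length n -/
def strs : ℕ → List (List Bool)
  | 0 => [[]]
  | n+1 => (strs n).flatMap (fun σ => [σ ++ [false], σ ++ [true]])

@[fun_prop] theorem cStrs {f : α → ℕ} (h : Computable f) : Computable (fun x => strs (f x)) := by
  have : Computable (fun x => (fun l : List (List Bool) =>
      l.flatMap (fun σ => [σ ++ [false], σ ++ [true]]))^[f x] [[]]) := by fun_prop
  refine this.of_eq fun x => ?_
  generalize f x = n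
  induction n with
  | zero => rfl
  | succ n ih => rw [Function.iterate_succ_apply', ih, strs]

end CompLib

end

section

section SigLib
variable {α β γ δ : Type} [Primcodable α] [Primcodable β] [Primcodable γ] [Primcodable δ]

/-! ### strings -/
@[simp] theorem sp_length (A : ℕ → Bool) (n : ℕ) : (strPrefix A n).length = n := by simp [strPrefix]
theorem sp_getElem (A : ℕ → Bool) (n i : ℕ) (h : i < (strPrefix A n).length) :
    (strPrefix A n)[i] = A i := by simp [strPrefix]
theorem sp_getElem? (A : ℕ → Bool) (n i : ℕ) (h : i < n) : (strPrefix A n)[i]? = some (A i) := by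
  simp [strPrefix, h]
@[simp] theorem sp_take (A : ℕ → Bool) (n m : ℕ) :
    (strPrefix A n).take m = strPrefix A (min m n) := by
  simp only [strPrefix, ← List.map_take, List.take_range]
theorem sp_succ (A : ℕ → Bool) (n : ℕ) : strPrefix A (n+1) = strPrefix A n ++ [A n] := by
  simp [strPrefix, List.range_succ]
theorem isPrefixOf_iff {σ : List Bool} {X : ℕ → Bool} :
    IsPrefixOf σ X ↔ strPrefix X σ.length = σ := by
  constructor
  · intro h
    apply List.ext_getElem
    · simp
    · intro i h1 h2
      rw [sp_getElem]; exact h ⟨i, h2⟩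
  · intro h i
    have := sp_getElem X σ.length i (by simp)
    simp only [h] at this
    simp [← this]
theorem sp_mono (A : ℕ → Bool) {m n : ℕ} (h : m ≤ n) : strPrefix A m <+: strPrefix A n := by
  have := sp_take A n m
  rw [min_eq_left h] at this
  rw [← this]; exact List.take_prefix _ _
theorem prefix_sp {σ : List Bool} {A : ℕ → Bool} {n : ℕ} (h : σ <+: strPrefix A n) :
    σ = strPrefix A σ.length := by
  have h1 := List.prefix_iff_eq_take.1 h
  have h2 := h.length_le
  rw [sp_take, sp_length] at *
  rwa [min_eq_left h2] at h1
theorem sp_congr {A B : ℕ → Bool} {n : ℕ} : strPrefix A n = strPrefix B n ↔ ∀ i < n, A i = B i := by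
  simp [strPrefix]
theorem sp_eq_of_le {A B : ℕ → Bool} {n m : ℕ} (h : strPrefix A n = strPrefix B n) (hm : m ≤ n) :
    strPrefix A m = strPrefix B m := sp_congr.2 fun i hi => sp_congr.1 h i (by omega)
theorem mem_cyl {σ : List Bool} {X : ℕ → Bool} :
    X ∈ cylinder σ ↔ strPrefix X σ.length = σ := isPrefixOf_iff
theorem mem_openOf {S : Set (List Bool)} {X : ℕ → Bool} :
    X ∈ openOf S ↔ ∃ n, strPrefix X n ∈ S := by
  simp only [openOf, Set.mem_iUnion, mem_cyl]
  constructor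
  · rintro ⟨σ, hσ, h⟩; exact ⟨σ.length, h.symm ▸ hσ⟩
  · rintro ⟨n, h⟩; exact ⟨_, h, by simp⟩
theorem mem_openOf' {S : Set (List Bool)} {X : ℕ → Bool} :
    X ∈ openOf S ↔ ∃ σ ∈ S, IsPrefixOf σ X := by
  simp [openOf, _root_.cylinder]

/-! ### Sigma-1 predicates relative to an oracle -/

/-- `p` is (uniformly) c.e. in `A` -/
def Sig (A : ℕ → Bool) (p : α → Prop) : Prop :=
  ∃ h : List Bool → α → Bool, Computable (fun q : List Bool × α => h q.1 q.2) ∧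
    (∀ σ τ a, σ <+: τ → h σ a = true → h τ a = true) ∧
    ∀ a, p a ↔ ∃ ℓ, h (strPrefix A ℓ) a = true

variable {A B : ℕ → Bool}

theorem Sig.mk' {p : α → Prop} (h : List Bool → α → Bool)
    (hc : Computable (fun q : List Bool × α => h q.1 q.2))
    (hp : ∀ a, p a ↔ ∃ ℓ, h (strPrefix A ℓ) a = true) : Sig A p := by
  refine ⟨fun σ a => (List.range (σ.length + 1)).any (fun i => h (σ.take i) a), by fun_prop, ?_, ?_⟩
  · intro σ τ a hst hh
    simp only [List.any_eq_true, List.mem_range] at hh ⊢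
    obtain ⟨i, hi, hh⟩ := hh
    refine ⟨i, by have := hst.length_le; omega, ?_⟩
    obtain ⟨ρ, rfl⟩ := hst
    rwa [List.take_append_of_le_length (by omega)]
  · intro a
    rw [hp]
    constructor
    · rintro ⟨ℓ, h⟩
      refine ⟨ℓ, ?_⟩
      simp only [List.any_eq_true, List.mem_range]
      exact ⟨ℓ, by simp, by simpa using h⟩
    · rintro ⟨ℓ, h⟩
      simp only [List.any_eq_true, List.mem_range] at h
      obtain ⟨i, hi, h⟩ := h
      rw [sp_take] at h
      exact ⟨_, h⟩

theorem Sig.of_eq {p q : α → Prop} (hp : Sig A p) (h : ∀ a, p a ↔ q a) : Sig A q := by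
  rwa [show q = p from funext fun a => propext (h a).symm]

theorem Sig.dec {p : α → Prop} (hp : ComputablePred p) : Sig A p := by
  obtain ⟨f, hf, h⟩ := ComputablePred.computable_iff.1 hp
  exact Sig.mk' (fun _ a => f a) (by fun_prop) (by simp [h])

theorem Sig.comp {p : β → Prop} (hp : Sig A p) {f : α → β} (hf : Computable f) :
    Sig A (fun a => p (f a)) := by
  obtain ⟨h, hc, hm, hp⟩ := hp
  exact ⟨fun σ a => h σ (f a), by fun_prop, fun σ τ a => hm σ τ _, fun a => hp _⟩

theorem Sig.and {p q : α → Prop} (hp : Sig A p) (hq : Sig A q) : Sig A (fun a => p a ∧ q a) := by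
  obtain ⟨h, hc, hm, hp⟩ := hp
  obtain ⟨h', hc', hm', hq⟩ := hq
  refine ⟨fun σ a => h σ a && h' σ a, by fun_prop, ?_, ?_⟩
  · intro σ τ a hst hh
    simp only [Bool.and_eq_true] at hh ⊢
    exact ⟨hm _ _ _ hst hh.1, hm' _ _ _ hst hh.2⟩
  · intro a
    simp only [Bool.and_eq_true]
    rw [hp, hq]
    constructor
    · rintro ⟨⟨l, h1⟩, ⟨m, h2⟩⟩
      exact ⟨max l m, hm _ _ _ (sp_mono A (le_max_left _ _)) h1,
        hm' _ _ _ (sp_mono A (le_max_right _ _)) h2⟩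
    · rintro ⟨l, h1, h2⟩; exact ⟨⟨l, h1⟩, ⟨l, h2⟩⟩

theorem Sig.or {p q : α → Prop} (hp : Sig A p) (hq : Sig A q) : Sig A (fun a => p a ∨ q a) := by
  obtain ⟨h, hc, hm, hp⟩ := hp
  obtain ⟨h', hc', hm', hq⟩ := hq
  refine Sig.mk' (fun σ a => h σ a || h' σ a) (by fun_prop) ?_
  intro a
  simp only [Bool.or_eq_true, exists_or]
  rw [hp, hq]

theorem Sig.ex {p : α → β → Prop} (hp : Sig A (fun q : α × β => p q.1 q.2)) :
    Sig A (fun a => ∃ b, p a b) := by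
  obtain ⟨h, hc, hm, hp⟩ := hp
  refine Sig.mk' (fun σ a => (List.range (σ.length)).any fun i =>
    (Encodable.decode (α := β) i).elim false (fun b => h σ (a, b))) (by fun_prop) ?_
  intro a
  simp only [List.any_eq_true, List.mem_range, sp_length]
  constructor
  · rintro ⟨b, hb⟩
    obtain ⟨l, hl⟩ := (hp (a, b)).1 hb
    refine ⟨max l (Encodable.encode b + 1), Encodable.encode b, by omega, ?_⟩
    simpa using hm _ _ _ (sp_mono A (le_max_left _ _)) hl
  · rintro ⟨l, i, hi, h1⟩
    cases hd : Encodable.decode (α := β) i with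
    | none => simp [hd] at h1
    | some b => exact ⟨b, (hp (a, b)).2 ⟨l, by simpa [hd] using h1⟩⟩

theorem Sig.ball {p : α → ℕ → Prop} (hp : Sig A (fun q : α × ℕ => p q.1 q.2)) {n : α → ℕ}
    (hn : Computable n) : Sig A (fun a => ∀ i < n a, p a i) := by
  obtain ⟨h, hc, hm, hp⟩ := hp
  refine Sig.mk' (fun σ a => (List.range (n a)).all fun i => h σ (a, i)) (by fun_prop) ?_
  intro a
  simp only [List.all_eq_true, List.mem_range]
  constructor
  · intro H
    have : ∀ m, (∀ i < m, p a i) → ∃ l, ∀ i < m, h (strPrefix A l) (a, i) = true := by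
      intro m
      induction m with
      | zero => intro _; exact ⟨0, by simp⟩
      | succ m ih =>
        intro H
        obtain ⟨l, hl⟩ := ih (fun i hi => H i (by omega))
        obtain ⟨l', hl'⟩ := (hp (a, m)).1 (H m (by omega))
        refine ⟨max l l', fun i hi => ?_⟩
        rcases Nat.lt_succ_iff_lt_or_eq.1 hi with h1 | rfl
        · exact hm _ _ _ (sp_mono A (le_max_left _ _)) (hl i h1)
        · exact hm _ _ _ (sp_mono A (le_max_right _ _)) hl'
    exact this _ H
  · rintro ⟨l, hl⟩ i hi
    exact (hp (a, i)).2 ⟨l, hl i hi⟩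

theorem Sig.pre : Sig A (fun x : ℕ × List Bool => strPrefix A x.1 = x.2) := by
  refine Sig.mk' (fun σ x => decide (x.1 ≤ σ.length) && decide (σ.take x.1 = x.2)) (by fun_prop) ?_
  intro a
  simp only [Bool.and_eq_true, decide_eq_true_eq, sp_length, sp_take]
  constructor
  · intro h; exact ⟨a.1, le_rfl, by simpa using h⟩
  · rintro ⟨l, h1, h2⟩; rwa [min_eq_left h1] at h2

theorem Sig.prefixOf : Sig A (fun x : List Bool => IsPrefixOf x A) :=
  ((Sig.pre (A := A)).comp (f := fun σ : List Bool => (σ.length, σ)) (by fun_prop)).of_eq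
    fun _ => isPrefixOf_iff.symm

theorem Sig.app : Sig A (fun x : ℕ × Bool => A x.1 = x.2) := by
  refine Sig.mk' (fun σ x => decide (σ[x.1]? = some x.2)) (by fun_prop) ?_
  intro a
  simp only [decide_eq_true_eq]
  constructor
  · intro h; exact ⟨a.1 + 1, by rw [sp_getElem? _ _ _ (by omega), h]⟩
  · rintro ⟨l, h⟩
    have : a.1 < l := by
      by_contra hc
      rw [List.getElem?_eq_none (by simp; omega)] at h
      simp at h
    rw [sp_getElem? _ _ _ this] at h
    exact Option.some.inj h

theorem Sig.wenum : Sig A (fun x : ℕ × ℕ => WEnum x.1 x.2) := by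
  have : Sig A (fun x : ℕ × ℕ => ∃ k : ℕ, (Nat.Partrec.Code.evaln k
      (Denumerable.ofNat Nat.Partrec.Code x.1) x.2).isSome = true) :=
    Sig.ex (Sig.dec (by fun_prop))
  refine this.of_eq fun x => ?_
  simp only [WEnum, Part.dom_iff_mem, Nat.Partrec.Code.evaln_complete, Option.isSome_iff_exists]
  exact ⟨fun ⟨k, a, h⟩ => ⟨a, k, h⟩, fun ⟨k, a, h⟩ => ⟨a, k, h⟩⟩

theorem Sig.oracle : Sig A (fun x : ℕ × ℕ × ℕ => OracleComputes x.1 A x.2.1 x.2.2) := by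
  apply Sig.ex
  apply Sig.and
  · exact Sig.prefixOf.comp (by fun_prop)
  · exact Sig.wenum.comp (f := fun q : (ℕ × ℕ × ℕ) × List Bool =>
      (q.1.1, Nat.pair (Encodable.encode q.2) (Nat.pair q.1.2.1 q.1.2.2))) (by fun_prop)

/-- s-m-n -/
theorem smn_lemma (h : β → ℕ → ℕ → Bool)
    (hc : Computable (fun q : β × ℕ × ℕ => h q.1 q.2.1 q.2.2)) :
    ∃ f : β → ℕ, Computable f ∧ ∀ b n, WEnum (f b) n ↔ ∃ t, h b n t = true := by
  have hp : Partrec (fun z : ℕ => Nat.rfind (fun t =>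
      (((Encodable.decode (α := β) z.unpair.1).elim false
        (fun b => h b z.unpair.2 t) : Bool) : Part Bool))) := by
    apply Partrec.rfind
    apply Computable.partrec
    show Computable (fun q : ℕ × ℕ => (Encodable.decode (α := β) q.1.unpair.1).elim false
        (fun b => h b q.1.unpair.2 q.2))
    fun_prop
  obtain ⟨c, hcode⟩ := Nat.Partrec.Code.exists_code.1 (Partrec.nat_iff.1 hp)
  refine ⟨fun b => Encodable.encode (Nat.Partrec.Code.curry c (Encodable.encode b)), ?_, ?_⟩
  · have : Computable fun b : β => Nat.Partrec.Code.curry c (Encodable.encode b) :=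
      c2 Nat.Partrec.Code.primrec₂_curry (Computable.const c) Computable.encode
    fun_prop
  · intro b n
    simp only [WEnum, Denumerable.ofNat_encode, Nat.Partrec.Code.eval_curry, hcode]
    simp only [Nat.unpair_pair, Encodable.encodek, Option.elim_some]
    refine Nat.rfind_dom.trans ?_
    simp

theorem sig_empty_iff {p : α → Prop} : Sig emptyOracle p ↔ ∃ h : α → ℕ → Bool,
    Computable (fun q : α × ℕ => h q.1 q.2) ∧ (∀ a s t, s ≤ t → h a s = true → h a t = true) ∧
    ∀ a, p a ↔ ∃ t, h a t = true := by
  constructor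
  · rintro ⟨h, hc, hm, hp⟩
    have e : ∀ n, List.replicate n false = strPrefix emptyOracle n := by
      intro n; exact List.ext_getElem (by simp) (by intro i h1 h2; rw [sp_getElem]; simp [emptyOracle])
    refine ⟨fun a t => h (List.replicate t false) a, by fun_prop, ?_, ?_⟩
    · intro a s t hst; simp only [e]; exact hm _ _ _ (sp_mono _ hst)
    · intro a; simp only [e]; exact hp a
  · rintro ⟨h, hc, hm, hp⟩
    exact Sig.mk' (fun σ a => h a σ.length) (by fun_prop) (by simpa using hp)

theorem Sig.of_empty {p : α → Prop} (hp : Sig emptyOracle p) : Sig A p := by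
  obtain ⟨h, hc, hm, hp⟩ := sig_empty_iff.1 hp
  exact Sig.mk' (fun σ a => h a σ.length) (by fun_prop) (by simpa using hp)

theorem smn_sig {p : β → γ → Prop} (hp : Sig emptyOracle (fun q : β × γ => p q.1 q.2)) :
    ∃ f : β → ℕ, Computable f ∧ ∀ b c, WEnum (f b) (Encodable.encode c) ↔ p b c := by
  obtain ⟨h, hc, hm, hp⟩ := sig_empty_iff.1 hp
  obtain ⟨f, hf, H⟩ := smn_lemma (fun (b : β) n t =>
    (Encodable.decode (α := γ) n).elim false (fun c => h (b, c) t)) (by fun_prop)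
  exact ⟨f, hf, fun b c => by rw [H, hp (b, c)]; simp⟩

theorem smn_nat {p : β → ℕ → Prop} (hp : Sig emptyOracle (fun q : β × ℕ => p q.1 q.2)) :
    ∃ f : β → ℕ, Computable f ∧ ∀ b c, WEnum (f b) c ↔ p b c := smn_sig hp

/-- uniform indices for functionals -/
theorem oracle_index {p : (ℕ → Bool) → β → ℕ → ℕ → Prop} (h : List Bool → β × ℕ × ℕ → Bool)
    (hc : Computable (fun q : List Bool × β × ℕ × ℕ => h q.1 q.2))
    (hp : ∀ A b n m, p A b n m ↔ ∃ ℓ, h (strPrefix A ℓ) (b, n, m) = true) :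
    ∃ f : β → ℕ, Computable f ∧ ∀ A b n m, OracleComputes (f b) A n m ↔ p A b n m := by
  obtain ⟨f, hf, H⟩ := smn_lemma (fun (b : β) z (_ : ℕ) =>
    (Encodable.decode (α := List Bool × ℕ × ℕ) z).elim false
      (fun c => h c.1 (b, c.2.1, c.2.2))) (by fun_prop)
  refine ⟨f, hf, fun A b n m => ?_⟩
  rw [hp]
  have : ∀ σ : List Bool, WEnum (f b) (Nat.pair (Encodable.encode σ) (Nat.pair n m)) ↔
      h σ (b, n, m) = true := by
    intro σ
    rw [H]
    have : Nat.pair (Encodable.encode σ) (Nat.pair n m) = Encodable.encode (σ, n, m) := by simp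
    rw [this, Encodable.encodek]; simp
  simp only [OracleComputes, this, isPrefixOf_iff]
  constructor
  · rintro ⟨σ, h1, h2⟩; exact ⟨σ.length, h1.symm ▸ h2⟩
  · rintro ⟨l, h⟩; exact ⟨_, by simp, h⟩

theorem Sig.index {p : ℕ × ℕ → Prop} (hp : Sig A p) :
    ∃ e, ∀ n m, OracleComputes e A n m ↔ p (n, m) := by
  obtain ⟨h, hc, hm, hp⟩ := hp
  obtain ⟨f, -, H⟩ := oracle_index (β := Unit)
    (p := fun A _ n m => ∃ ℓ, h (strPrefix A ℓ) (n, m) = true)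
    (fun σ q => h σ q.2) (by fun_prop) (by simp)
  exact ⟨f (), fun n m => by rw [H, hp]⟩

theorem fnComputableIn_iff {f : ℕ → ℕ} :
    FnComputableIn f A ↔ Sig A (fun x : ℕ × ℕ => x.2 = f x.1) := by
  constructor
  · rintro ⟨e, he⟩
    exact (Sig.oracle.comp (f := fun x : ℕ × ℕ => (e, x.1, x.2)) (by fun_prop)).of_eq
      fun x => he _ _
  · intro h; exact h.index

theorem turingLE_iff : TuringLE B A ↔ Sig A (fun x : ℕ × Bool => B x.1 = x.2) := by
  rw [TuringLE, fnComputableIn_iff]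
  have hb : Computable natOfBool := by unfold natOfBool; fun_prop
  constructor
  · intro h
    refine (h.comp (f := fun x : ℕ × Bool => (x.1, natOfBool x.2)) (by fun_prop)).of_eq fun x => ?_
    rcases x with ⟨n, b⟩; cases b <;> cases hh : B n <;> simp [natOfBool]
  · intro h
    have h2 : Sig A (fun x : ℕ × ℕ => ∃ b : Bool, B x.1 = b ∧ x.2 = natOfBool b) := by
      apply Sig.ex
      apply Sig.and
      · exact h.comp (f := fun q : (ℕ × ℕ) × Bool => (q.1.1, q.2)) (by fun_prop)
      · exact Sig.dec (by fun_prop)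
    exact h2.of_eq fun x => by simp

theorem turingLE_of_sig (h1 : Sig A (fun n => B n = true)) (h2 : Sig A (fun n => B n = false)) :
    TuringLE B A := by
  rw [turingLE_iff]
  have : Sig A (fun x : ℕ × Bool => (B x.1 = true ∧ x.2 = true) ∨ (B x.1 = false ∧ x.2 = false)) :=
    ((h1.comp (by fun_prop)).and (Sig.dec (by fun_prop))).or
      ((h2.comp (by fun_prop)).and (Sig.dec (by fun_prop)))
  refine this.of_eq fun x => ?_
  rcases x with ⟨n, b⟩; cases b <;> cases hh : B n <;> simp

theorem TuringLE.sigT (h : TuringLE B A) : Sig A (fun n => B n = true) :=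
  (turingLE_iff.1 h).comp (f := fun n => (n, true)) (by fun_prop)
theorem TuringLE.sigF (h : TuringLE B A) : Sig A (fun n => B n = false) :=
  (turingLE_iff.1 h).comp (f := fun n => (n, false)) (by fun_prop)

theorem Sig.preTrans (h : TuringLE B A) :
    Sig A (fun x : ℕ × List Bool => strPrefix B x.1 = x.2) := by
  have h1 := turingLE_iff.1 h
  have : Sig A (fun x : ℕ × List Bool => x.2.length = x.1 ∧ ∀ i < x.1, B i = x.2.getD i false) := by
    apply Sig.and (Sig.dec (by fun_prop))
    apply Sig.ball _ (by fun_prop)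
    exact h1.comp (f := fun q : (ℕ × List Bool) × ℕ => (q.2, q.1.2.getD q.2 false)) (by fun_prop)
  refine this.of_eq fun x => ?_
  constructor
  · rintro ⟨h1, h2⟩
    apply List.ext_getElem
    · simp [h1]
    · intro i h3 h4
      rw [sp_getElem, h2 i (by simpa using h3)]
      simp [h4]
  · rintro h1
    refine ⟨by rw [← h1]; simp, fun i hi => ?_⟩
    rw [← h1, List.getD_eq_getElem?_getD, sp_getElem? _ _ _ hi]; rfl

theorem Sig.trans {p : α → Prop} (h : TuringLE B A) (hp : Sig B p) : Sig A p := by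
  obtain ⟨g, hc, hm, hp⟩ := hp
  have : Sig A (fun a => ∃ x : ℕ × List Bool, strPrefix B x.1 = x.2 ∧ g x.2 a = true) := by
    apply Sig.ex
    apply Sig.and
    · exact (Sig.preTrans h).comp (by fun_prop)
    · exact Sig.dec (by fun_prop)
  refine this.of_eq fun a => ?_
  rw [hp]
  constructor
  · rintro ⟨x, h1, h2⟩; exact ⟨x.1, by rwa [h1]⟩
  · rintro ⟨l, h⟩; exact ⟨(l, _), rfl, h⟩

theorem TuringLE.refl (A : ℕ → Bool) : TuringLE A A := turingLE_iff.2 Sig.app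
theorem TuringLE.trans' {C : ℕ → Bool} (h : TuringLE C B) (h' : TuringLE B A) : TuringLE C A :=
  turingLE_iff.2 (Sig.trans h' (turingLE_iff.1 h))

theorem TuringLE.join_left : TuringLE A (joinSet A B) := by
  rw [turingLE_iff]
  exact (Sig.app.comp (f := fun x : ℕ × Bool => (2 * x.1, x.2)) (by fun_prop)).of_eq
    fun x => by simp [joinSet]
theorem TuringLE.join_right : TuringLE B (joinSet A B) := by
  rw [turingLE_iff]
  exact (Sig.app.comp (f := fun x : ℕ × Bool => (2 * x.1 + 1, x.2)) (by fun_prop)).of_eq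
    fun x => by
      have h1 : (2 * x.1 + 1) % 2 = 1 := by omega
      have h2 : (2 * x.1 + 1) / 2 = x.1 := by omega
      simp [joinSet, h1, h2]

theorem ceIn_iff {S : Set ℕ} : CeIn A S ↔ Sig A (fun n => n ∈ S) := by
  constructor
  · rintro ⟨e, he⟩
    have : Sig A (fun n => ∃ m, OracleComputes e A n m) :=
      Sig.ex (Sig.oracle.comp (f := fun x : ℕ × ℕ => (e, x.1, x.2)) (by fun_prop))
    exact this.of_eq fun n => (he n).symm
  · intro h
    obtain ⟨e, he⟩ := (h.comp (f := fun x : ℕ × ℕ => x.1) (by fun_prop)).index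
    exact ⟨e, fun n => by simp [he]⟩

theorem ceStrIn_iff {S : Set (List Bool)} : CeStrIn A S ↔ Sig A (fun n => n ∈ S) := by
  constructor
  · rintro ⟨e, he⟩
    have : Sig A (fun σ : List Bool => ∃ m, OracleComputes e A (Encodable.encode σ) m) :=
      Sig.ex (Sig.oracle.comp (f := fun x : List Bool × ℕ => (e, Encodable.encode x.1, x.2))
        (by fun_prop))
    exact this.of_eq fun n => (he n).symm
  · intro h
    have h2 : Sig A (fun x : ℕ × ℕ => ∃ σ : List Bool, x.1 = Encodable.encode σ ∧ σ ∈ S) :=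
      Sig.ex ((Sig.dec (by fun_prop)).and (h.comp (f := fun q : (ℕ × ℕ) × List Bool => q.2)
        (by fun_prop)))
    obtain ⟨e, he⟩ := h2.index
    exact ⟨e, fun n => by simp [he]⟩

/-! ### the halting problem -/
theorem zeroJump_iff {e : ℕ} : zeroJump e = true ↔ ∃ m, OracleComputes e emptyOracle e m := by
  simp [zeroJump, jump]

theorem sig_zeroJump : Sig emptyOracle (fun e => zeroJump e = true) := by
  have : Sig emptyOracle (fun e => ∃ m, OracleComputes e emptyOracle e m) :=
    Sig.ex (Sig.oracle.comp (f := fun x : ℕ × ℕ => (x.1, x.1, x.2)) (by fun_prop))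
  exact this.of_eq fun e => zeroJump_iff.symm

theorem sig_to_zeroJump {p : α → Prop} (hp : Sig emptyOracle p) :
    ∃ f : α → ℕ, Computable f ∧ ∀ a, zeroJump (f a) = true ↔ p a := by
  obtain ⟨h, hc, hm, hp⟩ := hp
  obtain ⟨f, hf, H⟩ := oracle_index (p := fun A b _ _ => ∃ ℓ, h (strPrefix A ℓ) b = true)
    (fun σ (q : α × ℕ × ℕ) => h σ q.1) (by fun_prop) (by simp)
  exact ⟨f, hf, fun a => by rw [zeroJump_iff, hp]; simp [H]⟩

theorem Sig.not_zj {p : α → Prop} (hp : Sig emptyOracle p) : Sig zeroJump (fun a => ¬ p a) := by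
  obtain ⟨f, hf, H⟩ := sig_to_zeroJump hp
  refine ((Sig.app (A := zeroJump)).comp (f := fun a => (f a, false)) (by fun_prop)).of_eq
    fun a => ?_
  rw [← H]; simp

/-! ### uniformization and iteration -/
theorem Sig.unif {p : α → β → Prop} (hp : Sig A (fun q : α × β => p q.1 q.2))
    (tot : ∀ a, ∃ b, p a b) :
    ∃ F : α → β, (∀ a, p a (F a)) ∧ Sig A (fun q : α × β => F q.1 = q.2) := by
  classical
  obtain ⟨h, hc, hm, hp⟩ := hp
  let Q : α → ℕ → Prop := fun a k => ∃ b, ∃ l, Encodable.encode (l, b) = k ∧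
    h (strPrefix A l) (a, b) = true
  have hQ : ∀ a, ∃ k, Q a k := fun a => by
    obtain ⟨b, hb⟩ := tot a
    obtain ⟨l, hl⟩ := (hp (a, b)).1 hb
    exact ⟨Encodable.encode (l, b), b, l, rfl, hl⟩
  let k : α → ℕ := fun a => Nat.find (hQ a)
  have hk : ∀ a, Q a (k a) := fun a => Nat.find_spec (hQ a)
  choose F L hF using hk
  refine ⟨F, fun a => (hp (a, F a)).2 ⟨_, (hF a).2⟩, ?_⟩
  have s1 : Sig A (fun q : α × ℕ => ¬ Q q.1 q.2) := by
    have : Sig A (fun q : α × ℕ => ∃ ρ : List Bool,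
        strPrefix A ((Encodable.decode (α := ℕ × β) q.2).elim 0 (fun x => x.1)) = ρ ∧
        ((Encodable.decode (α := ℕ × β) q.2).elim false
          (fun x => decide (Encodable.encode x = q.2) && h ρ (q.1, x.2))) = false) := by
      apply Sig.ex
      apply Sig.and
      · exact Sig.pre.comp (f := fun q : (α × ℕ) × List Bool =>
          ((Encodable.decode (α := ℕ × β) q.1.2).elim 0 (fun x => x.1), q.2)) (by fun_prop)
      · exact Sig.dec (by fun_prop)
    refine this.of_eq fun q => ?_
    simp only [Q]
    cases hd : Encodable.decode (α := ℕ × β) q.2 with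
    | none =>
      simp only [Option.elim_none, exists_eq_left', true_iff]
      rintro ⟨b, l, h1, -⟩
      rw [← h1, Encodable.encodek] at hd; simp at hd
    | some x =>
      simp only [Option.elim_some, exists_eq_left', Bool.and_eq_false_iff, decide_eq_false_iff_not]
      constructor
      · rintro h1 ⟨b, l, h2, h3⟩
        rw [← h2, Encodable.encodek] at hd
        have hx := Option.some.inj hd
        subst hx
        rcases h1 with h1 | h1
        · exact h1 h2
        · simp only at h1; rw [h1] at h3; simp at h3
      · intro h1
        by_cases h2 : Encodable.encode x = q.2
        · right
          by_contra h3
          exact h1 ⟨x.2, x.1, h2, by simpa using h3⟩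
        · exact Or.inl h2
  have s2 : Sig A (fun q : α × β => ∃ r : ℕ × List Bool, strPrefix A r.1 = r.2 ∧
      h r.2 q = true ∧ ∀ i < Encodable.encode (r.1, q.2), ¬ Q q.1 i) := by
    apply Sig.ex
    apply Sig.and
    · exact Sig.pre.comp (by fun_prop)
    apply Sig.and
    · exact Sig.dec (by fun_prop)
    · apply Sig.ball _ (by fun_prop)
      exact s1.comp (f := fun q : ((α × β) × ℕ × List Bool) × ℕ => (q.1.1.1, q.2)) (by fun_prop)
  refine s2.of_eq fun q => ?_
  rcases q with ⟨a, b⟩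
  constructor
  · rintro ⟨⟨l, ρ⟩, h1, h2, h3⟩
    have hq : Q a (Encodable.encode (l, b)) :=
      ⟨b, l, rfl, by simp only at h1 h2; rwa [h1]⟩
    have : k a = Encodable.encode (l, b) := (Nat.find_eq_iff _).2 ⟨hq, fun n hn => h3 n hn⟩
    have h4 := (hF a).1
    rw [this] at h4
    have h4 := Encodable.encode_injective h4
    simp only [Prod.mk.injEq] at h4
    exact h4.2
  · rintro h4
    simp only at h4
    subst h4
    refine ⟨(L a, _), rfl, (hF a).2, fun i hi => ?_⟩
    have := (hF a).1
    exact Nat.find_min (hQ a) (by show i < k a; rw [← this]; exact hi)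

theorem Sig.iter {F : α → α} (hF : Sig A (fun q : α × α => F q.1 = q.2)) (x₀ : α) :
    Sig A (fun q : ℕ × α => F^[q.1] x₀ = q.2) := by
  have : Sig A (fun q : ℕ × α => ∃ L : List α, L[0]? = some x₀ ∧ L[q.1]? = some q.2 ∧
      ∀ i < q.1, ∃ y : α × α, L[i]? = some y.1 ∧ L[i+1]? = some y.2 ∧ F y.1 = y.2) := by
    classical
    apply Sig.ex
    apply Sig.and (Sig.dec (by fun_prop))
    apply Sig.and (Sig.dec (by fun_prop))
    apply Sig.ball _ (by fun_prop)
    apply Sig.ex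
    apply Sig.and (Sig.dec (by fun_prop))
    apply Sig.and (Sig.dec (by fun_prop))
    exact hF.comp (f := fun q : (((ℕ × α) × List α) × ℕ) × α × α => q.2) (by fun_prop)
  refine this.of_eq fun q => ?_
  constructor
  · rintro ⟨L, h0, h1, h2⟩
    have : ∀ i ≤ q.1, L[i]? = some (F^[i] x₀) := by
      intro i
      induction i with
      | zero => intro _; exact h0
      | succ i ih =>
        intro hi
        obtain ⟨y, h3, h4, h5⟩ := h2 i (by omega)
        rw [ih (by omega)] at h3
        rw [h4, ← h5, Function.iterate_succ_apply', Option.some.inj h3]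
    rw [this _ le_rfl] at h1
    exact Option.some.inj h1
  · intro h
    have hr : ∀ i < q.1 + 1, ((List.range (q.1 + 1)).map (fun i => F^[i] x₀))[i]? =
        some (F^[i] x₀) := by
      intro i hi; rw [List.getElem?_map, List.getElem?_range hi]; rfl
    refine ⟨(List.range (q.1 + 1)).map (fun i => F^[i] x₀), hr 0 (by omega), by rw [hr _ (by omega), h], fun i hi =>
      ⟨(F^[i] x₀, F^[i+1] x₀), ?_, ?_, ?_⟩⟩
    · exact hr _ (by omega)
    · exact hr _ (by omega)
    · simp only [Function.iterate_succ_apply']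

/-! ### limit lemma -/
theorem limit_lemma (hA : TuringLE A zeroJump) : ∃ a : ℕ → ℕ → Bool,
    Computable (fun q : ℕ × ℕ => a q.1 q.2) ∧ ∀ n, ∃ t₀, ∀ t ≥ t₀, a t n = A n := by
  obtain ⟨h, hc, hm, hp⟩ := turingLE_iff.1 hA
  obtain ⟨g, gc, gm, gp⟩ := sig_empty_iff.1 sig_zeroJump
  let st : ℕ → List Bool := fun t => (List.range t).map (fun i => g i t)
  let fnd : ℕ → ℕ → ℕ := fun t n => ((List.range t).find? (fun l =>
    h ((st t).take l) (n, true) || h ((st t).take l) (n, false))).getD 0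
  have cst : Computable st := by fun_prop
  refine ⟨fun t n => h ((st t).take (fnd t n)) (n, true), by fun_prop, fun n => ?_⟩
  have ex : ∃ l, (h (strPrefix zeroJump l) (n, true) || h (strPrefix zeroJump l) (n, false))
      = true := by
    obtain ⟨l, hl⟩ := (hp (n, A n)).1 rfl
    refine ⟨l, ?_⟩
    cases hA : A n <;> simp [hA] at hl <;> simp [hl]
  have hconv : ∀ l, ∃ t₀, ∀ t ≥ t₀, ∀ i < l, g i t = zeroJump i := by
    intro l
    induction l with
    | zero => exact ⟨0, by simp⟩
    | succ l ih =>
      obtain ⟨t₀, ht⟩ := ih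
      by_cases hz : zeroJump l = true
      · obtain ⟨t₁, h1⟩ := (gp l).1 hz
        refine ⟨max t₀ t₁, fun t htt i hi => ?_⟩
        rcases Nat.lt_succ_iff_lt_or_eq.1 hi with h2 | rfl
        · exact ht t (le_trans (le_max_left _ _) htt) i h2
        · rw [hz]; exact gm _ _ _ (le_trans (le_max_right _ _) htt) h1
      · refine ⟨t₀, fun t htt i hi => ?_⟩
        rcases Nat.lt_succ_iff_lt_or_eq.1 hi with h2 | rfl
        · exact ht t htt i h2
        · rw [Bool.not_eq_true] at hz
          rw [hz]
          by_contra hc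
          rw [Bool.not_eq_false] at hc
          have := (gp i).2 ⟨t, hc⟩
          simp [hz] at this
  let l₀ := Nat.find ex
  have hl₀ := Nat.find_spec ex
  obtain ⟨t₀, ht⟩ := hconv l₀
  refine ⟨max t₀ (l₀ + 1), fun t htt => ?_⟩
  have e1 : ∀ l ≤ l₀, (st t).take l = strPrefix zeroJump l := by
    intro l hl
    have hl2 : l ≤ t := by omega
    apply List.ext_getElem
    · simp [st, hl2]
    · intro i h1 h2
      simp only [st, List.getElem_take, List.getElem_map, List.getElem_range]
      rw [sp_getElem, ht t (by omega) i (by simp at h2; omega)]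
  have e2 : fnd t n = l₀ := by
    simp only [fnd]
    have : (List.range t).find? (fun l =>
        h ((st t).take l) (n, true) || h ((st t).take l) (n, false)) = some l₀ := by
      rw [List.find?_range_eq_some]
      refine ⟨by rw [e1 l₀ le_rfl]; exact hl₀, by simp; omega, fun j hj => ?_⟩
      rw [e1 j (by omega)]
      have := Nat.find_min ex hj
      simpa using this
    rw [this]; rfl
  simp only [e2, e1 l₀ le_rfl]
  cases hh : h (strPrefix zeroJump l₀) (n, true) with
  | true => exact ((hp (n, true)).2 ⟨_, hh⟩).symm
  | false =>
    have h5 : h (strPrefix zeroJump l₀) (n, false) = true := by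
      have h6 := hl₀; rw [hh, Bool.false_or] at h6; exact h6
    exact ((hp (n, false)).2 ⟨_, h5⟩).symm

end SigLib

end

section
open MeasureTheory ENNReal

section Meas

/-! ### strings and numbers -/
theorem mem_strs {n : ℕ} {σ : List Bool} : σ ∈ strs n ↔ σ.length = n := by
  induction n generalizing σ with
  | zero => simp [strs]
  | succ n ih =>
    simp only [strs, List.mem_flatMap, ih]
    constructor
    · rintro ⟨τ, h1, h2⟩
      simp only [List.mem_cons, List.not_mem_nil, or_false] at h2
      rcases h2 with rfl | rfl <;> simp [h1]
    · intro h
      have hne : σ ≠ [] := by rintro rfl; simp at h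
      refine ⟨σ.dropLast, by simp [h], ?_⟩
      have := List.dropLast_append_getLast hne
      cases hl : σ.getLast hne <;> rw [hl] at this <;> simp [this]

theorem strs_nodup (n : ℕ) : (strs n).Nodup := by
  induction n with
  | zero => simp [strs]
  | succ n ih =>
    rw [strs, List.nodup_flatMap]
    refine ⟨fun σ _ => by simp, ?_⟩
    refine ih.imp ?_
    intro a b hab
    simp only [Function.onFun, List.disjoint_cons_left, List.mem_cons, List.not_mem_nil, or_false]
    refine ⟨?_, ?_, List.disjoint_nil_left _⟩ <;>
      (rintro (h | h) <;> exact hab (List.append_inj' h rfl).1)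

theorem strs_length (n : ℕ) : (strs n).length = 2 ^ n := by
  induction n with
  | zero => simp [strs]
  | succ n ih => rw [strs, List.length_flatMap]; simp [ih, pow_succ]

/-- value of a string, most significant bit first -/
def num (σ : List Bool) : ℕ := σ.foldl (fun n b => 2 * n + cond b 1 0) 0

@[simp] theorem num_nil : num [] = 0 := rfl
theorem num_concat (σ : List Bool) (b : Bool) : num (σ ++ [b]) = 2 * num σ + cond b 1 0 := by
  simp [num]
theorem num_lt (σ : List Bool) : num σ < 2 ^ σ.length := by
  induction σ using List.reverseRecOn with
  | nil => simp
  | append_singleton l a ih =>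
    rw [num_concat, List.length_append, List.length_singleton, pow_succ]
    cases a <;> simp <;> omega
theorem num_inj {σ τ : List Bool} (hl : σ.length = τ.length) (h : num σ = num τ) : σ = τ := by
  induction σ using List.reverseRecOn generalizing τ with
  | nil => simp at hl; exact (List.eq_nil_of_length_eq_zero hl.symm).symm
  | append_singleton l a ih =>
    have hne : τ ≠ [] := by rintro rfl; simp at hl
    obtain ⟨t, b, rfl⟩ : ∃ t b, τ = t ++ [b] := ⟨_, _, (List.dropLast_append_getLast hne).symm⟩
    rw [num_concat, num_concat] at h
    have : num l = num t ∧ a = b := by cases a <;> cases b <;> simp at h ⊢ <;> omega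
    rw [ih (by simpa using hl) this.1, this.2]
theorem num_take (σ : List Bool) (n : ℕ) (hn : n ≤ σ.length) :
    num (σ.take n) = num σ / 2 ^ (σ.length - n) := by
  induction σ using List.reverseRecOn with
  | nil => simp
  | append_singleton l a ih =>
    rcases Nat.lt_or_ge l.length n with h | h
    · have : n = (l ++ [a]).length := by simp at hn ⊢; omega
      rw [this, List.take_length]; simp
    · rw [List.take_append_of_le_length h, ih h, num_concat]
      have : (l ++ [a]).length - n = (l.length - n) + 1 := by simp; omega
      rw [this, pow_succ, mul_comm _ 2, ← Nat.div_div_eq_div_mul]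
      congr 1
      cases a <;> simp <;> omega
@[fun_prop] theorem cNum {α : Type} [Primcodable α] {f : α → List Bool} (h : Computable f) :
    Computable (fun x => num (f x)) := by unfold num; fun_prop

/-! ### the measure -/
theorem num_digits {x : ℝ} (h0 : 0 ≤ x) (h1 : x < 1) (n : ℕ) :
    (num (strPrefix (binaryDigits x) n) : ℤ) = ⌊x * 2 ^ n⌋ := by
  induction n with
  | zero => simp [strPrefix]; symm; rw [Int.floor_eq_zero_iff]; exact ⟨h0, h1⟩
  | succ n ih =>
    rw [sp_succ, num_concat]
    push_cast
    rw [ih]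
    have h2 : ⌊x * 2 ^ n⌋ = ⌊x * 2 ^ (n+1)⌋ / 2 := by
      have : x * 2 ^ n = x * 2 ^ (n+1) / (2 : ℕ) := by rw [pow_succ]; push_cast; ring
      rw [this, Int.floor_div_natCast]; rfl
    rw [h2]
    simp only [binaryDigits]
    by_cases h : ⌊x * 2 ^ (n+1)⌋ % 2 = 1
    · simp [h]; omega
    · simp [h]; omega

theorem measurable_binaryDigits : Measurable binaryDigits := by
  rw [measurable_pi_iff]
  intro n
  have : Measurable (fun x : ℝ => ⌊x * 2 ^ (n+1)⌋) := Int.measurable_floor.comp (by fun_prop)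
  exact (measurable_of_countable (fun z : ℤ => decide (z % 2 = 1))).comp this

theorem measurableSet_sp (p : List Bool → Prop) (n : ℕ) : MeasurableSet {Y | p (strPrefix Y n)} := by
  have : {Y : ℕ → Bool | p (strPrefix Y n)} =
      ⋃ σ ∈ {σ : List Bool | p σ}, {Y | strPrefix Y n = σ} := by
    ext Y; simp
  rw [this]
  refine MeasurableSet.biUnion (Set.to_countable _) fun σ _ => ?_
  have : {Y | strPrefix Y n = σ} = {Y : ℕ → Bool | σ.length = n ∧ ∀ i < n, Y i = σ.getD i false} := by
    ext Y
    simp only [Set.mem_ofPred_eq]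
    constructor
    · rintro rfl
      exact ⟨by simp, fun i hi => by rw [List.getD_eq_getElem?_getD, sp_getElem? _ _ _ hi]; rfl⟩
    · rintro ⟨h1, h2⟩
      apply List.ext_getElem (by simp [h1])
      intro i h3 h4
      rw [sp_getElem, h2 i (by simpa using h3)]; simp [h4]
  rw [this]
  measurability

theorem measurableSet_cyl (σ : List Bool) : MeasurableSet (cylinder σ) := by
  have : cylinder σ = {Y | strPrefix Y σ.length = σ} := by ext; exact mem_cyl
  rw [this]; exact measurableSet_sp (fun τ => τ = σ) _

theorem mu_cyl (σ : List Bool) : μCantor (cylinder σ) = 2⁻¹ ^ σ.length := by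
  rw [μCantor, Measure.map_apply measurable_binaryDigits (measurableSet_cyl σ),
    Measure.restrict_apply (measurable_binaryDigits (measurableSet_cyl σ))]
  have : binaryDigits ⁻¹' cylinder σ ∩ Set.Ico 0 1 =
      Set.Ico ((num σ : ℝ) / 2 ^ σ.length) ((num σ + 1 : ℝ) / 2 ^ σ.length) := by
    ext x
    have hp : (0 : ℝ) < 2 ^ σ.length := by positivity
    simp only [Set.mem_inter_iff, Set.mem_preimage, mem_cyl, Set.mem_Ico]
    rw [div_le_iff₀ hp, lt_div_iff₀ hp]
    constructor
    · rintro ⟨h, h0, h1⟩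
      have hd := num_digits h0 h1 σ.length
      rw [h] at hd
      have e1 := Int.floor_le (x * 2 ^ σ.length)
      have e2 := Int.lt_floor_add_one (x * 2 ^ σ.length)
      rw [← hd] at e1 e2
      exact ⟨by exact_mod_cast e1, by exact_mod_cast e2⟩
    · rintro ⟨h1, h2⟩
      have h3 : (num σ : ℝ) + 1 ≤ 2 ^ σ.length := by exact_mod_cast num_lt σ
      have h0 : 0 ≤ x := by
        by_contra hc
        push Not at hc
        have : x * 2 ^ σ.length < 0 := mul_neg_of_neg_of_pos hc hp
        have : (0 : ℝ) ≤ num σ := by positivity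
        linarith
      have h4 : x < 1 := by
        by_contra hc
        push Not at hc
        have : 2 ^ σ.length ≤ x * 2 ^ σ.length := le_mul_of_one_le_left hp.le hc
        linarith
      refine ⟨?_, h0, h4⟩
      apply num_inj (by simp)
      have := num_digits h0 h4 σ.length
      have h5 : ⌊x * 2 ^ σ.length⌋ = (num σ : ℤ) := by
        rw [Int.floor_eq_iff]; exact ⟨by exact_mod_cast h1, by exact_mod_cast h2⟩
      rw [h5] at this; exact_mod_cast this
  rw [this, Real.volume_Ico]
  have : (num σ + 1 : ℝ) / 2 ^ σ.length - num σ / 2 ^ σ.length = (2 ^ σ.length)⁻¹ := by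
    field_simp; ring
  rw [this, ENNReal.ofReal_inv_of_pos (by positivity), ENNReal.ofReal_pow (by norm_num)]
  simp [ENNReal.inv_pow]

instance : IsProbabilityMeasure μCantor := ⟨by
  have : (Set.univ : Set (ℕ → Bool)) = cylinder [] := by ext; simp [mem_cyl, strPrefix]
  rw [this, mu_cyl]; simp⟩

theorem cyl_disjoint {σ τ : List Bool} (hl : σ.length = τ.length) (h : σ ≠ τ) :
    Disjoint (cylinder σ) (cylinder τ) := by
  rw [Set.disjoint_left]
  intro X h1 h2
  rw [mem_cyl] at h1 h2
  exact h (by rw [← h1, ← h2, hl])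

/-- number of strings of length n satisfying h -/
def cnt (h : List Bool → Bool) (n : ℕ) : ℕ := (strs n).countP h

theorem cnt_le (h : List Bool → Bool) (n : ℕ) : cnt h n ≤ 2 ^ n :=
  (List.countP_le_length).trans (strs_length n).le

theorem mu_level (h : List Bool → Bool) (n : ℕ) :
    μCantor {Y | h (strPrefix Y n) = true} = cnt h n * 2⁻¹ ^ n := by
  have : {Y | h (strPrefix Y n) = true} = ⋃ σ ∈ ((strs n).filter h).toFinset, cylinder σ := by
    ext Y
    simp only [Set.mem_ofPred_eq, List.mem_toFinset, List.mem_filter, mem_strs, Set.mem_iUnion,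
      mem_cyl]
    constructor
    · intro hh; exact ⟨_, ⟨by simp, hh⟩, by simp⟩
    · rintro ⟨σ, ⟨h1, h2⟩, h3⟩; rw [← h1, h3]; exact h2
  rw [this, measure_biUnion_finset]
  · rw [Finset.sum_congr rfl (g := fun _ => 2⁻¹ ^ n)]
    · rw [Finset.sum_const, List.toFinset_card_of_nodup ((strs_nodup n).filter _), nsmul_eq_mul,
        cnt, List.countP_eq_length_filter]
    · intro σ hσ
      simp only [List.mem_toFinset, List.mem_filter, mem_strs] at hσ
      rw [mu_cyl, hσ.1]
  · intro σ hσ τ hτ hne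
    simp only [Finset.mem_coe, List.mem_toFinset, List.mem_filter, mem_strs] at hσ hτ
    exact cyl_disjoint (by rw [hσ.1, hτ.1]) hne
  · exact fun σ _ => measurableSet_cyl σ

theorem mu_level_le_iff (h : List Bool → Bool) (n m : ℕ) :
    μCantor {Y | h (strPrefix Y n) = true} ≤ 2⁻¹ ^ m ↔ cnt h n * 2 ^ m ≤ 2 ^ n := by
  rw [mu_level, ← ENNReal.inv_pow, ← ENNReal.inv_pow, ← div_eq_mul_inv,
    ENNReal.div_le_iff (by simp) (by simp)]
  rw [mul_comm, ← div_eq_mul_inv, ENNReal.le_div_iff_mul_le (by simp) (by simp)]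
  exact_mod_cast Iff.rfl

/-- monotone Boolean function on strings -/
def Mon (h : List Bool → Bool) : Prop := ∀ σ τ, σ <+: τ → h σ = true → h τ = true

/-- open set given by h -/
def Op (h : List Bool → Bool) : Set (ℕ → Bool) := {Y | ∃ n, h (strPrefix Y n) = true}

theorem Op_eq (h : List Bool → Bool) : Op h = ⋃ n, {Y | h (strPrefix Y n) = true} := by
  ext; simp [Op]
theorem measurableSet_Op (h : List Bool → Bool) : MeasurableSet (Op h) := by
  rw [Op_eq]; exact MeasurableSet.iUnion fun n => measurableSet_sp (fun σ => h σ = true) n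
theorem Mon.monotone {h : List Bool → Bool} (hm : Mon h) :
    Monotone fun n => {Y | h (strPrefix Y n) = true} :=
  fun _ _ hab Y hY => hm _ _ (sp_mono Y hab) hY
theorem mu_Op {h : List Bool → Bool} (hm : Mon h) :
    μCantor (Op h) = ⨆ n, μCantor {Y | h (strPrefix Y n) = true} := by
  rw [Op_eq, hm.monotone.measure_iUnion]
theorem mu_Op_le {h : List Bool → Bool} (hm : Mon h) {q : ℝ≥0∞}
    (hq : ∀ n, μCantor {Y | h (strPrefix Y n) = true} ≤ q) : μCantor (Op h) ≤ q := by
  rw [mu_Op hm]; exact iSup_le hq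
theorem le_mu_Op (h : List Bool → Bool) (n : ℕ) :
    μCantor {Y | h (strPrefix Y n) = true} ≤ μCantor (Op h) :=
  measure_mono fun _ hY => ⟨n, hY⟩

/-- truncation of an open set to measure at most 2^-m -/
def trunc (h : List Bool → Bool) (m : ℕ) (ρ : List Bool) : Bool :=
  (List.range (ρ.length + 1)).any fun s => h (ρ.take s) && decide (cnt h s * 2 ^ m ≤ 2 ^ s)

theorem trunc_iff {h : List Bool → Bool} {m : ℕ} {ρ : List Bool} : trunc h m ρ = true ↔
    ∃ s ≤ ρ.length, h (ρ.take s) = true ∧ cnt h s * 2 ^ m ≤ 2 ^ s := by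
  simp [trunc, Nat.lt_succ_iff]
theorem take_of_prefix {σ τ : List Bool} (h : σ <+: τ) {s : ℕ} (hs : s ≤ σ.length) :
    τ.take s = σ.take s := by
  obtain ⟨ρ, rfl⟩ := h
  rw [List.take_append_of_le_length hs]
theorem trunc_mon (h : List Bool → Bool) (m : ℕ) : Mon (trunc h m) := by
  intro σ τ hst hh
  rw [trunc_iff] at *
  obtain ⟨s, h1, h2, h3⟩ := hh
  exact ⟨s, h1.trans hst.length_le, by rwa [take_of_prefix hst h1], h3⟩
theorem mu_trunc {h : List Bool → Bool} (hm : Mon h) (m : ℕ) : μCantor (Op (trunc h m)) ≤ 2⁻¹ ^ m := by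
  refine mu_Op_le (trunc_mon h m) fun n => ?_
  classical
  let F := (Finset.range (n+1)).filter fun s => cnt h s * 2 ^ m ≤ 2 ^ s
  by_cases hF : F.Nonempty
  · obtain ⟨s, hs, hmax⟩ := F.exists_max_image id hF
    simp only [F, Finset.mem_filter, Finset.mem_range] at hs hmax
    refine (measure_mono ?_).trans ((mu_level_le_iff h s m).2 hs.2)
    intro Y hY
    simp only [Set.mem_ofPred_eq, trunc_iff, sp_length, sp_take] at hY ⊢
    obtain ⟨s', h1, h2, h3⟩ := hY
    rw [min_eq_left h1] at h2
    exact hm _ _ (sp_mono Y (hmax s' ⟨by omega, h3⟩)) h2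
  · have : {Y | trunc h m (strPrefix Y n) = true} = ∅ := by
      ext Y
      simp only [Set.mem_ofPred_eq, trunc_iff, sp_length, Set.mem_empty_iff_false, iff_false]
      rintro ⟨s, h1, h2, h3⟩
      exact hF ⟨s, by simp [F]; exact ⟨by omega, h3⟩⟩
    rw [this]; simp
theorem trunc_of_le {h : List Bool → Bool} {m : ℕ} (hle : μCantor (Op h) ≤ 2⁻¹ ^ m)
    {ρ : List Bool} (hρ : h ρ = true) : trunc h m ρ = true := by
  rw [trunc_iff]
  exact ⟨ρ.length, le_rfl, by simpa using hρ,
    (mu_level_le_iff h _ m).1 ((le_mu_Op h _).trans hle)⟩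
theorem trunc_sub {h : List Bool → Bool} {m : ℕ} {ρ : List Bool} (hm : Mon h)
    (hρ : trunc h m ρ = true) : h ρ = true := by
  rw [trunc_iff] at hρ
  obtain ⟨s, h1, h2, h3⟩ := hρ
  exact hm _ _ (List.take_prefix _ _) h2

variable {α : Type} [Primcodable α]
@[fun_prop] theorem cCnt {h : α → List Bool → Bool} {n : α → ℕ}
    (hh : Computable (fun q : α × List Bool => h q.1 q.2)) (hn : Computable n) :
    Computable (fun a => cnt (h a) (n a)) := by unfold cnt; fun_prop
@[fun_prop] theorem cTrunc {h : α → List Bool → Bool} {m : α → ℕ} {ρ : α → List Bool}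
    (hh : Computable (fun q : α × List Bool => h q.1 q.2)) (hm : Computable m)
    (hρ : Computable ρ) : Computable (fun a => trunc (h a) (m a) (ρ a)) := by
  unfold trunc; fun_prop

/-! ### open sets from strings -/
theorem measurableSet_openOf (S : Set (List Bool)) : MeasurableSet (openOf S) :=
  MeasurableSet.biUnion (Set.to_countable S) fun σ _ => measurableSet_cyl σ
theorem mu_openOf_le (S : Set (List Bool)) : μCantor (openOf S) ≤ weight S := by
  rw [openOf, weight]
  refine (measure_biUnion_le _ (Set.to_countable S) _).trans ?_
  simp only [mu_cyl]; exact le_rfl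

theorem Op_eq_openOf (h : List Bool → Bool) : Op h = openOf {σ | h σ = true} := by
  ext Y; rw [mem_openOf]; rfl

/-! ### tests -/
theorem test_lemma {A X : ℕ → Bool} {R : ℕ → List Bool → Prop}
    (hR : Sig A (fun q : ℕ × List Bool => R q.1 q.2))
    (hμ : ∀ n, μCantor (openOf {σ | R n σ}) ≤ 2⁻¹ ^ n) (hX : MLRandomIn A X) :
    ∃ n, X ∉ openOf {σ | R n σ} := by
  have h2 : Sig A (fun x : ℕ × ℕ => ∃ q : ℕ × List Bool,
      x.1 = Nat.pair q.1 (Encodable.encode q.2) ∧ R q.1 q.2) :=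
    Sig.ex ((Sig.dec (by fun_prop)).and (hR.comp (f := fun q : (ℕ × ℕ) × ℕ × List Bool => q.2)
      (by fun_prop)))
  obtain ⟨e, he⟩ := h2.index
  refine hX (fun n => openOf {σ | R n σ}) ⟨⟨e, fun n => ?_⟩, hμ⟩
  simp only [testLevel, he]
  congr 1; ext σ
  simp only [Set.mem_ofPred_eq]
  constructor
  · intro h; exact ⟨0, (n, σ), rfl, h⟩
  · rintro ⟨-, ⟨n', σ'⟩, h1, h2⟩
    simp only [Nat.pair_eq_pair, Encodable.encode_inj] at h1
    rw [h1.1, h1.2]; exact h2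

/-- tests given by computable monotone functions -/
theorem test_lemma' {A X : ℕ → Bool} {C : ℕ → Set (ℕ → Bool)} {R : ℕ → List Bool → Prop}
    (hR : Sig A (fun q : ℕ × List Bool => R q.1 q.2)) (hC : ∀ n, C n = openOf {σ | R n σ})
    (K : ℕ) (hμ : ∀ n, μCantor (C n) ≤ 2 ^ K * 2⁻¹ ^ n) (hX : MLRandomIn A X) :
    ∃ n, X ∉ C n := by
  obtain ⟨n, hn⟩ := test_lemma (R := fun n σ => R (n + K) σ)
    (hR.comp (f := fun q : ℕ × List Bool => (q.1 + K, q.2)) (by fun_prop)) (fun n => by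
      rw [← hC]
      refine (hμ _).trans (le_of_eq ?_)
      rw [pow_add, mul_comm, mul_assoc, ← mul_pow, ENNReal.inv_mul_cancel (by simp) (by simp)]
      simp) hX
  exact ⟨n + K, by rw [hC]; exact hn⟩

theorem MLRandomIn.mono {A B X : ℕ → Bool} (h : TuringLE B A) (hX : MLRandomIn A X) :
    MLRandomIn B X := by
  rintro G ⟨⟨e, he⟩, hμ⟩
  have : Sig A (fun q : ℕ × List Bool =>
      ∃ m, OracleComputes e B (Nat.pair q.1 (Encodable.encode q.2)) m) := by
    apply Sig.ex
    exact (Sig.trans h Sig.oracle).comp (f := fun q : (ℕ × List Bool) × ℕ =>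
      (e, Nat.pair q.1.1 (Encodable.encode q.1.2), q.2)) (by fun_prop)
  obtain ⟨n, hn⟩ := test_lemma this (fun n => by rw [← testLevel, ← he]; exact hμ n) hX
  exact ⟨n, by rw [he]; exact hn⟩

theorem emptyOracle_le (A : ℕ → Bool) : TuringLE emptyOracle A := by
  rw [turingLE_iff]; exact Sig.dec (by unfold emptyOracle; fun_prop)
theorem MLRandomIn.toRandom {A X : ℕ → Bool} (hX : MLRandomIn A X) : MLRandom X :=
  hX.mono (emptyOracle_le A)

/-! ### universal oracle test -/
/-- σ lies in level n of the e-th test by stage |τ| with oracle τ -/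
def lev (e n : ℕ) (τ σ : List Bool) : Bool :=
  (List.range (σ.length + 1)).any fun i => (List.range (τ.length + 1)).any fun j =>
    (List.range τ.length).any fun m => (Nat.Partrec.Code.evaln τ.length
      (Denumerable.ofNat Nat.Partrec.Code e) (Nat.pair (Encodable.encode (τ.take j))
        (Nat.pair (Nat.pair n (Encodable.encode (σ.take i))) m))).isSome

@[fun_prop] theorem cLev {e n : α → ℕ} {τ σ : α → List Bool} (he : Computable e)
    (hn : Computable n) (hτ : Computable τ) (hσ : Computable σ) :
    Computable (fun a => lev (e a) (n a) (τ a) (σ a)) := by unfold lev; fun_prop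

theorem lev_mono {e n : ℕ} {τ τ' σ σ' : List Bool} (h : τ <+: τ') (h' : σ <+: σ')
    (hl : lev e n τ σ = true) : lev e n τ' σ' = true := by
  simp only [lev, List.any_eq_true, List.mem_range] at hl ⊢
  obtain ⟨i, hi, j, hj, m, hm, hh⟩ := hl
  have l1 := h.length_le
  have l2 := h'.length_le
  refine ⟨i, by omega, j, by omega, m, by omega, ?_⟩
  rw [take_of_prefix h (by omega), take_of_prefix h' (by omega)]
  rw [Option.isSome_iff_exists] at hh ⊢
  obtain ⟨a, ha⟩ := hh
  exact ⟨a, Nat.Partrec.Code.evaln_mono l1 ha⟩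

/-- h(τ,σ) along the oracle A -/
def along (h : List Bool → List Bool → Bool) (A : ℕ → Bool) (σ : List Bool) : Bool :=
  h (strPrefix A σ.length) σ

theorem lev_mon (e n : ℕ) (A : ℕ → Bool) : Mon (along (lev e n) A) := by
  intro σ τ hst h
  exact lev_mono (sp_mono A hst.length_le) hst h

theorem testLevel_eq (e n : ℕ) (A : ℕ → Bool) : testLevel e A n = Op (along (lev e n) A) := by
  ext Y
  simp only [testLevel, mem_openOf, Op, along, Set.mem_ofPred_eq, sp_length]
  constructor
  · rintro ⟨i, m, ρ, h1, h2⟩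
    rw [isPrefixOf_iff] at h1
    rw [WEnum, Part.dom_iff_mem] at h2
    obtain ⟨y, hy⟩ := h2
    rw [Nat.Partrec.Code.evaln_complete] at hy
    obtain ⟨k, hk⟩ := hy
    refine ⟨max (max i (m+1)) (max ρ.length k), ?_⟩
    simp only [lev, List.any_eq_true, List.mem_range, sp_length, sp_take]
    refine ⟨i, by omega, ρ.length, by omega, m, by omega, ?_⟩
    rw [min_eq_left (by omega), min_eq_left (by omega), h1, Option.isSome_iff_exists]
    exact ⟨y, Nat.Partrec.Code.evaln_mono (by omega) hk⟩
  · rintro ⟨L, h⟩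
    simp only [lev, List.any_eq_true, List.mem_range, sp_length, sp_take] at h
    obtain ⟨i, hi, j, hj, m, hm, hh⟩ := h
    rw [min_eq_left (by omega), min_eq_left (by omega), Option.isSome_iff_exists] at hh
    obtain ⟨y, hy⟩ := hh
    refine ⟨i, m, strPrefix A j, isPrefixOf_iff.2 (by simp), ?_⟩
    rw [WEnum, Part.dom_iff_mem]
    exact ⟨y, Nat.Partrec.Code.evaln_sound hy⟩

/-- universal test -/
def univ (κ : ℕ) (τ σ : List Bool) : Bool :=
  (List.range τ.length).any fun e => (List.range (τ.length + 1)).any fun s =>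
    lev e (e + κ + 1) (τ.take s) (σ.take s) &&
      decide (cnt (lev e (e + κ + 1) (τ.take s)) s * 2 ^ (e + κ + 1) ≤ 2 ^ s)

@[fun_prop] theorem cUniv {κ : α → ℕ} {τ σ : α → List Bool} (hκ : Computable κ)
    (hτ : Computable τ) (hσ : Computable σ) :
    Computable (fun a => univ (κ a) (τ a) (σ a)) := by unfold univ; fun_prop

theorem univ_iff {κ L : ℕ} {A Y : ℕ → Bool} : univ κ (strPrefix A L) (strPrefix Y L) = true ↔
    ∃ e < L, ∃ s ≤ L, lev e (e + κ + 1) (strPrefix A s) (strPrefix Y s) = true ∧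
      cnt (lev e (e + κ + 1) (strPrefix A s)) s * 2 ^ (e + κ + 1) ≤ 2 ^ s := by
  simp only [univ, List.any_eq_true, List.mem_range, sp_length, sp_take, Bool.and_eq_true,
    decide_eq_true_eq, Nat.lt_succ_iff]
  refine exists_congr fun e => and_congr_right fun he => exists_congr fun s =>
    and_congr_right fun hs => ?_
  rw [min_eq_left hs]

theorem cnt_along (h : List Bool → List Bool → Bool) (A : ℕ → Bool) (s : ℕ) :
    cnt (along h A) s = cnt (h (strPrefix A s)) s := by
  unfold cnt
  apply List.countP_congr
  intro σ hσ
  rw [mem_strs] at hσ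
  simp [along, hσ]

theorem univ_iff' {κ L : ℕ} {A Y : ℕ → Bool} : univ κ (strPrefix A L) (strPrefix Y L) = true ↔
    ∃ e < L, trunc (along (lev e (e + κ + 1)) A) (e + κ + 1) (strPrefix Y L) = true := by
  rw [univ_iff]
  refine exists_congr fun e => and_congr_right fun he => ?_
  simp only [trunc_iff, sp_length, sp_take, cnt_along]
  refine exists_congr fun s => and_congr_right fun hs => ?_
  rw [min_eq_left hs]; simp [along]

theorem univ_mono {κ L L' : ℕ} {A Y : ℕ → Bool} (hL : L ≤ L')
    (h : univ κ (strPrefix A L) (strPrefix Y L) = true) :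
    univ κ (strPrefix A L') (strPrefix Y L') = true := by
  rw [univ_iff] at *
  obtain ⟨e, he, s, hs, hh⟩ := h
  exact ⟨e, by omega, s, by omega, hh⟩

theorem mu_univ (κ : ℕ) (A : ℕ → Bool) :
    μCantor {Y | ∃ L, univ κ (strPrefix A L) (strPrefix Y L) = true} ≤ 2⁻¹ ^ κ := by
  have : {Y | ∃ L, univ κ (strPrefix A L) (strPrefix Y L) = true} ⊆
      ⋃ e, Op (trunc (along (lev e (e + κ + 1)) A) (e + κ + 1)) := by
    rintro Y ⟨L, hL⟩
    rw [univ_iff'] at hL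
    obtain ⟨e, -, h⟩ := hL
    exact Set.mem_iUnion.2 ⟨e, L, h⟩
  refine (measure_mono this).trans ((measure_iUnion_le _).trans ?_)
  refine (ENNReal.tsum_le_tsum fun e => mu_trunc (lev_mon _ _ _) _).trans ?_
  have : ∀ e, (2⁻¹ : ℝ≥0∞) ^ (e + κ + 1) = 2⁻¹ ^ κ * 2⁻¹ ^ (e + 1) := fun e => by
    rw [← pow_add]; congr 1; omega
  simp only [this]
  rw [ENNReal.tsum_mul_left, ENNReal.tsum_geometric_add_one, ENNReal.one_sub_inv_two,
    inv_inv, ENNReal.inv_mul_cancel (by simp) (by simp), mul_one]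

theorem univ_complete (κ : ℕ) {A X : ℕ → Bool} (h : ¬ MLRandomIn A X) :
    ∃ L, univ κ (strPrefix A L) (strPrefix X L) = true := by
  simp only [MLRandomIn, not_forall] at h
  obtain ⟨G, ⟨⟨e, he⟩, hμ⟩, hX⟩ := h
  push Not at hX
  have h1 := hX (e + κ + 1)
  have h2 := hμ (e + κ + 1)
  rw [he, testLevel_eq] at h1 h2
  obtain ⟨n, hn⟩ := h1
  refine ⟨max n (e+1), univ_iff'.2 ⟨e, by omega, ?_⟩⟩
  exact trunc_mon _ _ _ _ (sp_mono X (le_max_left _ _)) (trunc_of_le h2 hn)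

end Meas

end

section
open MeasureTheory ENNReal

section Req

theorem sig_enum {α : Type} [Primcodable α] {p : α → Prop} (hp : Sig emptyOracle p) :
    ∃ ev : ℕ → Option α, Computable ev ∧
      (∀ i j a, ev i = some a → ev j = some a → i = j) ∧
      (∀ j a, ev j = some a → p a ∧ Encodable.encode a ≤ j) ∧ ∀ a, p a → ∃ j, ev j = some a := by
  classical
  obtain ⟨h, hc, hm, hh⟩ := sig_empty_iff.1 hp
  let ev : ℕ → Option α := fun j => (Encodable.decode (α := ℕ × α) j).bind fun q =>
    if Encodable.encode q = j ∧ h q.2 q.1 = true ∧ ¬ (h q.2 (q.1 - 1) = true ∧ 0 < q.1)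
      then some q.2 else none
  have hev : ∀ j a, ev j = some a ↔ ∃ t, Encodable.encode (t, a) = j ∧ h a t = true ∧
      ∀ s < t, ¬ h a s = true := by
    intro j a
    simp only [ev, Option.bind_eq_some_iff]
    constructor
    · rintro ⟨⟨t, b⟩, h1, h2⟩
      split_ifs at h2 with h3
      simp only [Option.some.injEq] at h2 h3
      subst h2
      exact ⟨t, h3.1, h3.2.1, fun s hs h4 => h3.2.2 ⟨hm b s (t-1) (by omega) h4, by omega⟩⟩
    · rintro ⟨t, rfl, h1, h2⟩
      refine ⟨(t, a), Encodable.encodek _, ?_⟩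
      rw [if_pos]
      refine ⟨rfl, h1, fun h3 => h2 (t-1) (by simp at h3; omega) h3.1⟩
  refine ⟨ev, by fun_prop, ?_, ?_, ?_⟩
  · intro i j a hi hj
    rw [hev] at hi hj
    obtain ⟨t, rfl, h1, h2⟩ := hi
    obtain ⟨t', rfl, h1', h2'⟩ := hj
    have : t = t' := by
      rcases lt_trichotomy t t' with h | h | h
      · exact absurd h1 (h2' _ h)
      · exact h
      · exact absurd h1' (h2 _ h)
    rw [this]
  · intro j a hj
    rw [hev] at hj
    obtain ⟨t, rfl, h1, h2⟩ := hj
    exact ⟨(hh a).2 ⟨t, h1⟩, Nat.right_le_pair _ _⟩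
  · intro a ha
    have := (hh a).1 ha
    exact ⟨_, (hev _ a).2 ⟨Nat.find this, rfl, Nat.find_spec this, fun s hs => Nat.find_min this hs⟩⟩

theorem mem_rfind_some (f : ℕ → Bool) (j : ℕ) :
    j ∈ Nat.rfind (fun t => (Part.some (f t) : Part Bool)) ↔ f j = true ∧ ∀ i < j, f i = false := by
  refine Nat.mem_rfind.trans ?_
  constructor
  · rintro ⟨h1, h2⟩; exact ⟨(Part.mem_some_iff.1 h1).symm, fun i hi => (Part.mem_some_iff.1 (h2 hi)).symm⟩
  · rintro ⟨h1, h2⟩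
    exact ⟨Part.mem_some_iff.2 h1.symm, fun {i} hi => Part.mem_some_iff.2 (h2 i hi).symm⟩

/-- weight of a set of requests -/
noncomputable def wt (V : Set (ℕ × ℕ)) : ℝ≥0∞ := ∑' x : V, 2⁻¹ ^ x.1.1

theorem wt_mono {V W : Set (ℕ × ℕ)} (h : V ⊆ W) : wt V ≤ wt W :=
  ENNReal.tsum_mono_subtype (fun x : ℕ × ℕ => (2⁻¹ : ℝ≥0∞) ^ x.1) h

theorem exists_num {n m : ℕ} (h : m < 2 ^ n) : ∃ σ : List Bool, σ.length = n ∧ num σ = m := by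
  induction n generalizing m with
  | zero => exact ⟨[], rfl, by simp at h ⊢; omega⟩
  | succ n ih =>
    obtain ⟨σ, h1, h2⟩ := ih (m := m / 2) (by rw [pow_succ] at h; omega)
    refine ⟨σ ++ [decide (m % 2 = 1)], by simp [h1], ?_⟩
    rw [num_concat, h2]
    by_cases h : m % 2 = 1 <;> simp [h] <;> omega

/-- the set defining Kcpx -/
def KSet (x : ℕ) : Set ℕ := {k | ∃ e, ∃ σ : List Bool, PrefixFreeMachine e ∧
    x ∈ (Denumerable.ofNat Nat.Partrec.Code e).eval (Encodable.encode σ) ∧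
    k = σ.length + 2 * e + 2}

theorem KC' {V : Set (ℕ × ℕ)} (hV : Sig emptyOracle (fun x => x ∈ V)) (hw : wt V < ⊤) :
    ∃ c, ∀ x ∈ V, x.1 + c ∈ KSet x.2 := by
  obtain ⟨ev, evc, ev1, ev2, ev3⟩ := sig_enum hV
  obtain ⟨K, hK⟩ : ∃ K : ℕ, wt V ≤ 2 ^ K := by
    obtain ⟨n, hn⟩ := ENNReal.exists_nat_gt hw.ne
    exact ⟨n, hn.le.trans (by exact_mod_cast Nat.lt_two_pow_self.le)⟩
  -- real partial sums
  let v : ℕ → ℝ := fun j => (ev j).elim 0 fun x => (1/2 : ℝ) ^ (x.1 + K)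
  let a : ℕ → ℝ := fun j => ∑ i ∈ Finset.range j, v i
  have v0 : ∀ j, 0 ≤ v j := by
    intro j; simp only [v]; cases ev j <;> simp
  have am : Monotone a := monotone_nat_of_le_succ fun j => by
    simp only [a]; rw [Finset.sum_range_succ]; linarith [v0 j]
  have a1 : ∀ j, a j ≤ 1 := by
    intro j
    classical
    have e1 : ENNReal.ofReal (a j) = ∑ i ∈ Finset.range j,
        (ev i).elim 0 fun x => (2⁻¹ : ℝ≥0∞) ^ (x.1 + K) := by
      simp only [a]
      rw [ENNReal.ofReal_sum_of_nonneg fun i _ => v0 i]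
      refine Finset.sum_congr rfl fun i _ => ?_
      simp only [v]
      cases ev i with
      | none => simp
      | some x =>
        simp only [Option.elim]
        rw [ENNReal.ofReal_pow (by norm_num)]
        congr 1
        rw [one_div, ENNReal.ofReal_inv_of_pos (by norm_num)]; simp
    have e2 : (∑ i ∈ Finset.range j, (ev i).elim 0 fun x => (2⁻¹ : ℝ≥0∞) ^ (x.1 + K)) ≤
        2⁻¹ ^ K * wt V := by
      rw [wt, ← ENNReal.tsum_mul_left]
      let F := (Finset.range j).filter fun i => (ev i).isSome = true
      have : (∑ i ∈ Finset.range j, (ev i).elim 0 fun x => (2⁻¹ : ℝ≥0∞) ^ (x.1 + K)) =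
          ∑ i ∈ F, (ev i).elim 0 fun x => (2⁻¹ : ℝ≥0∞) ^ (x.1 + K) := by
        refine (Finset.sum_subset (Finset.filter_subset _ _) fun i hi hn => ?_).symm
        simp only [F, Finset.mem_filter, hi, true_and, Bool.not_eq_true] at hn
        simp at hn
        simp [hn]
      rw [this]
      have : ∀ i : F, ∃ x : V, ev i = some x.1 := fun i => by
        have := (Finset.mem_filter.1 i.2).2
        rw [Option.isSome_iff_exists] at this
        obtain ⟨x, hx⟩ := this
        exact ⟨⟨x, (ev2 _ _ hx).1⟩, hx⟩
      choose g hg using this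
      have ginj : Function.Injective g := fun i j hij => by
        have h1 := hg i
        have h2 := hg j
        rw [hij] at h1
        exact Subtype.ext (ev1 _ _ _ h1 h2)
      refine le_trans (le_of_eq ?_) (ENNReal.tsum_comp_le_tsum_of_injective ginj _)
      rw [tsum_fintype, ← Finset.sum_coe_sort F]
      refine Finset.sum_congr rfl fun i _ => ?_
      rw [hg i]; simp only [Option.elim, pow_add]; rw [mul_comm]
    have e3 : ENNReal.ofReal (a j) ≤ 1 := by
      rw [e1]
      refine e2.trans ((mul_le_mul_right hK _).trans ?_)
      rw [← mul_pow, ENNReal.inv_mul_cancel (by simp) (by simp), one_pow]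
    simpa using e3
  -- integer version
  let N : ℕ → ℕ := fun j => ((List.range j).map fun i =>
    (ev i).elim 0 fun x => 2 ^ (j + K - (x.1 + K))).sum
  have hN : ∀ j, (N j : ℝ) = a j * 2 ^ (j + K) := by
    intro j
    simp only [N, a, Nat.cast_list_sum, List.map_map, Finset.sum_mul]
    rw [← List.sum_toFinset _ (List.nodup_range), List.toFinset_range]
    refine Finset.sum_congr rfl fun i hi => ?_
    simp only [Function.comp, v]
    cases he : ev i with
    | none => simp
    | some x =>
      simp only [Option.elim]
      have hx : x.1 ≤ j := by
        have := (ev2 _ _ he).2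
        have h2 : x.1 ≤ Encodable.encode x := Nat.left_le_pair _ _
        have := Finset.mem_range.1 hi
        omega
      obtain ⟨d, hd⟩ := Nat.exists_eq_add_of_le (show x.1 + K ≤ j + K by omega)
      rw [hd, Nat.add_sub_cancel_left, pow_add _ _ d, ← mul_assoc, ← mul_pow]
      norm_num
  let m : ℕ → ℕ → ℕ := fun j k => (N j * 2 ^ (k + K + 1) + (2 ^ (j + K) - 1)) / 2 ^ (j + K)
  have hm1 : ∀ j x, ev j = some x → a j ≤ (m j x.1 : ℝ) / 2 ^ (x.1 + K + 1) := by
    intro j x hx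
    rw [le_div_iff₀ (by positivity)]
    have h1 : N j * 2 ^ (x.1 + K + 1) ≤ m j x.1 * 2 ^ (j + K) := by
      simp only [m]
      have hp : 0 < 2 ^ (j + K) := by positivity
      have := Nat.div_add_mod (N j * 2 ^ (x.1 + K + 1) + (2 ^ (j + K) - 1)) (2 ^ (j + K))
      have h3 := Nat.mod_lt (N j * 2 ^ (x.1 + K + 1) + (2 ^ (j + K) - 1)) hp
      rw [mul_comm] at this
      omega
    have h2 : (N j : ℝ) * 2 ^ (x.1 + K + 1) ≤ m j x.1 * 2 ^ (j + K) := by exact_mod_cast h1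
    rw [hN] at h2
    have hp : (0 : ℝ) < 2 ^ (j + K) := by positivity
    nlinarith
  have hm2 : ∀ j x, ev j = some x → ((m j x.1 : ℝ) + 1) / 2 ^ (x.1 + K + 1) ≤ a (j+1) := by
    intro j x hx
    have ha : a (j+1) = a j + (1/2) ^ (x.1 + K) := by
      simp only [a]; rw [Finset.sum_range_succ]; simp [v, hx]
    rw [ha, div_le_iff₀ (by positivity)]
    have h1 : m j x.1 * 2 ^ (j + K) < N j * 2 ^ (x.1 + K + 1) + 2 ^ (j + K) := by
      simp only [m]
      have hp : 0 < 2 ^ (j + K) := by positivity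
      have := Nat.div_mul_le_self (N j * 2 ^ (x.1 + K + 1) + (2 ^ (j + K) - 1)) (2 ^ (j + K))
      omega
    have h2 : (m j x.1 : ℝ) * 2 ^ (j + K) < N j * 2 ^ (x.1 + K + 1) + 2 ^ (j + K) := by
      exact_mod_cast h1
    rw [hN] at h2
    have hp : (0 : ℝ) < 2 ^ (j + K) := by positivity
    have h3 : (m j x.1 : ℝ) < a j * 2 ^ (x.1 + K + 1) + 1 := by
      by_contra hc
      push Not at hc
      have := mul_le_mul_of_nonneg_right hc hp.le
      nlinarith
    have h4 : ((1:ℝ)/2) ^ (x.1 + K) * 2 ^ (x.1 + K + 1) = 2 := by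
      rw [pow_succ, ← mul_assoc, ← mul_pow]; norm_num
    nlinarith
  let Acc : List Bool → ℕ → Prop := fun σ j => ∃ x, ev j = some x ∧ σ.length = x.1 + K + 1 ∧
    num σ = m j x.1
  have pf : ∀ σ τ i j, Acc σ i → Acc τ j → σ <+: τ → i = j := by
    rintro σ τ i j ⟨x, hx, x1, x2⟩ ⟨y, hy, y1, y2⟩ hp
    have l := hp.length_le
    have h1 : num σ = num τ / 2 ^ (τ.length - σ.length) := by
      rw [← num_take _ _ l, ← List.prefix_iff_eq_take.1 hp]
    have h2 : num σ * 2 ^ (τ.length - σ.length) ≤ num τ := by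
      rw [h1]; exact Nat.div_mul_le_self _ _
    have h3 : num τ + 1 ≤ (num σ + 1) * 2 ^ (τ.length - σ.length) := by
      rw [h1, mul_comm]; exact Nat.lt_mul_div_succ _ (by positivity)
    have hpw : (2:ℝ) ^ τ.length = 2 ^ (τ.length - σ.length) * 2 ^ σ.length := by
      rw [← pow_add]; congr 1; omega
    have h4 : (num σ : ℝ) / 2 ^ σ.length ≤ num τ / 2 ^ τ.length := by
      rw [div_le_div_iff₀ (by positivity) (by positivity), hpw, ← mul_assoc]
      gcongr
      exact_mod_cast h2
    have h5 : (num τ + 1 : ℝ) / 2 ^ τ.length ≤ (num σ + 1) / 2 ^ σ.length := by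
      rw [div_le_div_iff₀ (by positivity) (by positivity), hpw, ← mul_assoc]
      gcongr
      exact_mod_cast h3
    have g1 := hm1 i x hx
    have g2 := hm2 i x hx
    have g3 := hm1 j y hy
    have g4 := hm2 j y hy
    rw [← x1, ← x2] at g1 g2
    rw [← y1, ← y2] at g3 g4
    have s1 : (num σ : ℝ) / 2 ^ σ.length < (num σ + 1) / 2 ^ σ.length := by gcongr; linarith
    have s2 : (num τ : ℝ) / 2 ^ τ.length < (num τ + 1) / 2 ^ τ.length := by gcongr; linarith
    rcases lt_trichotomy i j with h | h | h
    · have := am (show i + 1 ≤ j by omega)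
      linarith
    · exact h
    · have := am (show j + 1 ≤ i by omega)
      linarith
  -- machine
  let acc : List Bool → ℕ → Bool := fun σ j => (ev j).elim false fun x =>
    decide (σ.length = x.1 + K + 1) && decide (num σ = m j x.1)
  have hacc : ∀ σ j, acc σ j = true ↔ Acc σ j := by
    intro σ j
    simp only [acc, Acc]
    cases ev j <;> simp
  have accC : Computable (fun q : List Bool × ℕ => acc q.1 q.2) := by
    simp only [acc, m, N]; fun_prop
  have hp : Partrec (fun z : ℕ => (Nat.rfind (fun t =>
      (Part.some (((Encodable.decode (α := List Bool) z).elim false fun σ => acc σ t)) :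
        Part Bool))).map fun j => (ev j).elim 0 fun x => x.2) := by
    refine Partrec.map (Partrec.rfind (Computable.partrec ?_)) ?_
    · show Computable fun p : ℕ × ℕ => (Encodable.decode (α := List Bool) p.1).elim false fun σ => acc σ p.2
      fun_prop
    · show Computable fun p : ℕ × ℕ => (ev p.2).elim 0 fun x => x.2
      fun_prop
  obtain ⟨cd, hcd⟩ := Nat.Partrec.Code.exists_code.1 (Partrec.nat_iff.1 hp)
  have heval : ∀ σ : List Bool, ∀ y, y ∈ cd.eval (Encodable.encode σ) ↔
      ∃ j x, Acc σ j ∧ ev j = some x ∧ y = x.2 := by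
    intro σ y
    rw [hcd]
    simp only [Encodable.encodek, Option.elim, Part.mem_map_iff, mem_rfind_some]
    constructor
    · rintro ⟨j, ⟨h1, h2⟩, rfl⟩
      have h3 := (hacc σ j).1 h1
      obtain ⟨x, hx, -⟩ := id h3
      exact ⟨j, x, h3, hx, by simp [hx]⟩
    · rintro ⟨j, x, h1, h2, rfl⟩
      refine ⟨j, ⟨(hacc σ j).2 h1, fun i hi => ?_⟩, by simp [h2]⟩
      cases hb : acc σ i with
      | false => rfl
      | true =>
        have := pf σ σ i j ((hacc σ i).1 hb) h1 (List.prefix_refl _)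
        omega
  have hofn : Denumerable.ofNat Nat.Partrec.Code (Encodable.encode cd) = cd :=
    Denumerable.ofNat_encode cd
  refine ⟨K + 1 + 2 * Encodable.encode cd + 2, ?_⟩
  intro x hx
  obtain ⟨j, hj⟩ := ev3 x hx
  obtain ⟨σ, h1, h2⟩ : ∃ σ : List Bool, σ.length = x.1 + K + 1 ∧ num σ = m j x.1 := by
    apply exists_num
    have := (hm2 j x hj).trans (a1 _)
    rw [div_le_one (by positivity)] at this
    exact_mod_cast this
  refine ⟨Encodable.encode cd, σ, ?_, ?_, ?_⟩
  · intro ρ hρ τ hτ hpre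
    simp only [machineDom, hofn, Set.mem_ofPred_eq, Part.dom_iff_mem, heval] at hρ hτ
    obtain ⟨_, i, y, hi, hy, -⟩ := hρ
    obtain ⟨_, i', y', hi', hy', -⟩ := hτ
    have e := pf _ _ _ _ hi hi' hpre
    subst e
    obtain ⟨z, z1, z2, z3⟩ := hi
    obtain ⟨w, w1, w2, w3⟩ := hi'
    rw [z1] at w1
    cases w1
    exact num_inj (by omega) (by omega)
  · rw [hofn, heval]
    exact ⟨j, x, ⟨x, hj, h1, h2⟩, hj, rfl⟩
  · omega

theorem KSet_nonempty (x : ℕ) : (KSet x).Nonempty := by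
  obtain ⟨c, hc⟩ := KC' (V := {q | q.1 = 0 ∧ q.2 = x})
    (Sig.dec (by show ComputablePred fun q : ℕ × ℕ => q.1 = 0 ∧ q.2 = x; fun_prop)) (by
      have : ({q | q.1 = 0 ∧ q.2 = x} : Set (ℕ × ℕ)) = {((0 : ℕ), x)} := by
        ext ⟨a, b⟩; simp
      rw [this, wt, tsum_singleton (((0 : ℕ), x) : ℕ × ℕ) (fun q : ℕ × ℕ => (2⁻¹ : ℝ≥0∞) ^ q.1)]
      simp)
  exact ⟨_, hc (0, x) ⟨rfl, rfl⟩⟩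

theorem Kcpx_mem (x : ℕ) : Kcpx x ∈ KSet x := Nat.sInf_mem (KSet_nonempty x)

theorem KC {V : Set (ℕ × ℕ)} (hV : Sig emptyOracle (fun x => x ∈ V)) (hw : wt V < ⊤) :
    ∃ c, ∀ x ∈ V, Kcpx x.2 ≤ x.1 + c := by
  obtain ⟨c, hc⟩ := KC' hV hw
  exact ⟨c, fun x hx => Nat.sInf_le (hc x hx)⟩


theorem weight_prefixFree {S : Set (List Bool)} (h : PrefixFreeSet S) :
    weight S = μCantor (openOf S) := by
  rw [openOf, measure_biUnion (Set.to_countable S) _ fun σ _ => measurableSet_cyl σ]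
  · simp only [mu_cyl]; rfl
  · intro σ hσ τ hτ hne
    rw [Function.onFun, Set.disjoint_left]
    intro Y h1 h2
    rw [mem_cyl] at h1 h2
    rcases Nat.le_total σ.length τ.length with hl | hl
    · exact hne (h σ hσ τ hτ (by rw [← h1, ← h2]; simpa using sp_mono Y hl))
    · exact hne (h τ hτ σ hσ (by rw [← h1, ← h2]; simpa using sp_mono Y hl)).symm

/-- stage j of machine e: halting strings -/
def mst (e : ℕ) (j : ℕ × List Bool) : Option ℕ :=
  Nat.Partrec.Code.evaln j.1 (Denumerable.ofNat Nat.Partrec.Code e) (Encodable.encode j.2)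

theorem exZ : ∃ Z : Set (ℕ × ℕ), Sig emptyOracle (fun x => x ∈ Z) ∧ wt Z ≤ 1 ∧
    ∀ x, (Kcpx x, x) ∈ Z := by
  -- q = (stage, string)
  let Ac : ℕ → ℕ × List Bool → Prop := fun e q => ∀ i < Encodable.encode q,
    ∀ p : ℕ × List Bool, Encodable.encode p = i → (mst e p).isSome = true →
      (p.2 <+: q.2 ∨ q.2 <+: p.2) → p.2 = q.2
  let ac : ℕ → ℕ × List Bool → Bool := fun e q => (List.range (Encodable.encode q)).all fun i =>
    (Encodable.decode (α := ℕ × List Bool) i).elim true fun p =>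
      !(mst e p).isSome || !(decide (q.2.take p.2.length = p.2) || decide (p.2.take q.2.length = q.2))
        || decide (p.2 = q.2)
  have hac : ∀ e q, ac e q = true → Ac e q := by
    rintro e q h i hi p rfl h1 h2
    simp only [ac, List.all_eq_true, List.mem_range] at h
    have := h _ hi
    rw [Encodable.encodek] at this
    simp only [Option.elim, h1, Bool.not_true, Bool.false_or, Bool.or_eq_true, decide_eq_true_eq] at this
    rcases this with h3 | h3
    · exfalso
      simp only [Bool.not_eq_true', Bool.or_eq_false_iff, decide_eq_false_iff_not] at h3
      rcases h2 with h2 | h2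
      · exact h3.1 (List.prefix_iff_eq_take.1 h2).symm
      · exact h3.2 (List.prefix_iff_eq_take.1 h2).symm
    · exact h3
  let S : ℕ → Set (List Bool) := fun e => {σ | ∃ t, (mst e (t, σ)).isSome = true ∧ ac e (t, σ) = true}
  have hS : ∀ e, PrefixFreeSet (S e) := by
    rintro e σ ⟨t, h1, h2⟩ τ ⟨s, h3, h4⟩ hp
    rcases lt_trichotomy (Encodable.encode (t, σ)) (Encodable.encode (s, τ)) with h | h | h
    · exact hac _ _ h4 _ h (t, σ) rfl h1 (Or.inl hp)
    · have := Encodable.encode_injective h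
      simp at this; exact this.2
    · exact (hac _ _ h2 _ h (s, τ) rfl h3 (Or.inr hp)).symm
  let Z : Set (ℕ × ℕ) := {x | ∃ q : ℕ × ℕ × List Bool, mst q.1 q.2 = some x.2 ∧ ac q.1 q.2 = true ∧
    x.1 = q.2.2.length + 2 * q.1 + 2}
  refine ⟨Z, ?_, ?_, ?_⟩
  · show Sig emptyOracle fun x : ℕ × ℕ => ∃ q : ℕ × ℕ × List Bool,
      mst q.1 q.2 = some x.2 ∧ ac q.1 q.2 = true ∧ x.1 = q.2.2.length + 2 * q.1 + 2
    refine Sig.ex (Sig.dec ?_)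
    simp only [ac, mst]
    fun_prop
  · have : ∀ x : Z, ∃ q : ℕ × ℕ × List Bool, mst q.1 q.2 = some x.1.2 ∧ ac q.1 q.2 = true ∧
        x.1.1 = q.2.2.length + 2 * q.1 + 2 := fun x => x.2
    choose g g1 g2 g3 using this
    let G : Z → Σ e : ℕ, S e := fun x => ⟨(g x).1, (g x).2.2, (g x).2.1, by
      show (mst _ (g x).2).isSome = true
      rw [g1]; rfl, g2 x⟩
    have Ginj : Function.Injective G := by
      intro x y hxy
      have h1 : (g x).1 = (g y).1 := congrArg Sigma.fst hxy
      have h2 : (g x).2.2 = (g y).2.2 :=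
        congrArg (fun z : Σ e : ℕ, S e => (z.2 : List Bool)) hxy
      apply Subtype.ext
      apply Prod.ext
      · rw [g3, g3, h1, h2]
      · have a1 := Nat.Partrec.Code.evaln_sound (g1 x)
        have a2 := Nat.Partrec.Code.evaln_sound (g1 y)
        rw [h1, h2] at a1
        exact Part.mem_unique a1 a2
    have hle : wt Z ≤ ∑' z : Σ e : ℕ, S e, (2⁻¹ : ℝ≥0∞) ^ ((z.2 : List Bool).length + 2 * z.1 + 2) := by
      refine le_trans (le_of_eq ?_) (ENNReal.tsum_comp_le_tsum_of_injective Ginj _)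
      rw [wt]
      refine tsum_congr fun x => ?_
      rw [g3]
    refine hle.trans ?_
    rw [ENNReal.tsum_sigma']
    have : ∀ e, (∑' z : S e, (2⁻¹ : ℝ≥0∞) ^ ((z : List Bool).length + 2 * e + 2)) ≤ 2⁻¹ ^ (e + 1) := by
      intro e
      have h1 : weight (S e) ≤ 1 := by
        rw [weight_prefixFree (hS e)]; exact prob_le_one
      calc (∑' z : S e, (2⁻¹ : ℝ≥0∞) ^ ((z : List Bool).length + 2 * e + 2))
          = weight (S e) * 2⁻¹ ^ (2 * e + 2) := by
            rw [weight, ← ENNReal.tsum_mul_right]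
            refine tsum_congr fun z => ?_
            rw [← pow_add, add_assoc]
        _ ≤ 1 * 2⁻¹ ^ (e + 1) := by
            refine mul_le_mul' h1 (pow_le_pow_of_le_one (by simp) (by simp) (by omega))
        _ = _ := one_mul _
    refine (ENNReal.tsum_le_tsum this).trans (le_of_eq ?_)
    rw [ENNReal.tsum_geometric_add_one, ENNReal.one_sub_inv_two,
      inv_inv, ENNReal.inv_mul_cancel (by simp) (by simp)]
  · intro x
    obtain ⟨e, σ, h1, h2, h3⟩ := Kcpx_mem x
    rw [Nat.Partrec.Code.evaln_complete] at h2
    obtain ⟨t, ht⟩ := h2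
    refine ⟨(e, t, σ), ht, ?_, h3⟩
    simp only [ac, List.all_eq_true, List.mem_range]
    intro i hi
    cases hd : (Encodable.decode (α := ℕ × List Bool) i) with
    | none => rfl
    | some p =>
      simp only [Option.elim]
      rw [Bool.or_eq_true, Bool.or_eq_true]
      by_cases hs : (mst e p).isSome = true
      · have hp : p.2 ∈ machineDom e := by
          rw [Option.isSome_iff_exists] at hs
          obtain ⟨y, hy⟩ := hs
          exact Part.dom_iff_mem.2 ⟨y, Nat.Partrec.Code.evaln_sound hy⟩
        have hσ : σ ∈ machineDom e := Part.dom_iff_mem.2 ⟨x, Nat.Partrec.Code.evaln_sound ht⟩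
        by_cases h4 : p.2 = σ
        · right; simp [h4]
        · left; right
          simp only [Bool.not_eq_true', Bool.or_eq_false_iff, decide_eq_false_iff_not]
          constructor
          · intro h5; exact h4 (h1 _ hp _ hσ (List.prefix_iff_eq_take.2 h5.symm))
          · intro h5; exact h4 (h1 _ hσ _ hp (List.prefix_iff_eq_take.2 h5.symm)).symm
      · left; left; simpa using hs

end Req

end

section
open MeasureTheory ENNReal

section Low

/-- low for requests -/
def LProp (A : ℕ → Bool) : Prop := ∀ W : Set (ℕ × ℕ), Sig A (fun x => x ∈ W) → wt W < ⊤ →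
  ∃ V : Set (ℕ × ℕ), Sig emptyOracle (fun x => x ∈ V) ∧ W ⊆ V ∧ wt V < ⊤

theorem LProp.ktrivial {A : ℕ → Bool} (h : LProp A) : KTrivial A := by
  obtain ⟨Z, Zs, Zw, Zk⟩ := exZ
  let W : Set (ℕ × ℕ) := {x | ∃ q : ℕ × List Bool, strPrefix A q.1 = q.2 ∧
    x.2 = Encodable.encode q.2 ∧ (x.1, Encodable.encode (List.replicate q.1 true)) ∈ Z}
  have hW : Sig A (fun x => x ∈ W) := by
    show Sig A (fun x : ℕ × ℕ => ∃ q : ℕ × List Bool, strPrefix A q.1 = q.2 ∧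
      x.2 = Encodable.encode q.2 ∧ (x.1, Encodable.encode (List.replicate q.1 true)) ∈ Z)
    refine Sig.ex (Sig.and ?_ (Sig.and (Sig.dec (by fun_prop)) ?_))
    · exact Sig.pre.comp (f := fun q : (ℕ × ℕ) × ℕ × List Bool => q.2) (by fun_prop)
    · exact (Sig.of_empty Zs).comp (f := fun q : (ℕ × ℕ) × ℕ × List Bool =>
        (q.1.1, Encodable.encode (List.replicate q.2.1 true))) (by fun_prop)
  have hw : wt W ≤ 1 := by
    refine le_trans ?_ Zw
    have : ∀ x : W, ∃ q : ℕ × List Bool, strPrefix A q.1 = q.2 ∧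
      x.1.2 = Encodable.encode q.2 ∧ (x.1.1, Encodable.encode (List.replicate q.1 true)) ∈ Z := fun x => x.2
    choose g g1 g2 g3 using this
    let G : W → Z := fun x => ⟨_, g3 x⟩
    have Ginj : Function.Injective G := by
      intro x y hxy
      have h1 : x.1.1 = y.1.1 := congrArg (fun z : Z => z.1.1) hxy
      have h2 : Encodable.encode (List.replicate (g x).1 true) = Encodable.encode (List.replicate (g y).1 true) :=
        congrArg (fun z : Z => z.1.2) hxy
      have h3 : (g x).1 = (g y).1 := by
        have := congrArg List.length (Encodable.encode_injective h2)
        simpa using this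
      apply Subtype.ext
      apply Prod.ext h1
      rw [g2, g2, ← g1, ← g1, h3]
    exact ENNReal.tsum_comp_le_tsum_of_injective Ginj fun z : Z => (2⁻¹ : ℝ≥0∞) ^ z.1.1
  obtain ⟨V, V1, V2, V3⟩ := h W hW (hw.trans_lt (by simp))
  obtain ⟨c, hc⟩ := KC V1 V3
  refine ⟨c, fun n => ?_⟩
  exact hc (KofNat n, Encodable.encode (strPrefix A n)) (V2 ⟨(n, strPrefix A n), rfl, rfl, Zk _⟩)

variable {α : Type} [Primcodable α] {A X : ℕ → Bool}

theorem Sig.decA {h : List Bool → α → Bool} {n : α → ℕ}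
    (hc : Computable (fun q : List Bool × α => h q.1 q.2)) (hn : Computable n) :
    Sig A (fun a => h (strPrefix A (n a)) a = true) := by
  have : Sig A (fun a => ∃ τ, strPrefix A (n a) = τ ∧ h τ a = true) :=
    Sig.ex (Sig.and (Sig.pre.comp (f := fun q : α × List Bool => (n q.1, q.2)) (by fun_prop))
      (Sig.dec (by fun_prop)))
  exact this.of_eq fun a => by simp

theorem tsum_half (m : ℕ) : ∑' n : ℕ, (2⁻¹ : ℝ≥0∞) ^ (n + m) = 2 * 2⁻¹ ^ m := by
  simp only [pow_add]
  rw [ENNReal.tsum_mul_right, ENNReal.tsum_geometric, ENNReal.one_sub_inv_two, inv_inv]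

theorem complete_lemma (hX : MLRandom X) (D : ℕ → ℕ → List Bool → Bool)
    (Dc : Computable (fun q : ℕ × ℕ × List Bool => D q.1 q.2.1 q.2.2)) (K : ℕ)
    (hμ : ∀ n t, μCantor {Y | D n t (strPrefix Y t) = true} ≤ 2 ^ K * 2⁻¹ ^ n)
    (hup : ∀ n t t', t ≤ t' → D n t (strPrefix X t) = true → D n t' (strPrefix X t') = true)
    (hne : ∀ n, ∃ t, D n t (strPrefix X t) = true) : TuringLE zeroJump X := by
  obtain ⟨z, zc, zm, zz⟩ := sig_empty_iff.1 sig_zeroJump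
  let R : ℕ → List Bool → Prop := fun m σ => ∃ n, m ≤ n ∧ z n σ.length = true ∧
    (∀ s < σ.length, z n s = false) ∧ D n σ.length σ = true
  have hR : Sig emptyOracle (fun q : ℕ × List Bool => R q.1 q.2) := by
    refine Sig.ex (Sig.and (Sig.dec (by fun_prop)) (Sig.and (Sig.dec (by fun_prop)) (Sig.and ?_
      (Sig.dec (by fun_prop)))))
    exact Sig.ball (Sig.dec (by fun_prop)) (by fun_prop)
  obtain ⟨m, hm⟩ := test_lemma' hR (fun _ => rfl) (K+1) (fun m => by
    have : openOf {σ | R m σ} ⊆ ⋃ n : ℕ, ⋃ t : {t // z (n+m) t = true ∧ ∀ s < t, z (n+m) s = false},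
        {Y | D (n+m) t (strPrefix Y t) = true} := by
      intro Y hY
      rw [mem_openOf] at hY
      obtain ⟨t, n, h1, h2, h3, h4⟩ := hY
      rw [sp_length] at h2 h3 h4
      obtain ⟨k, rfl⟩ := Nat.exists_eq_add_of_le' h1
      exact Set.mem_iUnion.2 ⟨k, Set.mem_iUnion.2 ⟨⟨t, h2, h3⟩, h4⟩⟩
    refine (measure_mono this).trans ((measure_iUnion_le _).trans ?_)
    have h2 : ∀ n, μCantor (⋃ t : {t // z (n+m) t = true ∧ ∀ s < t, z (n+m) s = false},
        {Y | D (n+m) t (strPrefix Y t) = true}) ≤ 2 ^ K * 2⁻¹ ^ (n + m) := by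
      intro n
      have : Subsingleton {t // z (n+m) t = true ∧ ∀ s < t, z (n+m) s = false} := by
        refine ⟨?_⟩
        rintro ⟨t, h1, h2⟩ ⟨t', h1', h2'⟩
        apply Subtype.ext
        simp only
        rcases lt_trichotomy t t' with h | h | h
        · rw [h2' _ h] at h1; cases h1
        · exact h
        · rw [h2 _ h] at h1'; cases h1'
      rcases isEmpty_or_nonempty {t // z (n+m) t = true ∧ ∀ s < t, z (n+m) s = false} with he | ⟨⟨t⟩⟩
      · simp
      · refine (measure_mono (Set.iUnion_subset fun t' => ?_)).trans (hμ (n+m) t)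
        rw [Subsingleton.elim t' t]
    refine (ENNReal.tsum_le_tsum h2).trans (le_of_eq ?_)
    rw [ENNReal.tsum_mul_left, tsum_half, pow_succ, mul_assoc]) hX
  have key : ∀ n ≥ m, ∀ t, z n t = false → D n t (strPrefix X t) = true → zeroJump n = false := by
    intro n hn t h1 h2
    by_contra hc
    rw [Bool.not_eq_false] at hc
    have hex := (zz n).1 hc
    apply hm
    rw [mem_openOf]
    refine ⟨Nat.find hex, n, hn, ?_⟩
    rw [sp_length]
    refine ⟨Nat.find_spec hex, fun s hs => by simpa using Nat.find_min hex hs, hup n t _ ?_ h2⟩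
    by_contra hlt
    push Not at hlt
    rw [zm n _ _ hlt.le (Nat.find_spec hex)] at h1
    cases h1
  refine turingLE_of_sig (Sig.of_empty sig_zeroJump) ?_
  have : Sig X (fun n => (strPrefix zeroJump m)[n]? = some false ∨
      (m ≤ n ∧ ∃ t, z n t = false ∧ D n t (strPrefix X t) = true)) := by
    refine Sig.or (Sig.dec (by fun_prop)) (Sig.and (Sig.dec (by fun_prop)) (Sig.ex
      (Sig.and (Sig.dec (by fun_prop)) ?_)))
    exact Sig.decA (h := fun τ (q : ℕ × ℕ) => D q.1 q.2 τ) (n := fun q => q.2) (by fun_prop) (by fun_prop)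
  refine this.of_eq fun n => ?_
  constructor
  · rintro (h | ⟨h1, t, h2, h3⟩)
    · have hn : n < m := by
        by_contra hc
        rw [List.getElem?_eq_none (by simp; omega)] at h; cases h
      rw [sp_getElem? _ _ _ hn] at h; simpa using h
    · exact key n h1 t h2 h3
  · intro h
    by_cases hn : n < m
    · left; rw [sp_getElem? _ _ _ hn, h]
    · right
      obtain ⟨t, ht⟩ := hne n
      refine ⟨by omega, t, ?_, ht⟩
      by_contra hc
      rw [Bool.not_eq_false] at hc
      rw [(zz n).2 ⟨t, hc⟩] at h; cases h

/-! minimal strings -/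
/-- minimal elements -/
def minS (S : Set (List Bool)) : Set (List Bool) := {σ | σ ∈ S ∧ ∀ i < σ.length, σ.take i ∉ S}

theorem minS_pf (S : Set (List Bool)) : PrefixFreeSet (minS S) := by
  rintro σ ⟨h1, h2⟩ τ ⟨h3, h4⟩ hp
  by_contra hne
  have : σ.length < τ.length := by
    refine lt_of_le_of_ne hp.length_le fun h => hne (hp.eq_of_length h)
  exact h4 _ this (by rwa [← List.prefix_iff_eq_take.1 hp])

theorem minS_open (S : Set (List Bool)) : openOf (minS S) = openOf S := by
  classical
  ext Y
  rw [mem_openOf, mem_openOf]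
  constructor
  · rintro ⟨n, h⟩; exact ⟨n, h.1⟩
  · intro h
    refine ⟨Nat.find h, Nat.find_spec h, fun i hi => ?_⟩
    rw [sp_length] at hi
    rw [sp_take, min_eq_left hi.le]; exact Nat.find_min h hi

theorem weight_minS (S : Set (List Bool)) : weight (minS S) = μCantor (openOf S) := by
  rw [weight_prefixFree (minS_pf S), minS_open]

/-- requests from strings -/
def strReq (S : Set (List Bool)) : Set (ℕ × ℕ) := {x | ∃ σ ∈ S, x = (σ.length, Encodable.encode σ)}

theorem wt_strReq (S : Set (List Bool)) : wt (strReq S) ≤ weight S := by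
  have : ∀ x : strReq S, ∃ σ ∈ S, x.1 = (σ.length, Encodable.encode σ) := fun x => x.2
  choose g g1 g2 using this
  have inj : Function.Injective (fun x : strReq S => (⟨g x, g1 x⟩ : S)) := by
    intro x y h
    simp only [Subtype.mk.injEq] at h
    apply Subtype.ext
    rw [g2, g2, h]
  refine le_trans (le_of_eq ?_) (ENNReal.tsum_comp_le_tsum_of_injective inj _)
  rw [wt]
  refine tsum_congr fun x => ?_
  rw [g2]

theorem solovay {V : Set (ℕ × ℕ)} (hV : Sig emptyOracle (fun x => x ∈ V)) (hw : wt V < ⊤)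
    (hX : MLRandom X) : ∃ N, ∀ i ≥ N, (i, Encodable.encode (strPrefix X i)) ∉ V := by
  classical
  obtain ⟨h, hc, hm, hh⟩ := sig_empty_iff.1 hV
  obtain ⟨K, hK⟩ : ∃ K : ℕ, wt V ≤ 2 ^ K := by
    obtain ⟨n, hn⟩ := ENNReal.exists_nat_gt hw.ne
    exact ⟨n, hn.le.trans (by exact_mod_cast Nat.lt_two_pow_self.le)⟩
  let cn : List Bool → ℕ := fun ρ => (List.range (ρ.length + 1)).countP fun i =>
    h (i, Encodable.encode (ρ.take i)) ρ.length
  have cnc : Computable cn := by simp only [cn]; fun_prop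
  let ind : V → (ℕ → Bool) → ℝ≥0∞ := fun x =>
    Set.indicator {Y | Encodable.encode (strPrefix Y x.1.1) = x.1.2} (fun _ => 1)
  have ms : ∀ x : V, MeasurableSet {Y | Encodable.encode (strPrefix Y x.1.1) = x.1.2} := fun x =>
    measurableSet_sp (fun σ => Encodable.encode σ = x.1.2) _
  have hf : ∀ Y L, (cn (strPrefix Y L) : ℝ≥0∞) ≤ ∑' x : V, ind x Y := by
    intro Y L
    let F := (List.range (L + 1)).toFinset.filter fun i =>
      h (i, Encodable.encode ((strPrefix Y L).take i)) L = true
    have e1 : cn (strPrefix Y L) = F.card := by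
      simp only [cn, F, sp_length]
      rw [List.countP_eq_length_filter, ← List.toFinset_card_of_nodup (List.nodup_range.filter _),
        List.toFinset_filter]
    have e2 : ∀ i : F, ((i : ℕ), Encodable.encode (strPrefix Y i)) ∈ V := by
      rintro ⟨i, hi⟩
      simp only [F, Finset.mem_filter, List.toFinset_range, Finset.mem_range, sp_take] at hi
      rw [min_eq_left (by omega)] at hi
      exact (hh _).2 ⟨L, hi.2⟩
    have inj : Function.Injective (fun i : F => (⟨_, e2 i⟩ : V)) := by
      intro i j hij
      simp only [Subtype.mk.injEq, Prod.mk.injEq] at hij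
      exact Subtype.ext hij.1
    rw [e1]
    refine le_trans (le_of_eq ?_) (ENNReal.tsum_comp_le_tsum_of_injective inj _)
    rw [tsum_fintype]
    simp [ind]
  have hint : ∫⁻ Y, ∑' x : V, ind x Y ∂μCantor ≤ wt V := by
    rw [lintegral_tsum fun x => ((measurable_const).indicator (ms x)).aemeasurable, wt]
    refine ENNReal.tsum_le_tsum fun x => ?_
    change ∫⁻ a, Set.indicator {Y | Encodable.encode (strPrefix Y x.1.1) = x.1.2}
      (fun _ => 1) a ∂μCantor ≤ _
    rw [lintegral_indicator (ms x), setLIntegral_const, one_mul]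
    rcases Set.eq_empty_or_nonempty {Y | Encodable.encode (strPrefix Y x.1.1) = x.1.2} with he | ⟨Z, hZ⟩
    · rw [he]; simp
    · refine (measure_mono (t := cylinder (strPrefix Z x.1.1)) fun Y hY => ?_).trans ?_
      · rw [mem_cyl, sp_length]
        exact Encodable.encode_injective (hY.trans hZ.symm)
      · rw [mu_cyl, sp_length]
  obtain ⟨m, hm'⟩ := test_lemma' (A := emptyOracle) (X := X) (R := fun m ρ => 2 ^ m ≤ cn ρ)
    (Sig.dec (by fun_prop)) (fun _ => rfl) K (fun m => by
      have : openOf {ρ | 2 ^ m ≤ cn ρ} ⊆ {Y | (2 : ℝ≥0∞) ^ m ≤ ∑' x : V, ind x Y} := by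
        intro Y hY
        rw [mem_openOf] at hY
        obtain ⟨L, hL⟩ := hY
        refine le_trans ?_ (hf Y L)
        exact_mod_cast hL
      refine (measure_mono this).trans ?_
      have h1 := mul_meas_ge_le_lintegral (μ := μCantor) (f := fun Y => ∑' x : V, ind x Y)
        (Measurable.tsum fun x => (measurable_const).indicator (ms x)) (2 ^ m)
      have h2 := h1.trans (hint.trans hK)
      rw [← ENNReal.inv_pow, ← div_eq_mul_inv, ENNReal.le_div_iff_mul_le (by simp) (by simp), mul_comm]
      exact h2) hX
  by_contra hcon
  push Not at hcon
  apply hm'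
  rw [mem_openOf]
  -- choose many prefixes
  have inf : {i | (i, Encodable.encode (strPrefix X i)) ∈ V}.Infinite := by
    rw [Set.infinite_iff_exists_gt]
    intro a
    obtain ⟨i, hi, hi'⟩ := hcon (a+1)
    exact ⟨i, hi', by omega⟩
  obtain ⟨F, hF, hFc⟩ := inf.exists_subset_card_eq (2 ^ m)
  have : ∀ i : ℕ, ∃ t, i ∈ F → h (i, Encodable.encode (strPrefix X i)) t = true := by
    intro i
    by_cases hi : i ∈ F
    · obtain ⟨t, ht⟩ := (hh _).1 (hF hi)
      exact ⟨t, fun _ => ht⟩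
    · exact ⟨0, fun hc => absurd hc hi⟩
  choose T hT using this
  let L := F.sup T + F.sup id
  refine ⟨L, ?_⟩
  show 2 ^ m ≤ cn _
  simp only [cn, sp_length]
  rw [List.countP_eq_length_filter, ← List.toFinset_card_of_nodup (List.nodup_range.filter _),
        List.toFinset_filter, ← hFc]
  apply Finset.card_le_card
  intro i hi
  have h1 : T i ≤ F.sup T := Finset.le_sup hi
  have h2 : i ≤ F.sup id := Finset.le_sup (f := id) hi
  simp only [Finset.mem_filter, List.toFinset_range, Finset.mem_range, sp_take]
  refine ⟨by omega, ?_⟩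
  rw [min_eq_left (by omega)]
  exact hm _ _ _ (by omega) (hT i hi)

end Low

end

section
open MeasureTheory ENNReal

theorem half_lt {a b : ℕ} (h : a < b) : (2⁻¹ : ℝ≥0∞) ^ b < 2⁻¹ ^ a := by
  simp only [ENNReal.inv_pow.symm]
  rw [ENNReal.inv_lt_inv]
  have : (2:ℕ) ^ a < 2 ^ b := Nat.pow_lt_pow_right (by norm_num) h
  exact_mod_cast this

theorem half_le {a b : ℕ} (h : a ≤ b) : (2⁻¹ : ℝ≥0∞) ^ b ≤ 2⁻¹ ^ a :=
  h.eq_or_lt.elim (fun h => by rw [h]) fun h => (half_lt h).le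

section Low2
variable {A X : ℕ → Bool}

theorem sig_open {S : Set (List Bool)} (hS : Sig A (fun σ => σ ∈ S)) :
    ∃ g : List Bool → List Bool → Bool, Computable (fun q : List Bool × List Bool => g q.1 q.2) ∧
      (∀ τ τ' σ σ', τ <+: τ' → σ <+: σ' → g τ σ = true → g τ' σ' = true) ∧
      openOf S = Op (along g A) := by
  obtain ⟨h, hc, hm, hh⟩ := hS
  have hg : ∀ τ σ : List Bool, ((List.range (σ.length + 1)).any fun i => h τ (σ.take i)) = true ↔
      ∃ i ≤ σ.length, h τ (σ.take i) = true := by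
    intro τ σ; simp only [List.any_eq_true, List.mem_range, Nat.lt_succ_iff]
  refine ⟨fun τ σ => (List.range (σ.length + 1)).any fun i => h τ (σ.take i), by fun_prop, ?_, ?_⟩
  · intro τ τ' σ σ' h1 h2 h3
    rw [hg] at *
    obtain ⟨i, hi, h4⟩ := h3
    refine ⟨i, hi.trans h2.length_le, hm _ _ _ h1 ?_⟩
    rwa [take_of_prefix h2 hi]
  · ext Y
    simp only [mem_openOf, Op, Set.mem_ofPred_eq, along, sp_length, List.any_eq_true,
      List.mem_range, Nat.lt_succ_iff, sp_take, hh]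
    constructor
    · rintro ⟨n, ℓ, hl⟩
      refine ⟨max n ℓ, n, le_max_left _ _, ?_⟩
      rw [min_eq_left (le_max_left _ _)]
      exact hm _ _ _ (sp_mono A (le_max_right _ _)) hl
    · rintro ⟨L, i, hi, h4⟩
      rw [min_eq_left hi] at h4
      exact ⟨i, L, h4⟩

theorem along_mon {g : List Bool → List Bool → Bool}
    (hm : ∀ τ τ' σ σ', τ <+: τ' → σ <+: σ' → g τ σ = true → g τ' σ' = true) (A : ℕ → Bool) :
    Mon (along g A) := fun _ _ hp h => hm _ _ _ _ (sp_mono A hp.length_le) hp h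

theorem sig_open_empty {S : Set (List Bool)} (hS : Sig emptyOracle (fun σ => σ ∈ S)) :
    ∃ q : List Bool → Bool, Computable q ∧ Mon q ∧ openOf S = Op q := by
  obtain ⟨g, gc, gm, ge⟩ := sig_open hS
  have h0 : ∀ n, strPrefix emptyOracle n = List.replicate n false := by
    intro n; induction n with
    | zero => rfl
    | succ n ih => rw [sp_succ, ih, List.replicate_succ']; rfl
  refine ⟨fun σ => g (List.replicate σ.length false) σ, by fun_prop, ?_, ?_⟩
  · have := along_mon gm emptyOracle
    intro σ τ hp h
    have := this σ τ hp (by simpa [along, h0] using h)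
    simpa [along, h0] using this
  · rw [ge]
    congr 1
    funext σ
    simp [along, h0]

/-- minimal strings of a decidable-in-A monotone set are Sig A -/
theorem sig_minS {α : Type} [Primcodable α] {g : α → List Bool → List Bool → Bool}
    (gc : Computable (fun q : α × List Bool × List Bool => g q.1 q.2.1 q.2.2)) :
    Sig A (fun q : α × List Bool => q.2 ∈ minS {σ | along (g q.1) A σ = true}) := by
  have := Sig.decA (A := A) (α := α × List Bool)
    (h := fun τ q => g q.1 τ q.2 && (List.range q.2.length).all fun i =>
      !(g q.1 (τ.take i) (q.2.take i))) (n := fun q => q.2.length) (by fun_prop) (by fun_prop)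
  refine this.of_eq ?_
  rintro ⟨a, σ⟩
  simp only [minS, Set.mem_ofPred_eq, along, Bool.and_eq_true, List.all_eq_true, List.mem_range,
    Bool.not_eq_true', Bool.not_eq_true]
  refine and_congr_right fun _ => forall₂_congr fun i hi => ?_
  rw [sp_take, List.length_take]

theorem sig_strReq {α : Type} [Primcodable α] {S : α → Set (List Bool)}
    (h : Sig A (fun q : α × List Bool => q.2 ∈ S q.1)) :
    Sig A (fun q : α × ℕ × ℕ => q.2 ∈ strReq (S q.1)) := by
  have : Sig A (fun q : α × ℕ × ℕ => ∃ σ : List Bool, σ ∈ S q.1 ∧ q.2 = (σ.length, Encodable.encode σ)) :=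
    Sig.ex (Sig.and (h.comp (f := fun z : (α × ℕ × ℕ) × List Bool => (z.1.1, z.2)) (by fun_prop))
      (Sig.dec (by fun_prop)))
  exact this.of_eq fun q => Iff.rfl

theorem LProp.cover (hL : LProp A) (hX : MLRandom X) {S : Set (List Bool)}
    (hS : Sig A (fun σ => σ ∈ S)) (hXS : X ∉ openOf S) :
    ∃ S' : Set (List Bool), Sig emptyOracle (fun σ => σ ∈ S') ∧ X ∉ openOf S' ∧
      openOf S ⊆ openOf S' := by
  obtain ⟨g, gc, gm, ge⟩ := sig_open hS
  let M := minS {σ | along g A σ = true}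
  have hMo : openOf M = openOf S := by rw [minS_open, ge, Op_eq_openOf]
  have hM : Sig A (fun σ => σ ∈ M) :=
    (sig_minS (α := Unit) (A := A) (g := fun _ => g) (by fun_prop)).comp
      (f := fun σ : List Bool => ((), σ)) (by fun_prop)
  have hW : Sig A (fun x => x ∈ strReq M) :=
    (sig_strReq (α := Unit) (S := fun _ => M) (hM.comp (f := Prod.snd) (by fun_prop))).comp
      (f := fun x : ℕ × ℕ => ((), x)) (by fun_prop)
  have hw : wt (strReq M) < ⊤ := by
    refine (wt_strReq _).trans_lt ?_
    rw [weight_minS]; exact measure_lt_top _ _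
  obtain ⟨V, V1, V2, V3⟩ := hL _ hW hw
  obtain ⟨N, hN⟩ := solovay V1 V3 hX
  refine ⟨{σ | (σ.length, Encodable.encode σ) ∈ V ∧ (N ≤ σ.length ∨
    σ ≠ (strPrefix X N).take σ.length)}, ?_, ?_, ?_⟩
  · exact Sig.and (V1.comp (f := fun σ : List Bool => (σ.length, Encodable.encode σ)) (by fun_prop))
      (Sig.dec (by fun_prop))
  · rw [mem_openOf]
    rintro ⟨n, h1, h2⟩
    rw [sp_length] at h1 h2
    rcases h2 with h2 | h2
    · exact hN n h2 h1
    · by_cases hn : N ≤ n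
      · exact hN n hn h1
      · apply h2; rw [sp_take, min_eq_left (by omega)]
  · rw [← hMo]
    intro Y hY
    rw [mem_openOf] at hY ⊢
    obtain ⟨n, hn⟩ := hY
    refine ⟨n, V2 ⟨_, hn, rfl⟩, ?_⟩
    right
    intro hc
    rw [sp_length, sp_take] at hc
    have hnn : n = min n N := by simpa using congrArg List.length hc
    rw [← hnn] at hc
    apply hXS
    rw [← hMo, mem_openOf]
    exact ⟨n, by rwa [← hc]⟩

theorem LProp.random (hL : LProp A) (hX : MLRandom X) : MLRandomIn A X := by
  by_contra hcon
  let S : ℕ → Set (List Bool) := fun κ => minS {σ | along (univ κ) A σ = true}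
  have hS : Sig A (fun q : ℕ × List Bool => q.2 ∈ S q.1) := sig_minS (g := univ) (by fun_prop)
  have hO : ∀ κ, openOf (S κ) = {Y | ∃ L, univ κ (strPrefix A L) (strPrefix Y L) = true} := by
    intro κ
    rw [minS_open, ← Op_eq_openOf]
    ext Y
    simp [Op, along]
  have hμ : ∀ κ, weight (S κ) ≤ 2⁻¹ ^ κ := by
    intro κ
    rw [weight_prefixFree (minS_pf _), hO]; exact mu_univ κ A
  have hW : Sig A (fun x => x ∈ ⋃ κ, strReq (S κ)) := by
    have : Sig A (fun x : ℕ × ℕ => ∃ κ, x ∈ strReq (S κ)) :=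
      Sig.ex ((sig_strReq hS).comp (f := fun z : (ℕ × ℕ) × ℕ => (z.2, z.1)) (by fun_prop))
    exact this.of_eq fun x => by simp
  have hw : wt (⋃ κ, strReq (S κ)) < ⊤ := by
    have : wt (⋃ κ, strReq (S κ)) ≤ ∑' κ, wt (strReq (S κ)) :=
      ENNReal.tsum_iUnion_le_tsum (fun x : ℕ × ℕ => (2⁻¹ : ℝ≥0∞) ^ x.1) _
    refine this.trans_lt ?_
    refine (ENNReal.tsum_le_tsum fun κ => (wt_strReq _).trans (hμ κ)).trans_lt ?_
    rw [ENNReal.tsum_geometric, ENNReal.one_sub_inv_two, inv_inv]; simp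
  obtain ⟨V, V1, V2, V3⟩ := hL _ hW hw
  obtain ⟨N, hN⟩ := solovay V1 V3 hX
  have hXO : X ∈ openOf (S N) := by rw [hO]; exact univ_complete N hcon
  have hXO' := hXO
  rw [mem_openOf] at hXO
  obtain ⟨i, hi⟩ := hXO
  have h1 : (2⁻¹ : ℝ≥0∞) ^ i ≤ 2⁻¹ ^ N := by
    have : μCantor (cylinder (strPrefix X i)) ≤ μCantor (openOf (S N)) :=
      measure_mono fun Y hY => mem_openOf'.2 ⟨_, hi, hY⟩
    rw [mu_cyl, sp_length] at this
    exact this.trans ((mu_openOf_le _).trans (hμ N))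
  have h2 : N ≤ i := by
    by_contra hc
    push Not at hc
    have := half_lt hc
    exact absurd h1 (not_le.2 this)
  exact hN i h2 (V2 (Set.mem_iUnion.2 ⟨N, _, hi, by rw [sp_length]⟩))

theorem LProp.ce_le (hL : LProp A) (hA : TuringLE A zeroJump) {B : ℕ → Bool}
    (hB : Sig A (fun n => B n = true)) : TuringLE B zeroJump := by
  obtain ⟨D, Dc, Dm, DD⟩ := hB
  let W : Set (ℕ × ℕ) := {x | ∃ q : ℕ × ℕ, x = (q.1, Nat.pair q.1 q.2) ∧
    (D (strPrefix A q.2) q.1 && (List.range q.2).all fun i => !(D ((strPrefix A q.2).take i) q.1)) = true}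
  have hW : Sig A (fun x => x ∈ W) := by
    refine Sig.ex (Sig.and (Sig.dec (by fun_prop)) ?_)
    exact Sig.decA (h := fun τ (z : (ℕ × ℕ) × ℕ × ℕ) => D τ z.2.1 &&
      (List.range z.2.2).all fun i => !(D (τ.take i) z.2.1)) (n := fun z => z.2.2)
      (by fun_prop) (by fun_prop)
  have hw : wt W < ⊤ := by
    have : ∀ x : W, ∃ q : ℕ × ℕ, x.1 = (q.1, Nat.pair q.1 q.2) ∧
      (D (strPrefix A q.2) q.1 && (List.range q.2).all fun i => !(D ((strPrefix A q.2).take i) q.1)) = true :=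
      fun x => x.2
    choose g g1 g2 using this
    have inj : Function.Injective (fun x : W => (g x).1) := by
      intro x y hxy
      simp only at hxy
      have e : (g x).2 = (g y).2 := by
        have a := g2 x
        have b := g2 y
        simp only [Bool.and_eq_true, List.all_eq_true, List.mem_range, Bool.not_eq_true', sp_take] at a b
        rcases lt_trichotomy (g x).2 (g y).2 with h | h | h
        · have := b.2 _ h
          rw [min_eq_left h.le, ← hxy, a.1] at this; cases this
        · exact h
        · have := a.2 _ h
          rw [min_eq_left h.le, hxy, b.1] at this; cases this
      apply Subtype.ext
      rw [g1, g1, hxy, e]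
    have h1 : wt W ≤ ∑' n : ℕ, (2⁻¹ : ℝ≥0∞) ^ n := by
      refine le_trans (le_of_eq ?_) (ENNReal.tsum_comp_le_tsum_of_injective inj _)
      rw [wt]
      refine tsum_congr fun x => ?_
      rw [g1]
    refine h1.trans_lt ?_
    rw [ENNReal.tsum_geometric, ENNReal.one_sub_inv_two, inv_inv]; simp
  obtain ⟨V, V1, V2, V3⟩ := hL _ hW hw
  have hfin : ∀ n, ∃ M, ∀ ℓ, (n, Nat.pair n ℓ) ∈ V → ℓ < M := by
    intro n
    by_contra hcon
    push Not at hcon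
    have inf : {ℓ | (n, Nat.pair n ℓ) ∈ V}.Infinite := by
      rw [Set.infinite_iff_exists_gt]
      intro a
      obtain ⟨i, hi, hi'⟩ := hcon (a+1)
      exact ⟨i, hi, by omega⟩
    have : Infinite {ℓ | (n, Nat.pair n ℓ) ∈ V} := inf.to_subtype
    have inj : Function.Injective (fun ℓ : {ℓ | (n, Nat.pair n ℓ) ∈ V} => (⟨_, ℓ.2⟩ : V)) := by
      intro a b hab
      simp only [Subtype.mk.injEq, Prod.mk.injEq, true_and] at hab
      exact Subtype.ext (Nat.pair_eq_pair.1 hab).2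
    have h1 : ∑' ℓ : {ℓ | (n, Nat.pair n ℓ) ∈ V}, (2⁻¹ : ℝ≥0∞) ^ n ≤ wt V :=
      ENNReal.tsum_comp_le_tsum_of_injective inj fun x : V => (2⁻¹ : ℝ≥0∞) ^ x.1.1
    rw [ENNReal.tsum_const_eq_top_of_ne_zero (by simp)] at h1
    exact absurd V3 (not_lt.2 h1)
  refine turingLE_of_sig (Sig.trans hA ⟨D, Dc, Dm, DD⟩) ?_
  have h1 : Sig zeroJump (fun q : ℕ × ℕ => ¬ ∃ ℓ, q.2 ≤ ℓ ∧ (q.1, Nat.pair q.1 ℓ) ∈ V) := by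
    apply Sig.not_zj
    refine Sig.ex (Sig.and (Sig.dec (by fun_prop)) ?_)
    exact V1.comp (f := fun z : (ℕ × ℕ) × ℕ => (z.1.1, Nat.pair z.1.1 z.2)) (by fun_prop)
  have h2 : Sig zeroJump (fun q : ℕ × ℕ => (!(D (strPrefix A q.2) q.1)) = true) :=
    Sig.trans hA (Sig.decA (h := fun τ (q : ℕ × ℕ) => !(D τ q.1)) (n := fun q => q.2)
      (by fun_prop) (by fun_prop))
  refine (Sig.ex (p := fun n M => (¬∃ ℓ, M ≤ ℓ ∧ (n, Nat.pair n ℓ) ∈ V) ∧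
    (!(D (strPrefix A M) n)) = true) (h1.and h2)).of_eq fun n => ?_
  constructor
  · rintro ⟨M, h3, h4⟩
    by_contra hc
    rw [Bool.not_eq_false] at hc
    have hex := (DD n).1 hc
    have hin : (n, Nat.pair n (Nat.find hex)) ∈ V := by
      apply V2
      refine ⟨(n, Nat.find hex), rfl, ?_⟩
      simp only [Bool.and_eq_true, List.all_eq_true, List.mem_range, Bool.not_eq_true', sp_take]
      refine ⟨Nat.find_spec hex, fun i hi => ?_⟩
      rw [min_eq_left hi.le]
      simpa using Nat.find_min hex hi
    have hlt : Nat.find hex < M := by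
      by_contra hge
      exact h3 ⟨_, not_lt.1 hge, hin⟩
    simp only [Bool.not_eq_true'] at h4
    rw [Dm _ _ _ (sp_mono A hlt.le) (Nat.find_spec hex)] at h4; cases h4
  · intro h
    obtain ⟨M, hM⟩ := hfin n
    refine ⟨M, ?_, ?_⟩
    · rintro ⟨ℓ, h5, h6⟩; have := hM ℓ h6; omega
    · simp only [Bool.not_eq_true']
      by_contra hc
      rw [Bool.not_eq_false] at hc
      rw [(DD n).2 ⟨M, hc⟩] at h; cases h

theorem mu_inter_weight {C : Set (ℕ → Bool)} {T : Set (List Bool)} {δ : ℝ≥0∞}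
    (hT : ∀ τ ∈ T, μCantor (cylinder τ ∩ C) ≤ δ * 2⁻¹ ^ τ.length) :
    μCantor (openOf T ∩ C) ≤ δ * μCantor (openOf T) := by
  rw [← weight_minS, ← minS_open, openOf, Set.iUnion₂_inter]
  refine (measure_biUnion_le _ (Set.to_countable _) _).trans ?_
  rw [weight, ← ENNReal.tsum_mul_left]
  exact ENNReal.tsum_le_tsum fun τ => hT _ τ.2.1

theorem low_density (hX : MLRandom X) {S : Set (List Bool)} (hS : Sig emptyOracle (fun σ => σ ∈ S))
    (hXS : X ∉ openOf S)
    (hd : ∀ k, ∃ n, μCantor (cylinder (strPrefix X n) ∩ (openOf S)ᶜ) ≤ 2⁻¹ ^ k * 2⁻¹ ^ n) :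
    TuringLE zeroJump X := by
  obtain ⟨q, qc, qm, qe⟩ := sig_open_empty hS
  have hXq : ∀ t, q (strPrefix X t) = false := by
    intro t
    by_contra hc
    rw [Bool.not_eq_false] at hc
    exact hXS (by rw [qe]; exact ⟨t, hc⟩)
  let D : ℕ → ℕ → List Bool → Bool := fun n t ρ => !(q ρ) && (List.range (ρ.length + 1)).any fun ℓ =>
    decide (cnt (fun σ => !(q σ) && decide (σ.take ℓ = ρ.take ℓ)) t * 2 ^ (n + ℓ) ≤ 2 ^ t)
  have hD : ∀ n t Y, D n t (strPrefix Y t) = true ↔ q (strPrefix Y t) = false ∧ ∃ ℓ ≤ t,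
      μCantor (cylinder (strPrefix Y ℓ) ∩ {Z | q (strPrefix Z t) = false}) ≤ 2⁻¹ ^ n * 2⁻¹ ^ ℓ := by
    intro n t Y
    simp only [D, Bool.and_eq_true, Bool.not_eq_true', List.any_eq_true, List.mem_range,
      decide_eq_true_eq, sp_length, Nat.lt_succ_iff, sp_take]
    refine and_congr_right fun _ => exists_congr fun ℓ => and_congr_right fun hℓ => ?_
    rw [← mu_level_le_iff, pow_add]
    have : {Z | (!q (strPrefix Z t) && decide (List.take ℓ (strPrefix Z t) = strPrefix Y (min ℓ t))) = true} =
        cylinder (strPrefix Y ℓ) ∩ {Z | q (strPrefix Z t) = false} := by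
      ext Z
      simp only [Set.mem_ofPred_eq, Bool.and_eq_true, Bool.not_eq_true', decide_eq_true_eq, sp_take,
        Set.mem_inter_iff, mem_cyl, sp_length]
      rw [min_eq_left hℓ, and_comm]
    rw [this]
  refine complete_lemma hX D (by simp only [D]; fun_prop) 0 ?_ ?_ ?_
  · intro n t
    let C := {Z | q (strPrefix Z t) = false}
    let T : Set (List Bool) := {τ | μCantor (cylinder τ ∩ C) ≤ 2⁻¹ ^ n * 2⁻¹ ^ τ.length}
    have : {Y | D n t (strPrefix Y t) = true} ⊆ openOf T ∩ C := by
      intro Y hY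
      rw [Set.mem_ofPred_eq, hD] at hY
      obtain ⟨h1, ℓ, h2, h3⟩ := hY
      refine ⟨mem_openOf.2 ⟨ℓ, ?_⟩, h1⟩
      simpa [T] using h3
    refine (measure_mono this).trans ((mu_inter_weight (fun τ hτ => hτ)).trans ?_)
    rw [pow_zero, one_mul]
    exact mul_le_of_le_one_right' prob_le_one
  · intro n t t' htt h
    rw [hD] at *
    obtain ⟨h1, ℓ, h2, h3⟩ := h
    refine ⟨hXq _, ℓ, h2.trans htt, le_trans (measure_mono ?_) h3⟩
    refine Set.inter_subset_inter_right _ fun Z hZ => ?_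
    simp only [Set.mem_ofPred_eq] at *
    by_contra hc
    rw [Bool.not_eq_false] at hc
    rw [qm _ _ (sp_mono Z htt) hc] at hZ; cases hZ
  · intro n
    obtain ⟨ℓ, hℓ⟩ := hd (n+1)
    have hlt : μCantor (cylinder (strPrefix X ℓ) ∩ (openOf S)ᶜ) < 2⁻¹ ^ n * 2⁻¹ ^ ℓ := by
      refine hℓ.trans_lt ?_
      rw [← pow_add, ← pow_add]
      exact half_lt (by omega)
    have hanti : Antitone fun t => cylinder (strPrefix X ℓ) ∩ {Z | q (strPrefix Z t) = false} := by
      intro t t' htt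
      refine Set.inter_subset_inter_right _ fun Z hZ => ?_
      simp only [Set.mem_ofPred_eq] at *
      by_contra hc
      rw [Bool.not_eq_false] at hc
      rw [qm _ _ (sp_mono Z htt) hc] at hZ; cases hZ
    have heq : cylinder (strPrefix X ℓ) ∩ (openOf S)ᶜ =
        ⋂ t, cylinder (strPrefix X ℓ) ∩ {Z | q (strPrefix Z t) = false} := by
      rw [← Set.inter_iInter]
      congr 1
      rw [qe]
      ext Z
      simp [Op]
    rw [heq, hanti.measure_iInter (fun t => ((measurableSet_cyl _).inter
      (measurableSet_sp (fun σ => q σ = false) t)).nullMeasurableSet) ⟨0, measure_ne_top _ _⟩,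
      iInf_lt_iff] at hlt
    obtain ⟨t, ht⟩ := hlt
    refine ⟨max t ℓ, (hD _ _ _).2 ⟨hXq _, ℓ, le_max_right _ _, ?_⟩⟩
    exact (measure_mono (hanti (le_max_left t ℓ))).trans ht.le

end Low2

end

section
open MeasureTheory ENNReal

section Hungry

/-- string `ρ` lies in the part of `st` assigned to `x` -/
def hq (st : List ((ℕ × ℕ) × List Bool)) (x : ℕ × ℕ) (ρ : List Bool) : Bool :=
  st.any fun e => decide (e.1 = x) && decide (ρ.take e.2.length = e.2)

def hused (st : List ((ℕ × ℕ) × List Bool)) (ρ : List Bool) : Bool :=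
  st.any fun e => decide (ρ.take e.2.length = e.2)

def havail (h : List Bool → ℕ × ℕ → Bool) (st : List ((ℕ × ℕ) × List Bool)) (s : ℕ) (x : ℕ × ℕ) :
    List (List Bool) := (strs s).filter fun ρ => h ρ x && !(hused st ρ)

def hroom (d : ℕ) (st : List ((ℕ × ℕ) × List Bool)) (s : ℕ) (x : ℕ × ℕ) : ℕ :=
  if x.1 + d ≤ s then 2 ^ (s - (x.1 + d)) - cnt (hq st x) s else 0

def hact (s : ℕ) : ℕ × ℕ := (s.unpair.1).unpair

def hst (h : List Bool → ℕ × ℕ → Bool) (d : ℕ) : ℕ → List ((ℕ × ℕ) × List Bool)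
  | 0 => []
  | s+1 => hst h d s ++ ((havail h (hst h d s) s (hact s)).take (hroom d (hst h d s) s (hact s))).map
      fun ρ => (hact s, ρ)

theorem countP_add {α : Type} [DecidableEq α] {l t : List α} {p p' : α → Bool} (hl : l.Nodup)
    (ht : t.Nodup) (hs : ∀ a ∈ t, a ∈ l) (hd : ∀ a ∈ t, p a = false)
    (hp : ∀ a ∈ l, p' a = true ↔ p a = true ∨ a ∈ t) : l.countP p' = l.countP p + t.length := by
  rw [List.countP_eq_length_filter, List.countP_eq_length_filter, ← List.length_append]
  apply List.Perm.length_eq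
  rw [List.perm_ext_iff_of_nodup (hl.filter _)]
  · intro a
    simp only [List.mem_filter, List.mem_append]
    constructor
    · rintro ⟨h1, h2⟩
      exact ((hp a h1).1 h2).imp (fun h => ⟨h1, h⟩) id
    · rintro (⟨h1, h2⟩ | h1)
      · exact ⟨h1, (hp a h1).2 (.inl h2)⟩
      · exact ⟨hs a h1, (hp a (hs a h1)).2 (.inr h1)⟩
  · refine (hl.filter _).append ht ?_
    intro a h1 h2
    have := (List.mem_filter.1 h1).2
    rw [hd a h2] at this; cases this

variable {h : List Bool → ℕ × ℕ → Bool} {d : ℕ}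

theorem cHst (hc : Computable (fun q : List Bool × (ℕ × ℕ) => h q.1 q.2)) :
    Computable (fun q : ℕ × ℕ => hst h q.1 q.2) := by
  have e : ∀ q : ℕ × ℕ, hst h q.1 q.2 = Nat.rec (motive := fun _ => List ((ℕ × ℕ) × List Bool)) []
      (fun s st => st ++ ((havail h st s (hact s)).take (hroom q.1 st s (hact s))).map
      fun ρ => (hact s, ρ)) q.2 := by
    rintro ⟨d, s⟩
    induction s with
    | zero => rfl
    | succ s ih => simp only [hst] at *; rw [ih]
  refine Computable.of_eq ?_ (fun q => (e q).symm)
  unfold havail hroom hact hused hq cnt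
  fun_prop

def hM (h : List Bool → ℕ × ℕ → Bool) (d : ℕ) (x : ℕ × ℕ) (s : ℕ) : Set (ℕ → Bool) :=
  {Y | ∃ e ∈ hst h d s, e.1 = x ∧ strPrefix Y e.2.length = e.2}

theorem hst_len {s : ℕ} : ∀ e ∈ hst h d s, e.2.length < s ∧ h e.2 e.1 = true := by
  induction s with
  | zero => intro e he; simp [hst] at he
  | succ s ih =>
    intro e he
    rw [hst, List.mem_append, List.mem_map] at he
    rcases he with he | ⟨ρ, hρ, rfl⟩
    · exact ⟨(ih e he).1.trans (Nat.lt_succ_self s), (ih e he).2⟩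
    · have := List.mem_filter.1 (List.mem_of_mem_take hρ)
      have h2 := this.2
      simp only [Bool.and_eq_true] at h2
      exact ⟨Nat.lt_succ_of_le (mem_strs.1 this.1).le, h2.1⟩

theorem hst_mono {s t : ℕ} (hst' : s ≤ t) : ∀ e ∈ hst h d s, e ∈ hst h d t := by
  induction t, hst' using Nat.le_induction with
  | base => exact fun e he => he
  | succ t _ ih => intro e he; rw [hst]; exact List.mem_append_left _ (ih e he)

theorem hM_eq {x : ℕ × ℕ} {s t : ℕ} (hs : s ≤ t + 1) :
    hM h d x s = {Y | hq (hst h d s) x (strPrefix Y t) = true} := by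
  ext Y
  simp only [hM, hq, Set.mem_ofPred_eq, List.any_eq_true, Bool.and_eq_true, decide_eq_true_eq, sp_take]
  constructor
  · rintro ⟨e, he, h1, h2⟩
    refine ⟨e, he, h1, ?_⟩
    rw [min_eq_left (by have := (hst_len e he).1; omega), h2]
  · rintro ⟨e, he, h1, h2⟩
    refine ⟨e, he, h1, ?_⟩
    rw [min_eq_left (by have := (hst_len e he).1; omega)] at h2
    exact h2

/-- the strings taken at stage `s` -/
def htk (h : List Bool → ℕ × ℕ → Bool) (d s : ℕ) : List (List Bool) :=
  (havail h (hst h d s) s (hact s)).take (hroom d (hst h d s) s (hact s))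

theorem mem_hst_succ {s : ℕ} {e : (ℕ × ℕ) × List Bool} : e ∈ hst h d (s+1) ↔
    e ∈ hst h d s ∨ (e.1 = hact s ∧ e.2 ∈ htk h d s) := by
  rw [hst, List.mem_append, List.mem_map]
  constructor
  · rintro (h | ⟨ρ, hρ, rfl⟩)
    · exact .inl h
    · exact .inr ⟨rfl, hρ⟩
  · rintro (h | ⟨h1, h2⟩)
    · exact .inl h
    · exact .inr ⟨e.2, h2, by rw [← h1]⟩

theorem htk_spec {s : ℕ} {ρ : List Bool} (hρ : ρ ∈ htk h d s) :
    ρ.length = s ∧ h ρ (hact s) = true ∧ hused (hst h d s) ρ = false := by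
  have := List.mem_filter.1 (List.mem_of_mem_take hρ)
  have h2 := this.2
  simp only [Bool.and_eq_true, Bool.not_eq_true'] at h2
  exact ⟨mem_strs.1 this.1, h2.1, h2.2⟩

theorem hcnt_succ {s : ℕ} : cnt (hq (hst h d (s+1)) (hact s)) s =
    cnt (hq (hst h d s) (hact s)) s + (htk h d s).length := by
  unfold cnt
  refine countP_add (strs_nodup s) ?_ ?_ ?_ ?_
  · exact ((strs_nodup s).filter _).sublist (List.take_sublist _ _)
  · exact fun a ha => mem_strs.2 (htk_spec ha).1
  · intro a ha
    have := (htk_spec ha).2.2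
    simp only [hused, List.any_eq_false, decide_eq_true_eq] at this
    simp only [hq, List.any_eq_false, Bool.and_eq_true, decide_eq_true_eq]
    exact fun e he h => this e he h.2
  · intro a ha
    have hl := mem_strs.1 ha
    simp only [hq, List.any_eq_true, Bool.and_eq_true, decide_eq_true_eq]
    constructor
    · rintro ⟨e, he, h1, h2⟩
      rcases mem_hst_succ.1 he with h3 | ⟨h3, h4⟩
      · exact .inl ⟨e, h3, h1, h2⟩
      · right
        rw [(htk_spec h4).1, ← hl, List.take_length] at h2
        rwa [h2]
    · rintro (⟨e, he, h1, h2⟩ | h1)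
      · exact ⟨e, mem_hst_succ.2 (.inl he), h1, h2⟩
      · exact ⟨(hact s, a), mem_hst_succ.2 (.inr ⟨rfl, h1⟩), rfl, List.take_length⟩

theorem hM_succ_ne {s : ℕ} {x : ℕ × ℕ} (hx : x ≠ hact s ∨ htk h d s = []) :
    hM h d x (s+1) = hM h d x s := by
  ext Y
  constructor
  · rintro ⟨e, he, h1, h2⟩
    rcases mem_hst_succ.1 he with h3 | ⟨h3, h4⟩
    · exact ⟨e, h3, h1, h2⟩
    · rcases hx with hx | hx
      · exact absurd (h1.symm.trans h3) hx
      · rw [hx] at h4; cases h4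
  · rintro ⟨e, he, h1, h2⟩
    exact ⟨e, mem_hst_succ.2 (.inl he), h1, h2⟩

theorem mu_hM (x : ℕ × ℕ) (s : ℕ) : μCantor (hM h d x s) ≤ 2⁻¹ ^ (x.1 + d) := by
  induction s with
  | zero =>
    have : hM h d x 0 = ∅ := by ext Y; simp [hM, hst]
    rw [this]; simp
  | succ s ih =>
    by_cases hx : x = hact s
    swap
    · rwa [hM_succ_ne (.inl hx)]
    by_cases hr : x.1 + d ≤ s
    swap
    · rwa [hM_succ_ne (.inr ?_)]
      rw [htk, hroom, ← hx, if_neg hr, List.take_zero]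
    rw [hM_eq (s := s) (t := s) (by omega), mu_level_le_iff] at ih
    rw [hM_eq (s := s+1) (t := s) le_rfl, mu_level_le_iff]
    subst hx
    rw [hcnt_succ]
    have h1 : (htk h d s).length ≤ 2 ^ (s - ((hact s).1 + d)) - cnt (hq (hst h d s) (hact s)) s := by
      rw [htk, hroom, if_pos hr]; exact List.length_take_le _ _
    have h2 : 2 ^ s = 2 ^ (s - ((hact s).1 + d)) * 2 ^ ((hact s).1 + d) := by
      rw [← pow_add]; congr 1; omega
    rw [h2] at ih ⊢
    have ih' := Nat.le_of_mul_le_mul_right ih (by positivity)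
    apply Nat.mul_le_mul_right
    omega

def hC (h : List Bool → ℕ × ℕ → Bool) (d : ℕ) (x : ℕ × ℕ) : Set (ℕ → Bool) := ⋃ s, hM h d x s

theorem hM_mono (x : ℕ × ℕ) : Monotone (hM h d x) := by
  rintro s t hst Y ⟨e, he, h1⟩
  exact ⟨e, hst_mono hst e he, h1⟩

theorem mu_hC (x : ℕ × ℕ) : μCantor (hC h d x) ≤ 2⁻¹ ^ (x.1 + d) := by
  rw [hC, (hM_mono x).measure_iUnion]
  exact iSup_le fun s => mu_hM x s

theorem hM_meas (x : ℕ × ℕ) (s : ℕ) : MeasurableSet (hM h d x s) := by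
  rw [hM_eq (t := s) (by omega)]
  exact measurableSet_sp (fun ρ => hq (hst h d s) x ρ = true) _

theorem hM_disj {x y : ℕ × ℕ} (hxy : x ≠ y) (s : ℕ) : Disjoint (hM h d x s) (hM h d y s) := by
  induction s with
  | zero =>
    have : hM h d x 0 = ∅ := by ext Y; simp [hM, hst]
    rw [this]; simp
  | succ s ih =>
    rw [Set.disjoint_left] at *
    rintro Y ⟨e, he, h1, h2⟩ ⟨e', he', h1', h2'⟩
    have key : ∀ e ∈ hst h d s, ∀ e' : (ℕ × ℕ) × List Bool, e'.2 ∈ htk h d s →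
        strPrefix Y e.2.length = e.2 → strPrefix Y e'.2.length = e'.2 → False := by
      intro e he e' he' h2 h2'
      have h4 := (htk_spec he').2.2
      simp only [hused, List.any_eq_false, decide_eq_true_eq] at h4
      apply h4 e he
      rw [← h2', sp_take, min_eq_left, h2]
      rw [(htk_spec he').1]; exact (hst_len e he).1.le
    rcases mem_hst_succ.1 he with h3 | ⟨h3, h4⟩ <;>
    rcases mem_hst_succ.1 he' with h3' | ⟨h3', h4'⟩
    · exact ih ⟨e, h3, h1, h2⟩ ⟨e', h3', h1', h2'⟩
    · exact key e h3 e' h4' h2 h2'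
    · exact key e' h3' e h4 h2' h2
    · exact hxy (h1.symm.trans (h3.trans (h3'.symm.trans h1')))

theorem hC_disj : Pairwise (Function.onFun Disjoint (hC h d)) := by
  intro x y hxy
  rw [Function.onFun, Set.disjoint_left]
  intro Y h1 h2
  obtain ⟨s, hs⟩ := Set.mem_iUnion.1 h1
  obtain ⟨t, ht⟩ := Set.mem_iUnion.1 h2
  exact Set.disjoint_left.1 (hM_disj (h := h) (d := d) hxy (max s t)) (hM_mono x (le_max_left _ _) hs)
    (hM_mono y (le_max_right _ _) ht)

def hV (h : List Bool → ℕ × ℕ → Bool) (d : ℕ) : Set (ℕ × ℕ) := {x | ∃ s, x.1 + d ≤ s ∧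
  2 ^ (s - (x.1 + d)) ≤ cnt (hq (hst h d (s+1)) x) s}

theorem mu_hV {x : ℕ × ℕ} (hx : x ∈ hV h d) : 2⁻¹ ^ (x.1 + d) ≤ μCantor (hC h d x) := by
  obtain ⟨s, hs, h1⟩ := hx
  refine le_trans ?_ (measure_mono (Set.subset_iUnion _ (s+1)))
  rw [hM_eq le_rfl, mu_level]
  calc (2⁻¹ : ℝ≥0∞) ^ (x.1 + d) = (2 ^ (s - (x.1 + d)) : ℕ) * 2⁻¹ ^ s := by
        conv_rhs => rw [show s = (s - (x.1 + d)) + (x.1 + d) by omega, pow_add (2⁻¹ : ℝ≥0∞)]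
        rw [Nat.add_sub_cancel, ← mul_assoc]
        push_cast
        rw [← mul_pow, ENNReal.mul_inv_cancel (by simp) (by simp), one_pow, one_mul]
    _ ≤ _ := by gcongr

theorem wt_hV : wt (hV h d) ≤ 2 ^ d := by
  have h1 : ∑' x : hV h d, (2⁻¹ : ℝ≥0∞) ^ (x.1.1 + d) ≤ 1 := by
    calc _ ≤ ∑' x : hV h d, μCantor (hC h d x.1) := ENNReal.tsum_le_tsum fun x => mu_hV x.2
      _ ≤ ∑' x, μCantor (hC h d x) :=
        ENNReal.tsum_comp_le_tsum_of_injective Subtype.val_injective _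
      _ = μCantor (⋃ x, hC h d x) := (measure_iUnion hC_disj fun x =>
          MeasurableSet.iUnion fun s => hM_meas x s).symm
      _ ≤ 1 := prob_le_one
  simp only [pow_add, ENNReal.tsum_mul_right] at h1
  calc wt (hV h d) = wt (hV h d) * 2⁻¹ ^ d * 2 ^ d := by
        rw [mul_assoc, ← mul_pow, ENNReal.inv_mul_cancel (by simp) (by simp), one_pow, mul_one]
    _ ≤ 1 * 2 ^ d := by gcongr; exact h1
    _ = _ := one_mul _

theorem lprop_of_base {A X : ℕ → Bool} (hX : MLRandomIn A X) (hA : TuringLE A X) : LProp A := by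
  intro W hW hwt
  obtain ⟨h, hc, hm, hh⟩ := Sig.trans hA hW
  obtain ⟨K, hK⟩ : ∃ K : ℕ, wt W ≤ 2 ^ K := by
    obtain ⟨n, hn⟩ := ENNReal.exists_nat_gt hwt.ne
    refine ⟨n, hn.le.trans ?_⟩
    exact_mod_cast n.lt_two_pow_self.le
  have cs := cHst hc
  have hR : Sig A (fun q : ℕ × List Bool => ∃ x : ℕ × ℕ, x ∈ W ∧ ∃ s : ℕ, (x, q.2) ∈ hst h q.1 s) := by
    refine Sig.ex (p := fun (q : ℕ × List Bool) (x : ℕ × ℕ) => x ∈ W ∧ ∃ s : ℕ, (x, q.2) ∈ hst h q.1 s)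
      (Sig.and (hW.comp (f := fun z : (ℕ × List Bool) × (ℕ × ℕ) => z.2) (by fun_prop)) ?_)
    refine Sig.ex (p := fun (z : (ℕ × List Bool) × (ℕ × ℕ)) (s : ℕ) => (z.2, z.1.2) ∈ hst h z.1.1 s) ?_
    have : Sig A (fun z : ((ℕ × List Bool) × (ℕ × ℕ)) × ℕ =>
        ((hst h z.1.1.1 z.2).any fun e => decide (e = (z.1.2, z.1.1.2))) = true) := by
      apply Sig.dec
      fun_prop
    refine this.of_eq fun z => ?_
    simp [List.any_eq_true]
  obtain ⟨d, hd⟩ := test_lemma' (X := X) (C := fun d => ⋃ x : W, hC h d x.1)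
      (R := fun d σ => ∃ x : ℕ × ℕ, x ∈ W ∧ ∃ s : ℕ, (x, σ) ∈ hst h d s) hR (by
    intro d
    ext Y
    rw [mem_openOf']
    simp only [hC, hM, Set.mem_iUnion, Set.mem_ofPred_eq]
    constructor
    · rintro ⟨⟨x, hx⟩, s, e, he, rfl, h2⟩
      exact ⟨e.2, ⟨e.1, hx, s, he⟩, isPrefixOf_iff.2 h2⟩
    · rintro ⟨σ, ⟨x, hx, s, he⟩, h2⟩
      exact ⟨⟨x, hx⟩, s, _, he, rfl, isPrefixOf_iff.1 h2⟩) K (by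
    intro d
    calc _ ≤ ∑' x : W, μCantor (hC h d x.1) := measure_iUnion_le _
      _ ≤ ∑' x : W, 2⁻¹ ^ (x.1.1 + d) := ENNReal.tsum_le_tsum fun x => mu_hC _
      _ = wt W * 2⁻¹ ^ d := by simp only [pow_add, ENNReal.tsum_mul_right, wt]
      _ ≤ _ := by gcongr) hX
  have hno : ∀ x s, X ∉ hM h d x s := by
    rintro x s ⟨e, he, h1, h2⟩
    apply hd
    refine Set.mem_iUnion.2 ⟨⟨x, ?_⟩, Set.mem_iUnion.2 ⟨s, e, he, h1, h2⟩⟩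
    refine (hh x).2 ⟨e.2.length, ?_⟩
    rw [h2, ← h1]; exact (hst_len e he).2
  refine ⟨hV h d, ?_, ?_, wt_hV.trans_lt (by simp)⟩
  · show Sig _ (fun x : ℕ × ℕ => ∃ s, x.1 + d ≤ s ∧ 2 ^ (s - (x.1 + d)) ≤ cnt (hq (hst h d (s+1)) x) s)
    refine Sig.ex (p := fun (x : ℕ × ℕ) s => x.1 + d ≤ s ∧
      2 ^ (s - (x.1 + d)) ≤ cnt (hq (hst h d (s+1)) x) s) (Sig.dec ?_)
    unfold hq cnt
    fun_prop
  · intro x hx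
    obtain ⟨ℓ, hℓ⟩ := (hh x).1 hx
    set s := Nat.pair (Nat.pair x.1 x.2) (ℓ + (x.1 + d)) with hs
    have hsl : ℓ + (x.1 + d) ≤ s := Nat.right_le_pair _ _
    have hact' : hact s = x := by simp [hact, hs]
    refine ⟨s, by omega, ?_⟩
    have hav : strPrefix X s ∈ havail h (hst h d s) s (hact s) := by
      rw [havail, List.mem_filter, mem_strs, sp_length, hact']
      refine ⟨rfl, ?_⟩
      rw [hm _ _ _ (sp_mono X (by omega)) hℓ, Bool.true_and, Bool.not_eq_true']
      simp only [hused, List.any_eq_false, decide_eq_true_eq]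
      intro e he h2
      apply hno e.1 s
      refine ⟨e, he, rfl, ?_⟩
      rwa [sp_take, min_eq_left (hst_len e he).1.le] at h2
    have hlen : hroom d (hst h d s) s (hact s) < (havail h (hst h d s) s (hact s)).length := by
      by_contra hc
      apply hno x (s+1)
      refine ⟨(x, strPrefix X s), mem_hst_succ.2 (.inr ⟨hact'.symm, ?_⟩), rfl, by simp only [sp_length]⟩
      rw [htk, List.take_of_length_le (not_lt.1 hc)]
      exact hav
    have h3 : (htk h d s).length = hroom d (hst h d s) s (hact s) := by
      rw [htk, List.length_take, min_eq_left hlen.le]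
    have h4 := hcnt_succ (h := h) (d := d) (s := s)
    rw [h3, hroom, hact', if_pos (by omega)] at h4
    omega

/-- left-c.e. random sequences are complete -/
theorem lce_complete {X : ℕ → Bool} (hX : MLRandom X) (a : ℕ → ℕ → ℕ)
    (ac : Computable (fun q : ℕ × ℕ => a q.1 q.2)) (am : ∀ t t' n, t ≤ t' → a t n ≤ a t' n)
    (aX : ∀ n, ∃ t₀, ∀ t ≥ t₀, a t n = num (strPrefix X n)) : TuringLE zeroJump X := by
  refine complete_lemma hX (fun n t ρ => decide (n ≤ t) && decide (num (ρ.take n) = a t n))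
    (by unfold num; fun_prop) 0 ?_ ?_ ?_
  · intro n t
    by_cases hnt : n ≤ t
    swap
    · simp [hnt]
    have e : {Y : ℕ → Bool | (decide (n ≤ t) && decide (num ((strPrefix Y t).take n) = a t n)) = true} =
        {Y | (fun ρ => decide (num ρ = a t n)) (strPrefix Y n) = true} := by
      ext Y
      simp only [Set.mem_ofPred_eq, Bool.and_eq_true, decide_eq_true_eq, sp_take, min_eq_left hnt, hnt,
        true_and]
    rw [e, mu_level (fun ρ => decide (num ρ = a t n))]
    have : cnt (fun ρ => decide (num ρ = a t n)) n ≤ 1 := by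
      unfold cnt
      rw [List.countP_eq_length_filter]
      by_contra hc
      push Not at hc
      have nd := (strs_nodup n).filter (fun ρ => decide (num ρ = a t n))
      set l := (strs n).filter (fun ρ => decide (num ρ = a t n)) with hl
      have p0 := List.mem_filter.1 (l.getElem_mem (n := 0) (by omega))
      have p1 := List.mem_filter.1 (l.getElem_mem (n := 1) (by omega))
      have : l[0] = l[1] := num_inj ((mem_strs.1 p0.1).trans (mem_strs.1 p1.1).symm)
        ((of_decide_eq_true p0.2).trans (of_decide_eq_true p1.2).symm)
      have := (List.Nodup.getElem_inj_iff nd).1 this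
      omega
    calc _ ≤ ((1:ℕ) : ℝ≥0∞) * 2⁻¹ ^ n := by gcongr
      _ = _ := by simp
  · intro n t t' htt h1
    simp only [Bool.and_eq_true, decide_eq_true_eq, sp_take] at *
    rw [min_eq_left h1.1] at h1
    rw [min_eq_left (h1.1.trans htt)]
    refine ⟨h1.1.trans htt, ?_⟩
    obtain ⟨t₀, ht⟩ := aX n
    have := ht (max t₀ t') (le_max_left _ _)
    have h2 := am t t' n htt
    have h3 := am t' (max t₀ t') n (le_max_right _ _)
    omega
  · intro n
    obtain ⟨t₀, ht⟩ := aX n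
    refine ⟨max t₀ n, ?_⟩
    simp only [Bool.and_eq_true, decide_eq_true_eq, sp_take]
    rw [min_eq_left (le_max_right _ _), ht _ (le_max_left _ _)]
    exact ⟨le_max_right _ _, rfl⟩

end Hungry

end

section
open MeasureTheory ENNReal

section Dens

/-- oracle computation with a finite oracle -/
def oc (τ : List Bool) (e n m : ℕ) : Bool :=
  (List.range (τ.length + 1)).any fun j => (Nat.Partrec.Code.evaln τ.length
      (Denumerable.ofNat Nat.Partrec.Code e) (Nat.pair (Encodable.encode (τ.take j))
        (Nat.pair n m))).isSome

theorem oc_mono {τ τ' : List Bool} {e n m : ℕ} (h : τ <+: τ') (hl : oc τ e n m = true) :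
    oc τ' e n m = true := by
  simp only [oc, List.any_eq_true, List.mem_range, Nat.lt_succ_iff, Option.isSome_iff_exists] at *
  obtain ⟨j, hj, a, ha⟩ := hl
  refine ⟨j, hj.trans h.length_le, a, ?_⟩
  rw [take_of_prefix h hj]
  exact Nat.Partrec.Code.evaln_mono h.length_le ha

theorem oc_iff {A : ℕ → Bool} {e n m : ℕ} : OracleComputes e A n m ↔ ∃ ℓ, oc (strPrefix A ℓ) e n m = true := by
  simp only [oc, List.any_eq_true, List.mem_range, Nat.lt_succ_iff, Option.isSome_iff_exists, sp_length,
    sp_take, OracleComputes, WEnum, Part.dom_iff_mem]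
  constructor
  · rintro ⟨σ, hσ, a, ha⟩
    obtain ⟨k, hk⟩ := Nat.Partrec.Code.evaln_complete.1 ha
    refine ⟨max k σ.length, σ.length, le_max_right _ _, a, ?_⟩
    rw [min_eq_left (le_max_right _ _), isPrefixOf_iff.1 hσ]
    exact Nat.Partrec.Code.evaln_mono (le_max_left _ _) hk
  · rintro ⟨ℓ, j, hj, a, ha⟩
    refine ⟨_, isPrefixOf_iff.2 ?_, a, Nat.Partrec.Code.evaln_sound ha⟩
    rw [sp_length]

def jn (σ ρ : List Bool) : List Bool := (List.range (2 * min σ.length ρ.length)).map fun i =>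
  if i % 2 = 0 then σ.getD (i/2) false else ρ.getD (i/2) false

theorem jn_sp (A Y : ℕ → Bool) (n : ℕ) :
    jn (strPrefix A n) (strPrefix Y n) = strPrefix (joinSet A Y) (2 * n) := by
  simp only [jn, sp_length, min_self]
  unfold strPrefix
  apply List.map_congr_left
  intro i hi
  have hi : i / 2 < n := by have := List.mem_range.1 hi; omega
  have e : ∀ A : ℕ → Bool, (strPrefix A n).getD (i/2) false = A (i/2) := by
    intro A; rw [List.getD_eq_getElem?_getD, sp_getElem? _ _ _ hi]; rfl
  have e1 := e A
  have e2 := e Y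
  unfold strPrefix at e1 e2
  simp only [joinSet, e1, e2]

def gg (σ ρ : List Bool) (n : ℕ) : Bool := oc (jn σ ρ) n.unpair.1 n 0

/-- decoding the string and the exponent -/
def dk (n : ℕ) : ℕ := n.unpair.2.unpair.1
def dt (n : ℕ) : List Bool := (Encodable.decode (α := List Bool) n.unpair.2.unpair.2).getD []

def qa (n : ℕ) (σ ρ : List Bool) : Bool := decide (ρ.take (dt n).length = dt n) && gg σ ρ n
def qc (n : ℕ) (σ ρ : List Bool) : Bool := decide (ρ.take (dt n).length = dt n) && !(gg σ ρ n)
/-- relative measure of the 0-computations above `dt n` exceeds `1-2^-k` at level `s` -/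
def bd (n : ℕ) (σ : List Bool) (s : ℕ) : Bool :=
  decide ((dt n).length ≤ s) && decide (cnt (qc n σ) s * 2 ^ (dk n + (dt n).length) ≤ 2 ^ s)

def qok (n : ℕ) (σ ρ : List Bool) : Bool := qa n σ ρ && !(bd n σ ρ.length)

theorem gg_mono {A Y : ℕ → Bool} {n s t : ℕ} (hst : s ≤ t)
    (h : gg (strPrefix A s) (strPrefix Y s) n = true) :
    gg (strPrefix A t) (strPrefix Y t) n = true := by
  unfold gg at *
  rw [jn_sp] at *
  exact oc_mono (sp_mono _ (by omega)) h

theorem gg_iff {A Y : ℕ → Bool} {n : ℕ} : (∃ s, gg (strPrefix A s) (strPrefix Y s) n = true) ↔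
    OracleComputes n.unpair.1 (joinSet A Y) n 0 := by
  unfold gg
  simp only [jn_sp, oc_iff]
  constructor
  · rintro ⟨s, h⟩; exact ⟨_, h⟩
  · rintro ⟨s, h⟩; exact ⟨s, oc_mono (sp_mono _ (by omega)) h⟩

variable {A X : ℕ → Bool}

theorem len_take {ρ τ : List Bool} (h : ρ.take τ.length = τ) : τ.length ≤ ρ.length := by
  have := congrArg List.length h
  rw [List.length_take] at this
  omega

theorem bd_spec {n s : ℕ} (hs : (dt n).length ≤ s) : bd n (strPrefix A s) s = true ↔
    μCantor (cylinder (dt n) ∩ {Y | gg (strPrefix A s) (strPrefix Y s) n = false}) ≤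
      2⁻¹ ^ (dk n + (dt n).length) := by
  simp only [bd, Bool.and_eq_true, decide_eq_true_eq, hs, true_and]
  rw [← mu_level_le_iff]
  have : {Y | qc n (strPrefix A s) (strPrefix Y s) = true} =
      cylinder (dt n) ∩ {Y | gg (strPrefix A s) (strPrefix Y s) n = false} := by
    ext Y
    simp only [qc, Set.mem_ofPred_eq, Bool.and_eq_true, decide_eq_true_eq, sp_take, Set.mem_inter_iff,
      mem_cyl, Bool.not_eq_true', min_eq_left hs]
  rw [this]

theorem not_bd_spec {n s : ℕ} (hs : (dt n).length ≤ s) (h : bd n (strPrefix A s) s = false) :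
    μCantor (cylinder (dt n) ∩ {Y | gg (strPrefix A s) (strPrefix Y s) n = true}) ≤
      (1 - 2⁻¹ ^ (dk n)) * 2⁻¹ ^ (dt n).length := by
  have h1 : 2⁻¹ ^ (dk n + (dt n).length) <
      μCantor (cylinder (dt n) ∩ {Y | gg (strPrefix A s) (strPrefix Y s) n = false}) := by
    rw [← not_le, ← bd_spec hs, h]; simp
  have h2 : μCantor (cylinder (dt n) ∩ {Y | gg (strPrefix A s) (strPrefix Y s) n = true}) +
      μCantor (cylinder (dt n) ∩ {Y | gg (strPrefix A s) (strPrefix Y s) n = false}) =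
      2⁻¹ ^ (dt n).length := by
    rw [← mu_cyl, ← measure_inter_add_diff (cylinder (dt n))
      (measurableSet_sp (fun ρ => gg (strPrefix A s) ρ n = true) s)]
    congr 2
    ext Y; simp
  rw [ENNReal.sub_mul (by simp), one_mul, ← pow_add]
  apply ENNReal.le_sub_of_add_le_right (by simp)
  rw [← h2]
  gcongr

theorem mu_qok (n : ℕ) : μCantor (openOf {ρ | qok n (strPrefix A ρ.length) ρ = true}) ≤
    (1 - 2⁻¹ ^ (dk n)) * 2⁻¹ ^ (dt n).length := by
  let D : ℕ → Set (ℕ → Bool) := fun s => {Y | ∃ s' < s, qok n (strPrefix A s') (strPrefix Y s') = true}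
  have hD : openOf {ρ | qok n (strPrefix A ρ.length) ρ = true} = ⋃ s, D s := by
    ext Y
    simp only [mem_openOf, Set.mem_iUnion, D, Set.mem_ofPred_eq, sp_length]
    exact ⟨fun ⟨s, h⟩ => ⟨s+1, s, Nat.lt_succ_self s, h⟩, fun ⟨s, s', _, h⟩ => ⟨s', h⟩⟩
  have hm : Monotone D := by
    rintro s t hst Y ⟨s', h1, h2⟩
    exact ⟨s', h1.trans_le hst, h2⟩
  rw [hD, hm.measure_iUnion]
  refine iSup_le fun s => ?_
  induction s with
  | zero =>
    have : D 0 = ∅ := by ext Y; simp [D]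
    rw [this]; simp
  | succ s ih =>
    by_cases hc : (dt n).length ≤ s ∧ bd n (strPrefix A s) s = false
    · refine le_trans (measure_mono ?_) (not_bd_spec hc.1 hc.2)
      rintro Y ⟨s', h1, h2⟩
      simp only [qok, qa, Bool.and_eq_true, decide_eq_true_eq] at h2
      refine ⟨?_, gg_mono (Nat.lt_succ_iff.1 h1) h2.1.2⟩
      have := len_take h2.1.1
      rw [mem_cyl]
      rw [sp_length] at this
      have h3 := h2.1.1
      rwa [sp_take, min_eq_left this] at h3
    · refine le_trans (measure_mono ?_) ih
      rintro Y ⟨s', h1, h2⟩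
      rcases (Nat.lt_succ_iff.1 h1).eq_or_lt with rfl | h3
      · simp only [qok, qa, Bool.and_eq_true, decide_eq_true_eq, Bool.not_eq_true', sp_length] at h2
        have := len_take h2.1.1
        rw [sp_length] at this
        exact absurd ⟨this, h2.2⟩ hc
      · exact ⟨s', h3, h2⟩

@[fun_prop] theorem cGg {α : Type} [Primcodable α] {σ ρ : α → List Bool} {n : α → ℕ}
    (hσ : Computable σ) (hρ : Computable ρ) (hn : Computable n) :
    Computable (fun a => gg (σ a) (ρ a) (n a)) := by unfold gg oc jn; fun_prop
@[fun_prop] theorem cDk {α : Type} [Primcodable α] {n : α → ℕ}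
    (hn : Computable n) : Computable (fun a => dk (n a)) := by unfold dk; fun_prop
@[fun_prop] theorem cDt {α : Type} [Primcodable α] {n : α → ℕ}
    (hn : Computable n) : Computable (fun a => dt (n a)) := by
  have : ∀ n, dt n = (Encodable.decode (α := List Bool) n.unpair.2.unpair.2).elim [] id := by
    intro n; unfold dt; cases Encodable.decode (α := List Bool) n.unpair.2.unpair.2 <;> rfl
  simp only [this, id]; fun_prop
@[fun_prop] theorem cQa {α : Type} [Primcodable α] {σ ρ : α → List Bool} {n : α → ℕ}
    (hσ : Computable σ) (hρ : Computable ρ) (hn : Computable n) :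
    Computable (fun a => qa (n a) (σ a) (ρ a)) := by unfold qa; fun_prop
@[fun_prop] theorem cBd {α : Type} [Primcodable α] {σ : α → List Bool} {s n : α → ℕ}
    (hσ : Computable σ) (hs : Computable s) (hn : Computable n) :
    Computable (fun a => bd (n a) (σ a) (s a)) := by unfold bd qc; fun_prop

/-- iterating a relation from a starting point -/
def Sr {α : Type} (x₀ : α) (R : α → α → Prop) : ℕ → Set α
  | 0 => {x₀}
  | m+1 => {ρ | ∃ τ ∈ Sr x₀ R m, R τ ρ}

theorem mem_Sr {α : Type} {x₀ : α} {R : α → α → Prop} {m : ℕ} {ρ : α} : ρ ∈ Sr x₀ R m ↔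
    ∃ L : List α, L.getD 0 x₀ = x₀ ∧ L.getD m x₀ = ρ ∧
      ∀ i < m, R (L.getD i x₀) (L.getD (i+1) x₀) := by
  constructor
  · intro h
    have : ∃ f : ℕ → α, f 0 = x₀ ∧ f m = ρ ∧ ∀ i < m, R (f i) (f (i+1)) := by
      induction m generalizing ρ with
      | zero => exact ⟨fun _ => x₀, rfl, h.symm, by simp⟩
      | succ m ih =>
        obtain ⟨τ, h1, h2⟩ := h
        obtain ⟨f, f0, fm, fR⟩ := ih h1
        refine ⟨Function.update f (m+1) ρ, ?_, by simp, ?_⟩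
        · rw [Function.update_of_ne (by omega)]; exact f0
        · intro i hi
          rw [Function.update_of_ne (by omega)]
          rcases (Nat.lt_succ_iff.1 hi).eq_or_lt with rfl | h3
          · rw [Function.update_self, fm]; exact h2
          · rw [Function.update_of_ne (by omega)]; exact fR i h3
    obtain ⟨f, f0, fm, fR⟩ := this
    have e : ∀ i ≤ m, ((List.range (m+1)).map f).getD i x₀ = f i := by
      intro i hi
      rw [List.getD_eq_getElem?_getD, List.getElem?_map, List.getElem?_range (by omega)]
      rfl
    refine ⟨(List.range (m+1)).map f, ?_, ?_, ?_⟩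
    · rw [e 0 (by omega), f0]
    · rw [e m le_rfl, fm]
    · intro i hi
      rw [e i hi.le, e (i+1) hi]; exact fR i hi
  · rintro ⟨L, h0, hm, hR⟩
    induction m generalizing ρ with
    | zero => rw [← hm, h0]; rfl
    | succ m ih =>
      exact ⟨L.getD m x₀, ih rfl fun i hi => hR i (by omega), hm ▸ hR m (Nat.lt_succ_self m)⟩

theorem sig_Sr {α : Type} [Primcodable α] [DecidableEq α] {x₀ : α} {R : α → α → Prop} (hR : Sig A (fun q : α × α => R q.1 q.2)) :
    Sig A (fun q : ℕ × α => q.2 ∈ Sr x₀ R q.1) := by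
  have : Sig A (fun q : ℕ × α => ∃ L : List α, (L.getD 0 x₀ = x₀ ∧ L.getD q.1 x₀ = q.2) ∧
      ∀ i < q.1, R (L.getD i x₀) (L.getD (i+1) x₀)) := by
    refine Sig.ex (p := fun (q : ℕ × α) (L : List α) =>
      (L.getD 0 x₀ = x₀ ∧ L.getD q.1 x₀ = q.2) ∧
      ∀ i < q.1, R (L.getD i x₀) (L.getD (i+1) x₀)) (Sig.and (Sig.dec (by fun_prop)) ?_)
    refine Sig.ball (p := fun (z : (ℕ × α) × List α) i =>
      R (z.2.getD i x₀) (z.2.getD (i+1) x₀)) (n := fun z => z.1.1) ?_ (by fun_prop)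
    exact hR.comp (f := fun z : ((ℕ × α) × List α) × ℕ =>
      (z.1.2.getD z.2 x₀, z.1.2.getD (z.2+1) x₀)) (by fun_prop)
  refine this.of_eq fun q => ?_
  rw [mem_Sr]
  exact exists_congr fun L => and_assoc

theorem weight_iUnion_le {T : Set (List Bool)} {S : List Bool → Set (List Bool)} {r : ℝ≥0∞}
    (h : ∀ τ ∈ T, weight (S τ) ≤ r * 2⁻¹ ^ τ.length) :
    weight {ρ | ∃ τ ∈ T, ρ ∈ S τ} ≤ r * weight T := by
  have e : {ρ | ∃ τ ∈ T, ρ ∈ S τ} = ⋃ τ : T, S τ.1 := by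
    ext ρ; simp
  rw [e]
  unfold weight
  refine (ENNReal.tsum_iUnion_le_tsum (fun σ : List Bool => (2⁻¹ : ℝ≥0∞) ^ σ.length) _).trans ?_
  rw [← ENNReal.tsum_mul_left]
  exact ENNReal.tsum_le_tsum fun τ => h τ.1 τ.2

theorem part8 (hX : MLRandomIn A X)
    (hB : ∀ B : ℕ → Bool, Sig A (fun n => B n = true) → TuringLE B (joinSet A X)) :
    ∃ S : Set (List Bool), Sig A (fun σ => σ ∈ S) ∧ X ∉ openOf S ∧
      ∀ k, ∃ n, μCantor (cylinder (strPrefix X n) ∩ (openOf S)ᶜ) ≤ 2⁻¹ ^ k * 2⁻¹ ^ n := by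
  classical
  have hb : Sig A (fun n => ∃ s, bd n (strPrefix A s) s = true) :=
    Sig.ex (p := fun n s => bd n (strPrefix A s) s = true)
      (Sig.decA (h := fun σ (z : ℕ × ℕ) => bd z.1 σ z.2) (n := fun z => z.2) (by fun_prop) (by fun_prop))
  obtain ⟨e, he⟩ := hB (fun n => decide (∃ s, bd n (strPrefix A s) s = true))
    (hb.of_eq fun n => by simp)
  let nn : ℕ → List Bool → ℕ := fun k τ => Nat.pair e (Nat.pair k (Encodable.encode τ))
  have nn1 : ∀ k τ, (nn k τ).unpair.1 = e := by intro k τ; simp [nn]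
  have nn2 : ∀ k τ, dk (nn k τ) = k := by intro k τ; simp [nn, dk]
  have nn3 : ∀ k τ, dt (nn k τ) = τ := by intro k τ; simp [nn, dt]
  have key : ∀ k τ, (∃ s, gg (strPrefix A s) (strPrefix X s) (nn k τ) = true) ↔
      ¬ ∃ s, bd (nn k τ) (strPrefix A s) s = true := by
    intro k τ
    rw [gg_iff, nn1, he]
    by_cases h : ∃ s, bd (nn k τ) (strPrefix A s) s = true
    · simp [h, natOfBool]
    · simp [h, natOfBool]
  let S : Set (List Bool) := {ρ | ∃ z : ℕ × List Bool, qa (nn z.1 z.2) (strPrefix A ρ.length) ρ = true ∧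
    ∃ s, bd (nn z.1 z.2) (strPrefix A s) s = true}
  refine ⟨S, ?_, ?_, ?_⟩
  · refine Sig.ex (p := fun (ρ : List Bool) (z : ℕ × List Bool) =>
      qa (nn z.1 z.2) (strPrefix A ρ.length) ρ = true ∧ ∃ s, bd (nn z.1 z.2) (strPrefix A s) s = true)
      (Sig.and ?_ ?_)
    · exact Sig.decA (h := fun σ (z : List Bool × (ℕ × List Bool)) => qa (nn z.2.1 z.2.2) σ z.1)
        (n := fun z => z.1.length) (by simp only [nn]; fun_prop) (by fun_prop)
    · exact hb.comp (f := fun z : List Bool × (ℕ × List Bool) => nn z.2.1 z.2.2)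
        (by simp only [nn]; fun_prop)
  · rw [mem_openOf]
    rintro ⟨ℓ, ⟨k, τ⟩, h1, h2⟩
    simp only [qa, Bool.and_eq_true, sp_length] at h1
    exact (key k τ).1 ⟨ℓ, h1.2⟩ h2
  · intro k
    by_cases hk : ∃ n s, bd (nn k (strPrefix X n)) (strPrefix A s) s = true
    · obtain ⟨n, s, hs⟩ := hk
      have hls : (dt (nn k (strPrefix X n))).length ≤ s := by
        simp only [bd, Bool.and_eq_true, decide_eq_true_eq] at hs; exact hs.1
      have h1 := (bd_spec hls).1 hs
      rw [nn2, nn3, sp_length, pow_add] at h1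
      rw [nn3, sp_length] at hls
      refine ⟨n, le_trans (measure_mono ?_) h1⟩
      rintro Y ⟨hY1, hY2⟩
      refine ⟨hY1, ?_⟩
      rw [Set.mem_ofPred_eq]
      by_contra hc
      rw [Bool.not_eq_false] at hc
      apply hY2
      rw [mem_openOf]
      refine ⟨s, ⟨k, strPrefix X n⟩, ?_, s, hs⟩
      simp only [qa, Bool.and_eq_true, sp_length, hc, and_true, decide_eq_true_eq, nn3, sp_take]
      rw [min_eq_left hls]
      rw [mem_cyl, sp_length] at hY1
      exact hY1
    · exfalso
      push Not at hk
      let R : List Bool → List Bool → Prop := fun τ ρ =>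
        ρ ∈ minS {ρ | qok (nn k τ) (strPrefix A ρ.length) ρ = true}
      have hR : Sig A (fun q : List Bool × List Bool => R q.1 q.2) := by
        exact sig_minS (A := A) (α := List Bool) (g := fun τ σ ρ => qok (nn k τ) σ ρ)
          (by simp only [nn, qok]; fun_prop)
      have hw : ∀ m, weight (Sr [] R m) ≤ (1 - 2⁻¹ ^ k) ^ m := by
        intro m
        induction m with
        | zero => simp [Sr, weight]
        | succ m ih =>
          refine (weight_iUnion_le (T := Sr [] R m)
            (S := fun τ => minS {ρ | qok (nn k τ) (strPrefix A ρ.length) ρ = true})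
            (r := 1 - 2⁻¹ ^ k) ?_).trans ?_
          · intro τ _
            rw [weight_minS]
            have := mu_qok (A := A) (nn k τ)
            rwa [nn2, nn3] at this
          · rw [pow_succ, mul_comm]; gcongr
      have hXm : ∀ m, ∃ ℓ, strPrefix X ℓ ∈ Sr [] R m := by
        intro m
        induction m with
        | zero => exact ⟨0, rfl⟩
        | succ m ih =>
          obtain ⟨ℓ, hℓ⟩ := ih
          obtain ⟨s, hs⟩ := (key k (strPrefix X ℓ)).2 (by
            rintro ⟨s, hs⟩; exact hk ℓ s hs)
          have h1 : X ∈ openOf {ρ | qok (nn k (strPrefix X ℓ)) (strPrefix A ρ.length) ρ = true} := by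
            rw [mem_openOf]
            refine ⟨max ℓ s, ?_⟩
            simp only [Set.mem_ofPred_eq, qok, qa, Bool.and_eq_true, sp_length, nn3, decide_eq_true_eq,
              sp_take, Bool.not_eq_true']
            refine ⟨⟨?_, gg_mono (le_max_right _ _) hs⟩, ?_⟩
            · rw [min_eq_left (le_max_left _ _)]
            · exact Bool.eq_false_iff.2 (hk ℓ _)
          rw [← minS_open, mem_openOf] at h1
          obtain ⟨i, hi⟩ := h1
          exact ⟨i, _, hℓ, hi⟩
      have hr : (1 - 2⁻¹ ^ k : ℝ≥0∞) < 1 := ENNReal.sub_lt_self (by simp) (by simp) (by simp)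
      obtain ⟨c, hc⟩ : ∃ c : ℕ, (1 - 2⁻¹ ^ k : ℝ≥0∞) ^ c ≤ 2⁻¹ := by
        have := (ENNReal.tendsto_pow_atTop_nhds_zero_of_lt_one hr).eventually
          (gt_mem_nhds (show (0 : ℝ≥0∞) < 2⁻¹ by simp))
        obtain ⟨c, hc⟩ := this.exists
        exact ⟨c, hc.le⟩
      obtain ⟨n, hn⟩ := test_lemma (X := X) (R := fun n ρ => ρ ∈ Sr [] R (c * n))
        ((sig_Sr hR).comp (f := fun q : ℕ × List Bool => (c * q.1, q.2)) (by fun_prop)) (by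
          intro n
          refine (mu_openOf_le _).trans ((hw (c * n)).trans ?_)
          rw [pow_mul]
          gcongr) hX
      apply hn
      rw [mem_openOf]
      exact hXm _

end Dens

end

section
open MeasureTheory ENNReal

section Dir2

/-- uniform stage approximation of c.e. open sets -/
theorem famQ {α : Type} [Primcodable α] {S : α → Set (List Bool)}
    (hS : Sig emptyOracle (fun q : α × List Bool => q.2 ∈ S q.1)) :
    ∃ Q : α → ℕ → List Bool → Bool, Computable (fun q : α × ℕ × List Bool => Q q.1 q.2.1 q.2.2) ∧
      (∀ a t t' ρ ρ', t ≤ t' → ρ <+: ρ' → Q a t ρ = true → Q a t' ρ' = true) ∧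
      ∀ a, openOf (S a) = {Y | ∃ t, Q a t (strPrefix Y t) = true} := by
  obtain ⟨h, hc, hm, hp⟩ := sig_empty_iff.1 hS
  refine ⟨fun a t ρ => (List.range (ρ.length + 1)).any fun i => h (a, ρ.take i) t, by fun_prop, ?_, ?_⟩
  · intro a t t' ρ ρ' ht hr
    simp only [List.any_eq_true, List.mem_range, Nat.lt_succ_iff]
    rintro ⟨i, hi, h1⟩
    refine ⟨i, hi.trans hr.length_le, ?_⟩
    rw [take_of_prefix hr hi]
    exact hm _ _ _ ht h1
  · intro a
    ext Y
    simp only [mem_openOf, Set.mem_ofPred_eq, List.any_eq_true, List.mem_range, Nat.lt_succ_iff,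
      sp_length, sp_take]
    constructor
    · rintro ⟨n, hn⟩
      obtain ⟨t, ht⟩ := (hp (a, _)).1 hn
      refine ⟨max n t, n, le_max_left _ _, ?_⟩
      rw [min_eq_left (le_max_left _ _)]
      exact hm _ _ _ (le_max_right _ _) ht
    · rintro ⟨t, i, hi, h1⟩
      exact ⟨_, (hp (a, _)).2 ⟨t, h1⟩⟩

theorem mu_level_lt_iff (h : List Bool → Bool) (n m : ℕ) :
    μCantor {Y | h (strPrefix Y n) = true} < 2⁻¹ ^ m ↔ cnt h n * 2 ^ m < 2 ^ n := by
  rw [mu_level, ← ENNReal.inv_pow, ← ENNReal.inv_pow, ← div_eq_mul_inv,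
    ENNReal.div_lt_iff (by simp) (by simp), mul_comm ((2^m)⁻¹), ← div_eq_mul_inv,
    ENNReal.lt_div_iff_mul_lt (by simp) (by simp)]
  exact_mod_cast Iff.rfl

theorem sig_low {α : Type} [Primcodable α] {S : α → Set (List Bool)}
    (hS : Sig emptyOracle (fun q : α × List Bool => q.2 ∈ S q.1)) :
    Sig emptyOracle (fun x : α × ℕ × List Bool =>
      μCantor (cylinder x.2.2 ∩ (openOf (S x.1))ᶜ) < 2⁻¹ ^ x.2.1 * 2⁻¹ ^ x.2.2.length) := by
  obtain ⟨Q, Qc, Qm, Qe⟩ := famQ hS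
  have : Sig emptyOracle (fun x : α × ℕ × List Bool => ∃ t : ℕ, x.2.2.length ≤ t ∧
      cnt (fun σ => !(Q x.1 t σ) && decide (σ.take x.2.2.length = x.2.2)) t *
        2 ^ (x.2.1 + x.2.2.length) < 2 ^ t) :=
    Sig.ex (p := fun (x : α × ℕ × List Bool) (t : ℕ) => x.2.2.length ≤ t ∧
      cnt (fun σ => !(Q x.1 t σ) && decide (σ.take x.2.2.length = x.2.2)) t *
        2 ^ (x.2.1 + x.2.2.length) < 2 ^ t) (Sig.dec (by fun_prop))
  refine this.of_eq ?_
  rintro ⟨a, c, τ⟩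
  simp only
  have hanti : Antitone fun t => cylinder τ ∩ {Z | Q a t (strPrefix Z t) = false} := by
    intro t t' htt
    refine Set.inter_subset_inter_right _ fun Z hZ => ?_
    simp only [Set.mem_ofPred_eq] at *
    by_contra hc
    rw [Bool.not_eq_false] at hc
    rw [Qm _ _ _ _ _ htt (sp_mono Z htt) hc] at hZ; cases hZ
  have heq : cylinder τ ∩ (openOf (S a))ᶜ = ⋂ t, cylinder τ ∩ {Z | Q a t (strPrefix Z t) = false} := by
    rw [← Set.inter_iInter]
    congr 1
    rw [Qe]
    ext Z
    simp
  have hset : ∀ t, τ.length ≤ t → {Z | (!(Q a t (strPrefix Z t)) &&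
      decide ((strPrefix Z t).take τ.length = τ)) = true} =
      cylinder τ ∩ {Z | Q a t (strPrefix Z t) = false} := by
    intro t ht
    ext Z
    simp only [Set.mem_ofPred_eq, Bool.and_eq_true, Bool.not_eq_true', decide_eq_true_eq, sp_take,
      Set.mem_inter_iff, mem_cyl]
    rw [min_eq_left ht, and_comm]
  rw [heq, hanti.measure_iInter (fun t => ((measurableSet_cyl _).inter
      (measurableSet_sp (fun σ => Q a t σ = false) t)).nullMeasurableSet) ⟨0, measure_ne_top _ _⟩,
      iInf_lt_iff, ← pow_add]
  constructor
  · rintro ⟨t, h1, h2⟩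
    refine ⟨t, ?_⟩
    rw [← hset t h1]
    exact (mu_level_lt_iff (fun σ => !(Q a t σ) && decide (σ.take τ.length = τ)) _ _).2 h2
  · rintro ⟨t, h1⟩
    refine ⟨max t τ.length, le_max_right _ _, ?_⟩
    rw [← mu_level_lt_iff, hset _ (le_max_right _ _)]
    exact (measure_mono (hanti (le_max_left t τ.length))).trans_lt h1

/-! refinement -/
def refS (S : Set (List Bool)) (τ : List Bool) (c : ℕ) : Set (List Bool) :=
  {σ | σ ∈ S ∨ (τ <+: σ ∧ μCantor (cylinder σ ∩ (openOf S)ᶜ) < 2⁻¹ ^ c * 2⁻¹ ^ σ.length)}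

theorem openOf_mono {S T : Set (List Bool)} (h : S ⊆ T) : openOf S ⊆ openOf T := by
  intro Y hY
  rw [mem_openOf] at *
  obtain ⟨n, hn⟩ := hY
  exact ⟨n, h hn⟩

theorem sub_refS (S : Set (List Bool)) (τ : List Bool) (c : ℕ) : S ⊆ refS S τ c := fun _ h => Or.inl h

theorem ref_mu (S : Set (List Bool)) (τ : List Bool) (c : ℕ) :
    μCantor (cylinder τ ∩ (openOf S)ᶜ) ≤
      μCantor (cylinder τ ∩ (openOf (refS S τ c))ᶜ) + 2⁻¹ ^ c * 2⁻¹ ^ τ.length := by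
  let T : Set (List Bool) :=
    {σ | τ <+: σ ∧ μCantor (cylinder σ ∩ (openOf S)ᶜ) < 2⁻¹ ^ c * 2⁻¹ ^ σ.length}
  have h1 : cylinder τ ∩ (openOf S)ᶜ ⊆ (cylinder τ ∩ (openOf (refS S τ c))ᶜ) ∪
      (openOf T ∩ (openOf S)ᶜ) := by
    rintro Y ⟨hY, hY'⟩
    by_cases h : Y ∈ openOf T
    · exact Or.inr ⟨h, hY'⟩
    · refine Or.inl ⟨hY, fun hc => ?_⟩
      rw [mem_openOf] at hc
      obtain ⟨n, hn | hn⟩ := hc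
      · exact hY' (mem_openOf.2 ⟨n, hn⟩)
      · exact h (mem_openOf.2 ⟨n, hn⟩)
  refine (measure_mono h1).trans ((measure_union_le _ _).trans ?_)
  gcongr
  refine (mu_inter_weight (T := T) (fun σ hσ => hσ.2.le)).trans ?_
  gcongr
  rw [← mu_cyl]
  refine measure_mono fun Y hY => ?_
  rw [mem_openOf'] at hY
  obtain ⟨σ, hσ, hY⟩ := hY
  rw [mem_cyl, ← sp_length Y τ.length]
  have h2 : strPrefix Y σ.length = σ := isPrefixOf_iff.1 hY
  have h3 := hσ.1
  rw [← h2] at h3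
  rw [sp_length]
  exact (prefix_sp h3).symm

theorem ref_dens {S : Set (List Bool)} {τ : List Bool} {c : ℕ} {Y : ℕ → Bool}
    (hY : Y ∉ openOf (refS S τ c)) (hτ : Y ∈ cylinder τ) {ℓ : ℕ} (hℓ : τ.length ≤ ℓ) :
    ¬ μCantor (cylinder (strPrefix Y ℓ) ∩ (openOf S)ᶜ) < 2⁻¹ ^ c * 2⁻¹ ^ ℓ := by
  intro h
  apply hY
  rw [mem_openOf]
  refine ⟨ℓ, Or.inr ⟨?_, by rwa [sp_length]⟩⟩
  have := mem_cyl.1 hτ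
  rw [← this]
  exact sp_mono Y hℓ

/-! independence -/
theorem mu_bit (h : List Bool → Bool) (m : ℕ) :
    μCantor {Y | h (strPrefix Y m) = true ∧ Y m = false} =
      μCantor {Y | h (strPrefix Y m) = true} * 2⁻¹ := by
  have h1 : {Y | h (strPrefix Y m) = true ∧ Y m = false} =
      {Y | (h ((strPrefix Y (m+1)).take m) && !((strPrefix Y (m+1)).getD m true)) = true} := by
    ext Y
    simp only [Set.mem_ofPred_eq, Bool.and_eq_true, Bool.not_eq_true', sp_take,
      List.getD_eq_getElem?_getD, sp_getElem? Y (m+1) m (by omega)]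
    simp
  rw [h1, mu_level (fun σ => h (σ.take m) && !(σ.getD m true)), mu_level]
  have : cnt (fun σ => h (σ.take m) && !(σ.getD m true)) (m+1) = cnt h m := by
    rw [cnt, cnt, strs]
    have key : ∀ l : List (List Bool), (∀ σ ∈ l, σ.length = m) →
        (l.flatMap fun σ => [σ ++ [false], σ ++ [true]]).countP
          (fun σ => h (σ.take m) && !(σ.getD m true)) = l.countP h := by
      intro l
      induction l with
      | nil => simp
      | cons a l ih =>
        intro hl
        have ha : a.length = m := hl a (by simp)
        rw [List.flatMap_cons, List.countP_append, ih fun σ hσ => hl σ (by simp [hσ]),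
          List.countP_cons, add_comm]
        subst ha
        simp [List.countP_cons]
    exact key _ fun σ hσ => mem_strs.1 hσ
  rw [this, pow_succ, mul_assoc]

/-- zeros on an interval -/
def zer (m len : ℕ) : Set (ℕ → Bool) := {Y | ∀ i < len, Y (m + i) = false}

theorem mu_block (h : List Bool → Bool) (m len : ℕ) :
    μCantor ({Y | h (strPrefix Y m) = true} ∩ zer m len) =
      μCantor {Y | h (strPrefix Y m) = true} * 2⁻¹ ^ len := by
  induction len with
  | zero => simp [zer]
  | succ len ih =>
    have h1 : ∀ l, {Y | h (strPrefix Y m) = true} ∩ zer m l =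
        {Y | (h ((strPrefix Y (m+l)).take m) &&
          (List.range l).all fun i => !((strPrefix Y (m+l)).getD (m+i) true)) = true} := by
      intro l
      ext Y
      simp only [Set.mem_ofPred_eq, Bool.and_eq_true, Bool.not_eq_true', sp_take, Set.mem_inter_iff,
        zer, List.all_eq_true, List.mem_range, List.getD_eq_getElem?_getD]
      rw [min_eq_left (by omega)]
      refine and_congr_right fun _ => forall₂_congr fun i hi => ?_
      rw [sp_getElem? Y (m+l) (m+i) (by omega)]; simp
    have h2 : {Y | h (strPrefix Y m) = true} ∩ zer m (len+1) =
        {Y | (fun σ : List Bool => (h (σ.take m) &&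
          (List.range len).all fun i => !(σ.getD (m+i) true))) (strPrefix Y (m+len)) = true
          ∧ Y (m + len) = false} := by
      ext Y
      have := Set.ext_iff.1 (h1 len) Y
      rw [Set.mem_ofPred_eq] at this
      simp only [Set.mem_ofPred_eq]
      rw [← this]
      simp only [zer, Set.mem_inter_iff, Set.mem_ofPred_eq, and_assoc]
      refine and_congr_right fun _ => ?_
      constructor
      · intro H; exact ⟨fun i hi => H i (by omega), H len (by omega)⟩
      · rintro ⟨H1, H2⟩ i hi
        rcases Nat.lt_succ_iff_lt_or_eq.1 hi with h | h
        · exact H1 i h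
        · rw [h]; exact H2
    rw [h2, mu_bit (fun σ : List Bool => (h (σ.take m) &&
          (List.range len).all fun i => !(σ.getD (m+i) true))) (m+len), ← h1, ih, pow_succ, mul_assoc]

def bb (j y : ℕ) : ℕ := ((List.range y).map fun z => z.unpair.1 + j).sum

theorem bb_succ (j y : ℕ) : bb j (y+1) = bb j y + (y.unpair.1 + j) := by
  simp [bb, List.range_succ]
theorem bb_mono (j : ℕ) : Monotone (bb j) := monotone_nat_of_le_succ fun y => by
  rw [bb_succ]; omega

/-- the event `E_y` -/
def Ev (j o y : ℕ) : Set (ℕ → Bool) := zer (o + bb j y) (y.unpair.1 + j)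

theorem mem_Ev_congr {j o y m : ℕ} {Y Z : ℕ → Bool} (h : strPrefix Y m = strPrefix Z m)
    (hm : o + bb j (y+1) ≤ m) : Y ∈ Ev j o y ↔ Z ∈ Ev j o y := by
  rw [sp_congr] at h
  rw [bb_succ] at hm
  simp only [Ev, zer, Set.mem_ofPred_eq]
  refine forall₂_congr fun i hi => ?_
  rw [h _ (by omega)]

/-- level sets: membership depends on the first m bits -/
theorem level_eq {C : Set (ℕ → Bool)} {m : ℕ}
    (hC : ∀ Y Z, strPrefix Y m = strPrefix Z m → (Y ∈ C ↔ Z ∈ C)) :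
    ∃ h : List Bool → Bool, C = {Y | h (strPrefix Y m) = true} := by
  classical
  refine ⟨fun σ => decide ((fun n => σ.getD n false) ∈ C), ?_⟩
  ext Y
  simp only [Set.mem_ofPred_eq, decide_eq_true_eq]
  apply hC
  rw [sp_congr]
  intro i hi
  rw [List.getD_eq_getElem?_getD, sp_getElem? Y m i hi]; rfl

theorem mu_Ev {C : Set (ℕ → Bool)} {j o y : ℕ}
    (hC : ∀ Y Z, strPrefix Y (o + bb j y) = strPrefix Z (o + bb j y) → (Y ∈ C ↔ Z ∈ C)) :
    μCantor (C ∩ Ev j o y) = μCantor C * 2⁻¹ ^ (y.unpair.1 + j) := by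
  obtain ⟨h, rfl⟩ := level_eq hC
  exact mu_block h _ _

theorem meas_level {C : Set (ℕ → Bool)} {m : ℕ}
    (hC : ∀ Y Z, strPrefix Y m = strPrefix Z m → (Y ∈ C ↔ Z ∈ C)) : MeasurableSet C := by
  obtain ⟨h, rfl⟩ := level_eq hC
  exact measurableSet_sp (fun σ => h σ = true) m

theorem isClosed_level {C : Set (ℕ → Bool)} {m : ℕ}
    (hC : ∀ Y Z, strPrefix Y m = strPrefix Z m → (Y ∈ C ↔ Z ∈ C)) : IsClosed C := by
  obtain ⟨h, rfl⟩ := level_eq hC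
  have : {Y | h (strPrefix Y m) = true} = ⋃ σ ∈ ((strs m).filter h).toFinset, cylinder σ := by
    ext Y
    simp only [Set.mem_ofPred_eq, List.mem_toFinset, List.mem_filter, mem_strs, Set.mem_iUnion,
      mem_cyl, exists_prop]
    constructor
    · intro hh; exact ⟨_, ⟨sp_length _ _, hh⟩, by rw [sp_length]⟩
    · rintro ⟨σ, ⟨h1, h2⟩, h3⟩; rw [← h1, h3]; exact h2
  rw [this]
  refine Set.Finite.isClosed_biUnion (Finset.finite_toSet _) fun σ _ => ?_
  have : cylinder σ = ⋂ i : Fin σ.length, {X | X i = σ.get i} := by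
    ext X; simp [_root_.cylinder, IsPrefixOf]
  rw [this]
  exact isClosed_iInter fun i => isClosed_eq (continuous_apply _) continuous_const

theorem prod_bound (D : Set ℕ) (j o n : ℕ) :
    μCantor {Y | ∀ y ∈ D, y < n → Y ∉ Ev j o y} *
      (1 + ∑ y ∈ Finset.range n, D.indicator (fun y => 2⁻¹ ^ (y.unpair.1 + j)) y) ≤ 1 := by
  induction n with
  | zero => simp [prob_le_one]
  | succ n ih =>
    set H := {Y | ∀ y ∈ D, y < n → Y ∉ Ev j o y} with hH
    by_cases hn : n ∈ D
    · have e : {Y | ∀ y ∈ D, y < n + 1 → Y ∉ Ev j o y} = H \ (H ∩ Ev j o n) := by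
        ext Y
        simp only [Set.mem_ofPred_eq, hH, Set.mem_sdiff, Set.mem_inter_iff, not_and]
        constructor
        · intro h; exact ⟨fun y hy h1 => h y hy (by omega), fun _ => h n hn (by omega)⟩
        · rintro ⟨h1, h2⟩ y hy hyn
          rcases Nat.lt_succ_iff_lt_or_eq.1 hyn with h | h
          · exact h1 y hy h
          · rw [h]; exact h2 h1
      have hlev : ∀ Y Z, strPrefix Y (o + bb j n) = strPrefix Z (o + bb j n) → (Y ∈ H ↔ Z ∈ H) := by
        intro Y Z h
        simp only [hH, Set.mem_ofPred_eq]
        refine forall₃_congr fun y _ hy => not_congr ?_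
        refine mem_Ev_congr h ?_
        have := bb_mono j (show y + 1 ≤ n from hy)
        omega
      have hlev2 : ∀ Y Z, strPrefix Y (o + bb j (n+1)) = strPrefix Z (o + bb j (n+1)) →
          (Y ∈ H ∩ Ev j o n ↔ Z ∈ H ∩ Ev j o n) := by
        intro Y Z h
        have h1 := hlev Y Z (sp_eq_of_le h (by have := bb_mono j (show n ≤ n+1 by omega); omega))
        have h2 := mem_Ev_congr (j := j) (o := o) (y := n) h le_rfl
        simp only [Set.mem_inter_iff, h1, h2]
      rw [e, measure_sdiff Set.inter_subset_left (meas_level hlev2).nullMeasurableSet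
        (measure_ne_top _ _), mu_Ev hlev, Finset.sum_range_succ, Set.indicator_of_mem hn]
      refine le_trans ?_ ih
      set S := ∑ y ∈ Finset.range n, D.indicator (fun y => (2⁻¹ : ℝ≥0∞) ^ (y.unpair.1 + j)) y
      set p : ℝ≥0∞ := 2⁻¹ ^ (n.unpair.1 + j)
      have hp : p ≤ 1 := pow_le_one' (by simp) _
      have hp1 : p ≠ ⊤ := ne_top_of_le_ne_top (by simp) hp
      have hμ : μCantor H - μCantor H * p = μCantor H * (1 - p) := by
        rw [ENNReal.mul_sub (fun _ _ => measure_ne_top _ _), mul_one]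
      rw [hμ, mul_assoc]
      gcongr
      rw [← add_assoc, mul_add, ENNReal.sub_mul (fun _ _ => by
        simp only [ne_eq, ENNReal.add_eq_top, ENNReal.one_ne_top, false_or, S]
        rw [ENNReal.sum_eq_top]
        push Not
        intro y _
        refine ne_top_of_le_ne_top (b := 1) (by simp) ?_
        refine Set.indicator_apply_le' (fun _ => pow_le_one' (by simp) _) fun _ => by simp), one_mul]
      calc 1 + S - p * (1 + S) + (1 - p) * p ≤ 1 + S - p * (1+S) + p * (1 + S) := by
            rw [mul_comm (1 - p) p]
            exact add_le_add_right (mul_le_mul_right (tsub_le_self.trans le_self_add) _) _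
        _ = 1 + S := by
            apply tsub_add_cancel_of_le
            exact mul_le_of_le_one_left' hp
    · have e : {Y | ∀ y ∈ D, y < n + 1 → Y ∉ Ev j o y} = H := by
        ext Y
        simp only [Set.mem_ofPred_eq, hH]
        refine forall₂_congr fun y hy => ?_
        have : y ≠ n := fun h => hn (h ▸ hy)
        constructor
        · intro h h1; exact h (by omega)
        · intro h h1; exact h (by omega)
      rw [e, Finset.sum_range_succ, Set.indicator_of_notMem hn, add_zero]
      exact ih

/-- The avoidance lemma: pairs whose event misses a positive-measure Pi01 class lie in a
bounded c.e. set. -/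
theorem avoid {S : Set (List Bool)} (hS : Sig emptyOracle (fun σ => σ ∈ S))
    (hpos : μCantor (openOf S)ᶜ ≠ 0) (j o : ℕ) :
    ∃ V : Set (ℕ × ℕ), Sig emptyOracle (fun x => x ∈ V) ∧ wt V < ⊤ ∧
      ∀ y : ℕ, y.unpair ∉ V → ((openOf S)ᶜ ∩ Ev j o y).Nonempty := by
  obtain ⟨Q, Qc, Qm, Qe⟩ := famQ (α := Unit) (S := fun _ => S)
    (hS.comp (f := fun q : Unit × List Bool => q.2) (by fun_prop))
  let q : List Bool → Bool := fun ρ => Q () ρ.length ρ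
  have qc : Computable q := by simp only [q]; fun_prop
  have qe : openOf S = {Y | ∃ t, q (strPrefix Y t) = true} := by
    rw [Qe ()]; simp [q]
  have qm : ∀ ρ ρ', ρ <+: ρ' → q ρ = true → q ρ' = true := fun ρ ρ' h => Qm _ _ _ _ _ h.length_le h
  let G : ℕ → ℕ → Bool := fun y t => (strs (o + bb j (y+1) + t)).all fun σ =>
    q σ || (List.range (y.unpair.1 + j)).any fun i => σ.getD (o + bb j y + i) false
  have Gc : Computable (fun z : ℕ × ℕ => G z.1 z.2) := by simp only [G, bb]; fun_prop
  have hG : ∀ y t, G y t = true ↔ ∀ Y ∈ Ev j o y, q (strPrefix Y (o + bb j (y+1) + t)) = true := by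
    intro y t
    simp only [G, List.all_eq_true, mem_strs, Bool.or_eq_true, List.any_eq_true, List.mem_range]
    constructor
    · intro h Y hY
      refine (h _ (sp_length _ _)).resolve_right ?_
      rintro ⟨i, hi, h1⟩
      have := bb_succ j y
      rw [List.getD_eq_getElem?_getD, sp_getElem? Y _ _ (by omega)] at h1
      rw [Option.getD_some, hY i hi] at h1; cases h1
    · intro h σ hσ
      by_cases hc : ∃ x < y.unpair.1 + j, σ.getD (o + bb j y + x) false = true
      · exact Or.inr hc
      · left
        have := h (fun n => σ.getD n false) (fun i hi => by
          by_contra hcc; exact hc ⟨i, hi, by simpa using hcc⟩)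
        rw [← hσ] at this
        convert this
        apply List.ext_getElem (by simp [sp_length])
        intro n h1 h2
        rw [sp_getElem, List.getD_eq_getElem _ _ h1]
  have hD : ∀ y, (∃ t, G y t = true) ↔ (openOf S)ᶜ ∩ Ev j o y = ∅ := by
    intro y
    constructor
    · rintro ⟨t, ht⟩
      rw [hG] at ht
      rw [Set.eq_empty_iff_forall_notMem]
      rintro Y ⟨h1, h2⟩
      exact h1 (by rw [qe]; exact ⟨_, ht Y h2⟩)
    · intro he
      by_contra hcon
      push Not at hcon
      have hne : ∀ t, ({Y | q (strPrefix Y (o + bb j (y+1) + t)) = false} ∩ Ev j o y).Nonempty := by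
        intro t
        have := hcon t
        rw [ne_eq, hG] at this
        push Not at this
        obtain ⟨Y, h1, h2⟩ := this
        exact ⟨Y, by simpa using h2, h1⟩
      have hcl : ∀ t, IsClosed ({Y | q (strPrefix Y (o + bb j (y+1) + t)) = false} ∩ Ev j o y) := by
        intro t
        apply isClosed_level (m := o + bb j (y+1) + t)
        intro Y Z h
        have := mem_Ev_congr (j := j) (o := o) (y := y) h (by omega)
        simp only [Set.mem_inter_iff, Set.mem_ofPred_eq, h, this]
      have := IsCompact.nonempty_iInter_of_sequence_nonempty_isCompact_isClosed _
        (fun t => ?_) hne (hcl 0).isCompact hcl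
      · obtain ⟨Y, hY⟩ := this
        rw [Set.mem_iInter] at hY
        have : Y ∈ (openOf S)ᶜ ∩ Ev j o y := by
          refine ⟨?_, (hY 0).2⟩
          rw [qe]
          rintro ⟨t, ht⟩
          have := (hY t).1
          rw [Set.mem_ofPred_eq, qm _ _ (sp_mono Y (by omega)) ht] at this; cases this
        rw [he] at this; exact this
      · refine Set.inter_subset_inter_left _ fun Y hY => ?_
        simp only [Set.mem_ofPred_eq] at *
        by_contra hc
        rw [Bool.not_eq_false] at hc
        rw [qm _ _ (sp_mono Y (by omega)) hc] at hY; cases hY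
  refine ⟨{x | ∃ t, G (Nat.pair x.1 x.2) t = true}, ?_, ?_, ?_⟩
  · exact Sig.ex (p := fun (x : ℕ × ℕ) t => G (Nat.pair x.1 x.2) t = true) (Sig.dec (by fun_prop))
  · let D : Set ℕ := {y | ∃ t, G y t = true}
    have hb : ∀ n, ∑ y ∈ Finset.range n, D.indicator (fun y => (2⁻¹ : ℝ≥0∞) ^ (y.unpair.1 + j)) y ≤
        (μCantor (openOf S)ᶜ)⁻¹ := by
      intro n
      have h1 := prod_bound D j o n
      have h2 : μCantor (openOf S)ᶜ ≤ μCantor {Y | ∀ y ∈ D, y < n → Y ∉ Ev j o y} := by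
        refine measure_mono fun Y hY y hy _ hc => ?_
        have := (hD y).1 hy
        exact (Set.eq_empty_iff_forall_notMem.1 this Y) ⟨hY, hc⟩
      rw [ENNReal.le_inv_iff_mul_le]
      refine le_trans ?_ h1
      rw [mul_comm]
      gcongr
      exact le_add_self
    have hsum : ∑' y : ℕ, D.indicator (fun y => (2⁻¹ : ℝ≥0∞) ^ (y.unpair.1 + j)) y < ⊤ := by
      refine lt_of_le_of_lt (b := (μCantor (openOf S)ᶜ)⁻¹) ?_ (by
        rw [ENNReal.inv_lt_top]; exact pos_iff_ne_zero.2 hpos)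
      rw [ENNReal.tsum_eq_iSup_nat]
      exact iSup_le hb
    have hle : wt {x : ℕ × ℕ | ∃ t, G (Nat.pair x.1 x.2) t = true} ≤
        2 ^ j * ∑' y : ℕ, D.indicator (fun y => (2⁻¹ : ℝ≥0∞) ^ (y.unpair.1 + j)) y := by
      rw [← ENNReal.tsum_mul_left, wt]
      have inj : Function.Injective (fun x : {x : ℕ × ℕ | ∃ t, G (Nat.pair x.1 x.2) t = true} =>
          Nat.pair x.1.1 x.1.2) := by
        intro x y h
        have := Nat.pair_eq_pair.1 h
        exact Subtype.ext (Prod.ext this.1 this.2)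
      refine le_trans (le_of_eq ?_) (ENNReal.tsum_comp_le_tsum_of_injective inj _)
      refine tsum_congr fun x => ?_
      have hx : Nat.pair x.1.1 x.1.2 ∈ D := x.2
      simp only [Set.indicator_of_mem hx, Nat.unpair_pair]
      rw [pow_add, mul_comm ((2⁻¹ : ℝ≥0∞) ^ x.1.1), ← mul_assoc, ← mul_pow,
        ENNReal.mul_inv_cancel (by simp) (by simp), one_pow, one_mul]
    exact hle.trans_lt (ENNReal.mul_lt_top (by simp) hsum)
  · intro y hy
    rw [Set.nonempty_iff_ne_empty]
    intro hc
    apply hy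
    obtain ⟨t, ht⟩ := (hD y).2 hc
    refine ⟨t, ?_⟩
    rw [Nat.pair_unpair]; exact ht

end Dir2

end

section
open MeasureTheory ENNReal

section Dir2b
variable {A : ℕ → Bool}

theorem half_add (c : ℕ) : (2⁻¹ : ℝ≥0∞) ^ (c+1) + 2⁻¹ ^ (c+1) = 2⁻¹ ^ c := by
  rw [pow_succ, ← mul_add, ENNReal.inv_two_add_inv_two, mul_one]

theorem half_ne_top (c : ℕ) : (2⁻¹ : ℝ≥0∞) ^ c ≠ ⊤ := by simp

theorem halfpow_pos (c : ℕ) : 0 < (2⁻¹ : ℝ≥0∞) ^ c := by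
  rw [pos_iff_ne_zero]; simp

def hitB (f : List Bool → ℕ × ℕ → Bool) (α ρ : List Bool) (j o s : ℕ) : Bool :=
  (List.range s).any fun y => f (α.take s) y.unpair &&
    (List.range (y.unpair.1 + j)).all fun i => !(ρ.getD (o + bb j y + i) true)

def firB (f : List Bool → ℕ × ℕ → Bool) (α ρ : List Bool) (j o s : ℕ) : Bool :=
  hitB f α ρ j o s && (List.range s).all fun s' => !(hitB f α ρ j o s')

def Hit (f : List Bool → ℕ × ℕ → Bool) (A Y : ℕ → Bool) (j o s : ℕ) : Prop :=
  ∃ y < s, f (strPrefix A s) y.unpair = true ∧ Y ∈ Ev j o y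

theorem hit_iff (f : List Bool → ℕ × ℕ → Bool) (Y : ℕ → Bool) (j o : ℕ) {s s' : ℕ} (h : s' ≤ s) :
    hitB f (strPrefix A s) (strPrefix Y (o + bb j s)) j o s' = true ↔ Hit f A Y j o s' := by
  simp only [hitB, List.any_eq_true, List.mem_range, Bool.and_eq_true, List.all_eq_true,
    Bool.not_eq_true', sp_take, Hit, Ev, zer, Set.mem_ofPred_eq, min_eq_left h]
  refine exists_congr fun y => and_congr_right fun hy => and_congr_right fun _ =>
    forall₂_congr fun i hi => ?_
  have h1 := bb_mono j (show y + 1 ≤ s by omega)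
  have h2 := bb_succ j y
  rw [List.getD_eq_getElem?_getD, sp_getElem? Y _ _ (by omega)]
  simp

theorem fir_iff (f : List Bool → ℕ × ℕ → Bool) (Y : ℕ → Bool) (j o s : ℕ) :
    firB f (strPrefix A s) (strPrefix Y (o + bb j s)) j o s = true ↔
      Hit f A Y j o s ∧ ∀ s' < s, ¬ Hit f A Y j o s' := by
  simp only [firB, Bool.and_eq_true, List.all_eq_true, List.mem_range, Bool.not_eq_true']
  rw [hit_iff f Y j o le_rfl]
  refine and_congr_right fun _ => forall₂_congr fun s' hs => ?_
  rw [← hit_iff f Y j o hs.le]; simp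

theorem sig_refS {S : Set (List Bool)} (hS : Sig emptyOracle (fun σ => σ ∈ S)) (τ : List Bool) (c : ℕ) :
    Sig emptyOracle (fun σ => σ ∈ refS S τ c) := by
  have h1 := sig_low (α := Unit) (S := fun _ => S)
    (hS.comp (f := fun q : Unit × List Bool => q.2) (by fun_prop))
  have h2 := h1.comp (f := fun σ : List Bool => ((), c, σ)) (by fun_prop)
  have h3 : Sig emptyOracle (fun σ : List Bool => σ.take τ.length = τ) := Sig.dec (by fun_prop)
  refine (hS.or (h3.and h2)).of_eq fun σ => ?_
  simp only [refS, Set.mem_ofPred_eq]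
  rw [List.prefix_iff_eq_take, eq_comm]

theorem step_ex {f : List Bool → ℕ × ℕ → Bool}
    (fm : ∀ σ τ a, σ <+: τ → f σ a = true → f τ a = true) {K : ℕ}
    (hw : wt {x | ∃ ℓ, f (strPrefix A ℓ) x = true} ≤ 2 ^ K)
    (hV : ∀ V : Set (ℕ × ℕ), Sig emptyOracle (fun x => x ∈ V) → wt V < ⊤ →
      ¬ {x | ∃ ℓ, f (strPrefix A ℓ) x = true} ⊆ V)
    {S : Set (List Bool)} (hS : Sig emptyOracle (fun σ => σ ∈ S)) (τ : List Bool) (c N : ℕ)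
    (hd : ¬ μCantor (cylinder τ ∩ (openOf S)ᶜ) < 2⁻¹ ^ (c+2) * 2⁻¹ ^ τ.length) :
    ∃ s Y, N ≤ s ∧ Y ∈ cylinder τ ∧ Hit f A Y (K+c+5) τ.length s ∧
      (∀ s' < s, ¬ Hit f A Y (K+c+5) τ.length s') ∧
      ¬ μCantor (cylinder (strPrefix Y (τ.length + bb (K+c+5) s)) ∩ (openOf (refS S τ (c+3)))ᶜ) <
        2⁻¹ ^ (c+4) * 2⁻¹ ^ (τ.length + bb (K+c+5) s) := by
  classical
  set j := K + c + 5 with hj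
  set o := τ.length with ho
  set S3 := refS S τ (c+3) with hS3
  set S4 := refS S3 τ (c+4) with hS4
  have s3 : Sig emptyOracle (fun σ => σ ∈ S3) := sig_refS hS _ _
  have s4 : Sig emptyOracle (fun σ => σ ∈ S4) := sig_refS s3 _ _
  set t : ℝ≥0∞ := 2⁻¹ ^ o with ht
  have ht0 : t ≠ ⊤ := half_ne_top o
  have ht1 : t ≠ 0 := (halfpow_pos o).ne'
  have cancel : ∀ (a : ℕ) (m : ℝ≥0∞), 2⁻¹ ^ a * t ≤ m + 2⁻¹ ^ (a+1) * t → 2⁻¹ ^ (a+1) * t ≤ m := by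
    intro a m h
    rw [← half_add a, add_mul] at h
    exact (ENNReal.add_le_add_iff_right (ENNReal.mul_ne_top (half_ne_top _) ht0)).1 h
  have d3 := cancel (c+2) _ ((not_lt.1 hd).trans (ref_mu S τ (c+3)))
  have d4 := cancel (c+3) _ (d3.trans (ref_mu S3 τ (c+4)))
  let D : List ℕ := (List.range N).filter fun y => f (strPrefix A N) y.unpair
  have hD : ∀ y, y ∈ D ↔ y < N ∧ f (strPrefix A N) y.unpair = true := by simp [D]
  let T : List Bool → Bool := fun σ => D.any fun y => decide (σ.length = o + bb j (y+1)) &&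
    (List.range (y.unpair.1 + j)).all fun i => !(σ.getD (o + bb j y + i) true)
  have Tc : Computable T := by simp only [T, bb]; fun_prop
  have hT : openOf {σ | T σ = true} = ⋃ y ∈ D.toFinset, Ev j o y := by
    ext Y
    simp only [mem_openOf, Set.mem_ofPred_eq, T, List.any_eq_true, Bool.and_eq_true,
      decide_eq_true_eq, sp_length, List.all_eq_true, List.mem_range, Bool.not_eq_true',
      Set.mem_iUnion, List.mem_toFinset, exists_prop]
    have key : ∀ y, (∀ i < y.unpair.1 + j, (strPrefix Y (o + bb j (y+1))).getD (o + bb j y + i) true = false) ↔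
        Y ∈ Ev j o y := by
      intro y
      simp only [Ev, zer, Set.mem_ofPred_eq]
      refine forall₂_congr fun i hi => ?_
      have := bb_succ j y
      rw [List.getD_eq_getElem?_getD, sp_getElem? Y _ _ (by omega)]; simp
    constructor
    · rintro ⟨n, y, h1, h2, h3⟩
      subst h2
      exact ⟨y, h1, (key y).1 h3⟩
    · rintro ⟨y, h1, h2⟩
      exact ⟨_, y, h1, rfl, (key y).2 h2⟩
  let S5 : Set (List Bool) := {σ | σ ∈ S4 ∨ ((σ.length = o ∧ σ ≠ τ) ∨ T σ = true)}
  have s5 : Sig emptyOracle (fun σ => σ ∈ S5) := s4.or (Sig.dec (by fun_prop))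
  have h5 : (openOf S5)ᶜ = (cylinder τ ∩ (openOf S4)ᶜ) \ ⋃ y ∈ D.toFinset, Ev j o y := by
    rw [← hT]
    ext Y
    simp only [Set.mem_compl_iff, Set.mem_sdiff, Set.mem_inter_iff, mem_openOf, mem_cyl, S5,
      Set.mem_ofPred_eq, sp_length]
    constructor
    · intro h
      push Not at h
      refine ⟨⟨(h o).2.1 rfl, fun ⟨n, hn⟩ => (h n).1 hn⟩, fun ⟨n, hn⟩ => (h n).2.2 hn⟩
    · rintro ⟨⟨h1, h2⟩, h3⟩ ⟨n, hn | ⟨rfl, hn⟩ | hn⟩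
      · exact h2 ⟨n, hn⟩
      · exact hn h1
      · exact h3 ⟨n, hn⟩
  have hsum : ∑ y ∈ D.toFinset, (2⁻¹ : ℝ≥0∞) ^ y.unpair.1 ≤ 2 ^ K := by
    refine le_trans ?_ hw
    rw [wt, tsum_subtype {x : ℕ × ℕ | ∃ ℓ, f (strPrefix A ℓ) x = true}
      (fun x : ℕ × ℕ => (2⁻¹ : ℝ≥0∞) ^ x.1)]
    have inj : Function.Injective Nat.unpair := fun a b h => by
      rw [← Nat.pair_unpair a, ← Nat.pair_unpair b, h]
    refine le_trans ?_ (ENNReal.tsum_comp_le_tsum_of_injective inj _)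
    refine le_trans (Finset.sum_le_sum fun y hy => ?_) (ENNReal.sum_le_tsum D.toFinset)
    rw [List.mem_toFinset, hD] at hy
    rw [Set.indicator_of_mem (show y.unpair ∈ {x : ℕ × ℕ | ∃ ℓ, f (strPrefix A ℓ) x = true} from ⟨N, hy.2⟩)]
  have hE : μCantor (cylinder τ ∩ ⋃ y ∈ D.toFinset, Ev j o y) ≤ 2⁻¹ ^ (c+5) * t := by
    rw [Set.inter_iUnion₂]
    refine (measure_biUnion_finset_le _ _).trans ?_
    have : ∀ y ∈ D.toFinset, μCantor (cylinder τ ∩ Ev j o y) = 2⁻¹ ^ y.unpair.1 * (2⁻¹ ^ j * t) := by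
      intro y _
      rw [mu_Ev, mu_cyl, pow_add, mul_comm, mul_assoc]
      intro Y Z h
      rw [mem_cyl, mem_cyl, sp_eq_of_le h (by omega)]
    rw [Finset.sum_congr rfl this, ← Finset.sum_mul, ← mul_assoc]
    gcongr
    calc _ ≤ 2 ^ K * (2⁻¹ : ℝ≥0∞) ^ j := by gcongr
      _ = 2⁻¹ ^ (c+5) := by
        rw [hj, add_assoc, pow_add, ← mul_assoc, ← mul_pow, ENNReal.mul_inv_cancel (by simp) (by simp),
          one_pow, one_mul]
  have hpos : μCantor (openOf S5)ᶜ ≠ 0 := by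
    intro h0
    have h1 : cylinder τ ∩ (openOf S4)ᶜ ⊆ (openOf S5)ᶜ ∪ (cylinder τ ∩ ⋃ y ∈ D.toFinset, Ev j o y) := by
      rw [h5]
      intro Y hY
      by_cases h : Y ∈ ⋃ y ∈ D.toFinset, Ev j o y
      · exact Or.inr ⟨hY.1, h⟩
      · exact Or.inl ⟨hY, h⟩
    have h2 := (measure_mono h1).trans (measure_union_le (μ := μCantor) _ _)
    rw [h0, zero_add] at h2
    have h3 := d4.trans (h2.trans hE)
    exact absurd h3 (not_le.2 (by
      rw [ENNReal.mul_lt_mul_iff_left ht1 ht0]; exact half_lt (by omega)))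
  obtain ⟨V, V1, V2, V3⟩ := avoid s5 hpos j o
  obtain ⟨x, ⟨ℓ, hx⟩, hxV⟩ := Set.not_subset.1 (hV V V1 V2)
  obtain ⟨Y, hY, hYE⟩ := V3 (Nat.pair x.1 x.2) (by rwa [Nat.unpair_pair])
  rw [h5] at hY
  have hex : ∃ s, Hit f A Y j o s := by
    refine ⟨max ℓ (Nat.pair x.1 x.2 + 1), Nat.pair x.1 x.2, ?_, ?_, hYE⟩
    · exact lt_of_lt_of_le (Nat.lt_succ_self _) (le_max_right _ _)
    · rw [Nat.unpair_pair]
      exact fm _ _ _ (sp_mono A (le_max_left _ _)) hx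
  refine ⟨Nat.find hex, Y, ?_, hY.1.1, Nat.find_spec hex, fun s' h => Nat.find_min hex h, ?_⟩
  · by_contra hc
    push Not at hc
    obtain ⟨y, h1, h2, h3⟩ := Nat.find_spec hex
    refine hY.2 (Set.mem_iUnion₂.2 ⟨y, ?_, h3⟩)
    rw [List.mem_toFinset, hD]
    exact ⟨by omega, fm _ _ _ (sp_mono A hc.le) h2⟩
  · exact ref_dens hY.1.2 hY.1.1 (Nat.le_add_right _ _)

theorem split_ex {S T : Set (List Bool)} {Q : ℕ → List Bool → Bool}
    (Qm : ∀ t t' ρ ρ', t ≤ t' → ρ <+: ρ' → Q t ρ = true → Q t' ρ' = true)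
    (Qe : openOf T = {Y | ∃ t, Q t (strPrefix Y t) = true}) (τ : List Bool) (c : ℕ)
    (hd : ¬ μCantor (cylinder τ ∩ (openOf S)ᶜ) < 2⁻¹ ^ c * 2⁻¹ ^ τ.length) :
    ∃ a : ℕ, ¬ μCantor (cylinder τ ∩ (openOf {σ | σ ∈ S ∨ (a = 0 ∧ σ ∈ T) ∨
      (0 < a ∧ a ≤ σ.length ∧ Q a (σ.take a) = false)})ᶜ) < 2⁻¹ ^ (c+2) * 2⁻¹ ^ τ.length := by
  by_contra hcon
  push Not at hcon
  apply hd
  set U := fun t : ℕ => cylinder τ ∩ (openOf S)ᶜ ∩ {Y | Q (t+1) (strPrefix Y (t+1)) = true}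
  have h0 : cylinder τ ∩ (openOf S)ᶜ ⊆ (cylinder τ ∩ (openOf {σ | σ ∈ S ∨ (0 = 0 ∧ σ ∈ T) ∨
      (0 < 0 ∧ 0 ≤ σ.length ∧ Q 0 (σ.take 0) = false)})ᶜ) ∪ ⋃ t, U t := by
    rintro Y ⟨h1, h2⟩
    by_cases hT : Y ∈ openOf T
    · right
      rw [Qe] at hT
      obtain ⟨t, ht⟩ := hT
      exact Set.mem_iUnion.2 ⟨t, ⟨h1, h2⟩, Qm _ _ _ _ (by omega) (sp_mono Y (by omega)) ht⟩
    · left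
      refine ⟨h1, fun hc => ?_⟩
      rw [mem_openOf] at hc
      obtain ⟨n, hn | hn | hn⟩ := hc
      · exact h2 (mem_openOf.2 ⟨n, hn⟩)
      · exact hT (mem_openOf.2 ⟨n, hn.2⟩)
      · exact absurd hn.1 (by omega)
  have hU : ∀ t, U t ⊆ cylinder τ ∩ (openOf {σ | σ ∈ S ∨ (t + 1 = 0 ∧ σ ∈ T) ∨
      (0 < t + 1 ∧ t + 1 ≤ σ.length ∧ Q (t+1) (σ.take (t+1)) = false)})ᶜ := by
    rintro t Y ⟨⟨h1, h2⟩, h3⟩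
    refine ⟨h1, fun hc => ?_⟩
    rw [mem_openOf] at hc
    obtain ⟨n, hn | hn | hn⟩ := hc
    · exact h2 (mem_openOf.2 ⟨n, hn⟩)
    · exact absurd hn.1 (by omega)
    · have := hn.2.2
      rw [sp_length] at hn
      rw [sp_take, min_eq_left hn.2.1, h3] at this; cases this
  have hUm : Monotone U := by
    intro t t' h Y hY
    exact ⟨hY.1, Qm _ _ _ _ (by omega) (sp_mono Y (by omega)) hY.2⟩
  have h1 := (measure_mono h0).trans (measure_union_le (μ := μCantor) _ _)
  rw [hUm.measure_iUnion] at h1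
  refine lt_of_le_of_lt (h1.trans (add_le_add (hcon 0).le
    (iSup_le fun t => (measure_mono (hU t)).trans (hcon (t+1)).le))) ?_
  rw [← add_mul, half_add (c+1)]
  rw [ENNReal.mul_lt_mul_iff_left (halfpow_pos _).ne' (half_ne_top _)]; exact half_lt (by omega)

end Dir2b

end

section
open MeasureTheory ENNReal

section Dir2c
variable {A : ℕ → Bool}

def We (e : ℕ) : Set (List Bool) := {σ | WEnum e (Encodable.encode σ)}

def Low (e c : ℕ) (τ : List Bool) : Prop :=
  μCantor (cylinder τ ∩ (openOf (We e))ᶜ) < 2⁻¹ ^ c * 2⁻¹ ^ τ.length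

theorem sig_We : Sig A (fun q : ℕ × List Bool => q.2 ∈ We q.1) :=
  Sig.wenum.comp (f := fun q : ℕ × List Bool => (q.1, Encodable.encode q.2)) (by fun_prop)

theorem sig_Low : Sig emptyOracle (fun x : ℕ × ℕ × List Bool => Low x.1 x.2.1 x.2.2) :=
  sig_low (S := We) sig_We

theorem dir2 (hA : TuringLE A zeroJump) (hK : ¬ KTrivial A) : MLCuppable A := by
  classical
  have hL : ¬ LProp A := fun h => hK h.ktrivial
  simp only [LProp] at hL
  push Not at hL
  obtain ⟨W, hW, hWt, hWV⟩ := hL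
  obtain ⟨f, fc, fm, fW⟩ := hW
  have hWe : W = {x | ∃ ℓ, f (strPrefix A ℓ) x = true} := Set.ext fW
  obtain ⟨K, hKK⟩ : ∃ K : ℕ, wt W ≤ 2 ^ K := by
    obtain ⟨n, hn⟩ := ENNReal.exists_nat_gt hWt.ne
    refine ⟨n, hn.le.trans ?_⟩
    exact_mod_cast (Nat.lt_two_pow_self (n := n)).le
  have hV : ∀ V : Set (ℕ × ℕ), Sig emptyOracle (fun x => x ∈ V) → wt V < ⊤ →
      ¬ {x | ∃ ℓ, f (strPrefix A ℓ) x = true} ⊆ V := by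
    intro V h1 h2 h3
    exact absurd h2 (not_lt.2 (hWV V h1 (hWe ▸ h3)))
  rw [hWe] at hKK
  obtain ⟨Q, Qc, Qm, Qe⟩ := famQ (S := We) sig_We
  -- indices
  obtain ⟨i1, i1c, hi1⟩ := smn_sig (β := ℕ × ℕ × ℕ) (γ := List Bool)
    (p := fun b σ => σ ∈ We b.1 ∨ (b.2.2 = 0 ∧ σ ∈ We b.2.1) ∨
      (0 < b.2.2 ∧ b.2.2 ≤ σ.length ∧ Q b.2.1 b.2.2 (σ.take b.2.2) = false)) (by
    refine Sig.or (sig_We.comp (f := fun q : (ℕ × ℕ × ℕ) × List Bool => (q.1.1, q.2)) (by fun_prop)) ?_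
    refine Sig.or (Sig.and (Sig.dec (by fun_prop))
      (sig_We.comp (f := fun q : (ℕ × ℕ × ℕ) × List Bool => (q.1.2.1, q.2)) (by fun_prop))) ?_
    exact Sig.dec (by fun_prop))
  obtain ⟨i2, i2c, hi2⟩ := smn_sig (β := ℕ × List Bool × ℕ) (γ := List Bool)
    (p := fun b σ => σ ∈ We b.1 ∨ (σ.take b.2.1.length = b.2.1 ∧ Low b.1 b.2.2 σ)) (by
    refine Sig.or (sig_We.comp (f := fun q : (ℕ × List Bool × ℕ) × List Bool => (q.1.1, q.2))
      (by fun_prop)) ?_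
    refine Sig.and (Sig.dec (by fun_prop)) (sig_Low.comp
      (f := fun q : (ℕ × List Bool × ℕ) × List Bool => (q.1.1, q.1.2.2, q.2)) (by fun_prop)))
  have We1 : ∀ e i a, We (i1 (e, i, a)) = {σ | σ ∈ We e ∨ (a = 0 ∧ σ ∈ We i) ∨
      (0 < a ∧ a ≤ σ.length ∧ Q i a (σ.take a) = false)} := fun e i a => Set.ext fun σ => hi1 _ _
  have We2 : ∀ e τ c, We (i2 (e, τ, c)) = refS (We e) τ c := fun e τ c => Set.ext fun σ => by
    refine (hi2 _ _).trans ?_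
    simp only [refS, Set.mem_ofPred_eq]
    rw [List.prefix_iff_eq_take, eq_comm]; rfl
  obtain ⟨hz, hzc, hzm, hzz⟩ := sig_empty_iff.1 sig_zeroJump
  let cc : ℕ → ℕ := fun i => 1 + 4 * i
  let jj : ℕ → ℕ := fun i => K + cc i + 5
  -- the step relation
  let Sg : ℕ × List Bool × ℕ → ℕ × List Bool × ℕ → ℕ × ℕ × ℕ → Prop := fun x x' w =>
    ¬ Low (i1 (x.2.2, x.1, w.1)) (cc x.1 + 2) x.2.1 ∧
    (zeroJump x.1 = false ∨ hz x.1 w.2.1 = true) ∧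
    (w.2.1 ≤ w.2.2 ∧ x'.2.1.take x.2.1.length = x.2.1 ∧
      x'.2.1.length = x.2.1.length + bb (jj x.1) w.2.2 ∧
      x'.2.2 = i2 (i1 (x.2.2, x.1, w.1), x.2.1, cc x.1 + 3)) ∧
    firB f (strPrefix A w.2.2) x'.2.1 (jj x.1) x.2.1.length w.2.2 = true ∧
    ¬ Low x'.2.2 (cc x.1 + 4) x'.2.1
  let R : ℕ × List Bool × ℕ → ℕ × List Bool × ℕ → Prop := fun x x' =>
    x'.1 = x.1 + 1 ∧ ((Low x.2.2 (cc x.1) x.2.1 ∧ x'.2 = x.2) ∨ ∃ w, Sg x x' w)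
  have sFir : Sig A (fun q : (List Bool × ℕ × ℕ) × ℕ =>
      firB f (strPrefix A q.2) q.1.1 q.1.2.1 q.1.2.2 q.2 = true) :=
    Sig.decA (h := fun α (q : (List Bool × ℕ × ℕ) × ℕ) => firB f α q.1.1 q.1.2.1 q.1.2.2 q.2)
      (n := fun q => q.2) (by simp only [firB, hitB, bb]; fun_prop) (by fun_prop)
  have hR : Sig zeroJump (fun q : (ℕ × List Bool × ℕ) × (ℕ × List Bool × ℕ) => R q.1 q.2) := by
    refine Sig.and (Sig.dec (by fun_prop)) (Sig.or (Sig.and ?_ (Sig.dec (by fun_prop))) ?_)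
    · exact (Sig.of_empty sig_Low).comp (f := fun q : (ℕ × List Bool × ℕ) × (ℕ × List Bool × ℕ) =>
        (q.1.2.2, 1 + 4 * q.1.1, q.1.2.1)) (by fun_prop)
    · refine Sig.ex (p := fun (q : (ℕ × List Bool × ℕ) × (ℕ × List Bool × ℕ)) w => Sg q.1 q.2 w) ?_
      refine Sig.and ?_ (Sig.and (Sig.or ?_ (Sig.dec (by fun_prop))) (Sig.and (Sig.dec ?_)
        (Sig.and ?_ ?_)))
      · exact sig_Low.not_zj.comp (f := fun q : ((ℕ × List Bool × ℕ) × (ℕ × List Bool × ℕ)) × ℕ × ℕ × ℕ =>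
          (i1 (q.1.1.2.2, q.1.1.1, q.2.1), 1 + 4 * q.1.1.1 + 2, q.1.1.2.1)) (by fun_prop)
      · exact Sig.app.comp (f := fun q : ((ℕ × List Bool × ℕ) × (ℕ × List Bool × ℕ)) × ℕ × ℕ × ℕ =>
          (q.1.1.1, false)) (by fun_prop)
      · simp only [jj, cc, bb]; fun_prop
      · exact (Sig.trans hA sFir).comp
          (f := fun q : ((ℕ × List Bool × ℕ) × (ℕ × List Bool × ℕ)) × ℕ × ℕ × ℕ =>
          ((q.1.2.2.1, K + (1 + 4 * q.1.1.1) + 5, q.1.1.2.1.length), q.2.2.2)) (by fun_prop)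
      · exact sig_Low.not_zj.comp (f := fun q : ((ℕ × List Bool × ℕ) × (ℕ × List Bool × ℕ)) × ℕ × ℕ × ℕ =>
          (q.1.2.2.2, 1 + 4 * q.1.1.1 + 4, q.1.2.2.1)) (by fun_prop)
  have tot : ∀ x, ∃ x', R x x' := by
    rintro ⟨i, τ, e⟩
    by_cases hlow : Low e (cc i) τ
    · exact ⟨(i+1, τ, e), rfl, Or.inl ⟨hlow, rfl⟩⟩
    obtain ⟨a, ha⟩ := split_ex (S := We e) (T := We i) (Q := Q i) (Qm i) (Qe i) τ (cc i) hlow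
    rw [← We1] at ha
    obtain ⟨N, hN⟩ : ∃ N, zeroJump i = false ∨ hz i N = true := by
      by_cases h : zeroJump i = true
      · obtain ⟨N, hN⟩ := (hzz i).1 h
        exact ⟨N, Or.inr hN⟩
      · exact ⟨0, Or.inl (by simpa using h)⟩
    obtain ⟨s, Y, h1, h2, h3, h4, h5⟩ := step_ex fm hKK hV (S := We (i1 (e, i, a)))
      (sig_We.comp (f := fun σ : List Bool => (i1 (e, i, a), σ)) (by fun_prop)) τ (cc i) N ha
    refine ⟨(i+1, strPrefix Y (τ.length + bb (jj i) s), i2 (i1 (e, i, a), τ, cc i + 3)), rfl,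
      Or.inr ⟨(a, N, s), ha, hN, ⟨h1, ?_, sp_length _ _, rfl⟩, (fir_iff _ _ _ _ _).2 ⟨h3, h4⟩, ?_⟩⟩
    · simp only [sp_take]
      rw [min_eq_left (by omega)]; exact mem_cyl.1 h2
    · simp only [Low, We2, sp_length]
      exact h5
  obtain ⟨F, hF, sF⟩ := Sig.unif hR tot
  -- the start
  have h0 : ∀ n, strPrefix emptyOracle n = List.replicate n false := by
    intro n; induction n with
    | zero => rfl
    | succ n ih => rw [sp_succ, ih, List.replicate_succ']; rfl
  obtain ⟨i0, i0c, hi0⟩ := smn_sig (β := Unit) (γ := List Bool)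
    (p := fun _ σ => univ 1 (List.replicate σ.length false) σ = true) (Sig.dec (by fun_prop))
  let e0 := i0 ()
  have hWe0 : openOf (We e0) = {Y | ∃ L, univ 1 (strPrefix emptyOracle L) (strPrefix Y L) = true} := by
    ext Y
    rw [mem_openOf]
    simp only [h0]
    refine exists_congr fun n => ?_
    refine (hi0 () _).trans ?_
    rw [sp_length]
  let st : ℕ → ℕ × List Bool × ℕ := fun n => F^[n] (0, [], e0)
  have st_succ : ∀ n, st (n+1) = F (st n) := fun n => Function.iterate_succ_apply' F n _
  have st1 : ∀ n, (st n).1 = n := by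
    intro n
    induction n with
    | zero => rfl
    | succ n ih => rw [st_succ, (hF (st n)).1, ih]
  have good : ∀ n, ¬ Low (st n).2.2 (cc n) (st n).2.1 := by
    intro n
    induction n with
    | zero =>
      show ¬ Low e0 1 []
      simp only [Low, hWe0]
      have hc : cylinder [] = Set.univ := by ext Y; simp [mem_cyl, strPrefix]
      rw [hc, Set.univ_inter, not_lt, ← hWe0, prob_compl_eq_one_sub (measurableSet_openOf _), hWe0]
      simp only [List.length_nil, pow_zero, mul_one]
      apply ENNReal.le_sub_of_add_le_left (measure_ne_top _ _)
      refine (add_le_add_left (mu_univ 1 emptyOracle) _).trans ?_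
      simp [ENNReal.inv_two_add_inv_two]
    | succ n ih =>
      have := (hF (st n)).2
      rw [st1] at this
      rcases this with h | ⟨w, hw⟩
      · exact absurd h.1 ih
      · have := hw.2.2.2.2
        rw [st1] at this
        rw [st_succ]
        exact this
  have step : ∀ n, ∃ w, Sg (st n) (st (n+1)) w := by
    intro n
    have := (hF (st n)).2
    rw [st1, ← st_succ] at this
    exact this.resolve_left fun h => good n h.1
  choose w hw using step
  let τ : ℕ → List Bool := fun n => (st n).2.1
  let e : ℕ → ℕ := fun n => (st n).2.2
  have w1 : ∀ n, ¬ Low (i1 (e n, n, (w n).1)) (cc n + 2) (τ n) := by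
    intro n; have := (hw n).1; rwa [st1] at this
  have w2 : ∀ n, zeroJump n = false ∨ hz n (w n).2.1 = true := by
    intro n; have := (hw n).2.1; rwa [st1] at this
  have w3 : ∀ n, (w n).2.1 ≤ (w n).2.2 := fun n => (hw n).2.2.1.1
  have w4 : ∀ n, τ n <+: τ (n+1) := by
    intro n; rw [List.prefix_iff_eq_take]; exact (hw n).2.2.1.2.1.symm
  have w5 : ∀ n, (τ (n+1)).length = (τ n).length + bb (jj n) (w n).2.2 := by
    intro n; have := (hw n).2.2.1.2.2.1; rwa [st1] at this
  have w6 : ∀ n, e (n+1) = i2 (i1 (e n, n, (w n).1), τ n, cc n + 3) := by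
    intro n; have := (hw n).2.2.1.2.2.2; rwa [st1] at this
  have w7 : ∀ n, firB f (strPrefix A (w n).2.2) (τ (n+1)) (jj n) (τ n).length (w n).2.2 = true := by
    intro n; have := (hw n).2.2.2.1; rwa [st1] at this
  have mono : ∀ n m, n ≤ m → τ n <+: τ m := by
    intro n m h
    induction h with
    | refl => exact List.prefix_rfl
    | step _ ih => exact ih.trans (w4 _)
  have len : ∀ n, n ≤ (τ n).length := by
    intro n
    induction n with
    | zero => omega
    | succ n ih =>
      rw [w5]
      have h1 : 0 < (w n).2.2 := by
        have := w7 n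
        simp only [firB, Bool.and_eq_true, hitB, List.any_eq_true, List.mem_range] at this
        obtain ⟨⟨y, hy, _⟩, _⟩ := this
        omega
      have h2 := bb_mono (jj n) (show 1 ≤ (w n).2.2 from h1)
      have h3 := bb_succ (jj n) 0
      have : 5 ≤ jj n := by simp only [jj]; omega
      simp only [zero_add] at h3
      omega
  let X : ℕ → Bool := fun n => (τ (n+1)).getD n false
  have hXτ : ∀ n, strPrefix X (τ n).length = τ n := by
    intro n
    apply List.ext_getElem (by rw [sp_length])
    intro i h1 h2
    rw [sp_getElem]
    simp only [X]
    have h3 : i < (τ (i+1)).length := by have := len (i+1); omega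
    rw [List.getD_eq_getElem _ _ h3]
    rcases le_total n (i+1) with h | h
    · exact ((mono _ _ h).getElem h2).symm
    · exact (mono _ _ h).getElem h3
  have hnest : ∀ n m, n ≤ m → We (e n) ⊆ We (e m) := by
    intro n m h
    induction h with
    | refl => exact subset_rfl
    | step _ ih =>
      refine ih.trans ?_
      rw [w6, We2]
      refine subset_trans ?_ (sub_refS _ _ _)
      rw [We1]
      exact fun σ h => Or.inl h
  have hXe : ∀ n, X ∉ openOf (We (e n)) := by
    intro n hc
    rw [mem_openOf] at hc
    obtain ⟨m, hm⟩ := hc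
    let k := max n m
    apply good k
    have h1 : cylinder (τ k) ∩ (openOf (We (e k)))ᶜ = ∅ := by
      rw [Set.eq_empty_iff_forall_notMem]
      rintro Y ⟨h2, h3⟩
      apply h3
      rw [mem_openOf]
      refine ⟨m, hnest n k (le_max_left _ _) ?_⟩
      have h4 : strPrefix Y (τ k).length = strPrefix X (τ k).length := by
        rw [hXτ]; exact mem_cyl.1 h2
      rw [sp_eq_of_le h4 ((le_max_right n m).trans (len k))]
      exact hm
    show μCantor _ < _
    rw [h1, measure_empty]
    exact ENNReal.mul_pos (halfpow_pos _).ne' (halfpow_pos _).ne'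
  have hXr : MLRandom X := by
    by_contra hc
    exact hXe 0 (by
      show X ∈ openOf (We e0)
      rw [hWe0]; exact univ_complete 1 hc)
  have sst := Sig.iter sF (0, [], e0)
  have hX0 : TuringLE X zeroJump := by
    rw [turingLE_iff]
    refine (Sig.ex (p := fun (x : ℕ × Bool) (y : ℕ × List Bool × ℕ) => F^[x.1 + 1] (0, [], e0) = y ∧
      y.2.1.getD x.1 false = x.2) (Sig.and (sst.comp
        (f := fun q : (ℕ × Bool) × (ℕ × List Bool × ℕ) => (q.1.1 + 1, q.2)) (by fun_prop))
      (Sig.dec (by fun_prop)))).of_eq ?_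
    rintro ⟨n, b⟩
    constructor
    · rintro ⟨y, rfl, h⟩; exact h
    · intro h; exact ⟨_, rfl, h⟩
  refine ⟨X, hXr, hX0, ?_, ?_⟩
  · intro hZX
    obtain ⟨S, S1, S2, S3⟩ := part8 (A := emptyOracle) (X := X) hXr (by
      intro B hB
      refine TuringLE.trans' (TuringLE.trans' ?_ hZX) TuringLE.join_right
      exact turingLE_of_sig (Sig.of_empty hB) (hB.not_zj.of_eq fun n => by simp))
    obtain ⟨ii, iic, hii⟩ := smn_sig (β := Unit) (γ := List Bool) (p := fun _ σ => σ ∈ S)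
      (S1.comp (f := fun q : Unit × List Bool => q.2) (by fun_prop))
    let i := ii ()
    have hSi : We i = S := Set.ext fun σ => hii () σ
    set a := (w i).1 with ha
    have hX1 : X ∉ openOf (refS (We (i1 (e i, i, a))) (τ i) (cc i + 3)) := by
      rw [← We2, ← w6]; exact hXe (i+1)
    rcases Nat.eq_zero_or_pos a with h | h
    · have hsub : (openOf (We (i1 (e i, i, a))))ᶜ ⊆ (openOf S)ᶜ := by
        rw [Set.compl_subset_compl]
        apply openOf_mono
        rw [We1, hSi]
        exact fun σ hσ => Or.inr (Or.inl ⟨h, hσ⟩)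
      obtain ⟨n, hn⟩ := S3 (cc i + 3 + (τ i).length + 1)
      have key : ∀ ℓ, (τ i).length ≤ ℓ → 2⁻¹ ^ (cc i + 3) * 2⁻¹ ^ ℓ ≤
          μCantor (cylinder (strPrefix X ℓ) ∩ (openOf S)ᶜ) := by
        intro ℓ hℓ
        refine (not_lt.1 (ref_dens hX1 (mem_cyl.2 (hXτ i)) hℓ)).trans ?_
        exact measure_mono (Set.inter_subset_inter_right _ hsub)
      have h2 : μCantor (cylinder (strPrefix X (max n (τ i).length)) ∩ (openOf S)ᶜ) ≤
          μCantor (cylinder (strPrefix X n) ∩ (openOf S)ᶜ) := by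
        refine measure_mono (Set.inter_subset_inter_left _ fun Y hY => ?_)
        rw [mem_cyl, sp_length] at *
        exact sp_eq_of_le hY (le_max_left _ _)
      have h3 := (key _ (le_max_right n (τ i).length)).trans (h2.trans hn)
      rw [← pow_add, ← pow_add] at h3
      refine absurd h3 (not_le.2 (half_lt ?_))
      rcases le_total n (τ i).length with h | h
      · rw [max_eq_right h]; omega
      · rw [max_eq_left h]; omega
    · apply S2
      rw [← hSi, Qe]
      refine ⟨a, ?_⟩
      by_contra hc
      apply hX1
      apply openOf_mono (sub_refS _ _ _)
      rw [We1, mem_openOf]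
      refine ⟨a, Or.inr (Or.inr ⟨h, by rw [sp_length], ?_⟩)⟩
      rw [sp_take, min_self]; simpa using hc
  · -- decoding
    let J := joinSet A X
    have hfir : ∀ n, Hit f A X (jj n) (τ n).length (w n).2.2 ∧
        ∀ s' < (w n).2.2, ¬ Hit f A X (jj n) (τ n).length s' := by
      intro n
      rw [← fir_iff, ← w5, hXτ]; exact w7 n
    have sfir : Sig J (fun q : ℕ × ℕ × ℕ => firB f (strPrefix A q.2.2)
        (strPrefix X (q.2.1 + bb (jj q.1) q.2.2)) (jj q.1) q.2.1 q.2.2 = true) := by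
      have h1 : Sig J (fun q : ℕ × ℕ × ℕ => ∃ ρ, strPrefix X (q.2.1 + bb (jj q.1) q.2.2) = ρ ∧
          firB f (strPrefix A q.2.2) ρ (jj q.1) q.2.1 q.2.2 = true) := by
        refine Sig.ex (p := fun (q : ℕ × ℕ × ℕ) ρ => strPrefix X (q.2.1 + bb (jj q.1) q.2.2) = ρ ∧
          firB f (strPrefix A q.2.2) ρ (jj q.1) q.2.1 q.2.2 = true) (Sig.and ?_ ?_)
        · exact (Sig.preTrans (TuringLE.join_right (A := A) (B := X))).comp
            (f := fun z : (ℕ × ℕ × ℕ) × List Bool => (z.1.2.1 + bb (jj z.1.1) z.1.2.2, z.2))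
            (by simp only [jj, cc, bb]; fun_prop)
        · exact (Sig.trans (TuringLE.join_left (A := A) (B := X)) sFir).comp
            (f := fun z : (ℕ × ℕ × ℕ) × List Bool => ((z.2, jj z.1.1, z.1.2.1), z.1.2.2))
            (by simp only [jj, cc]; fun_prop)
      exact h1.of_eq fun q => by simp
    have uniq : ∀ n s, firB f (strPrefix A s) (strPrefix X ((τ n).length + bb (jj n) s)) (jj n)
        (τ n).length s = true ↔ s = (w n).2.2 := by
      intro n s
      rw [fir_iff]
      constructor
      · rintro ⟨h1, h2⟩
        rcases lt_trichotomy s (w n).2.2 with h | h | h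
        · exact absurd h1 ((hfir n).2 _ h)
        · exact h
        · exact absurd (hfir n).1 (h2 _ h)
      · rintro rfl; exact hfir n
    let RR : ℕ × ℕ → ℕ × ℕ → Prop := fun x x' => ∃ s, (x'.1 = x.1 + 1 ∧ x'.2 = x.2 + bb (jj x.1) s) ∧
      firB f (strPrefix A s) (strPrefix X (x.2 + bb (jj x.1) s)) (jj x.1) x.2 s = true
    have sRR : Sig J (fun q : (ℕ × ℕ) × (ℕ × ℕ) => RR q.1 q.2) := by
      refine Sig.ex (p := fun (q : (ℕ × ℕ) × (ℕ × ℕ)) s =>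
        (q.2.1 = q.1.1 + 1 ∧ q.2.2 = q.1.2 + bb (jj q.1.1) s) ∧
        firB f (strPrefix A s) (strPrefix X (q.1.2 + bb (jj q.1.1) s)) (jj q.1.1) q.1.2 s = true)
        (Sig.and (Sig.dec (by simp only [jj, cc, bb]; fun_prop)) ?_)
      exact sfir.comp (f := fun z : ((ℕ × ℕ) × (ℕ × ℕ)) × ℕ => (z.1.1.1, z.1.1.2, z.2)) (by fun_prop)
    have hSr : ∀ n, Sr (0, 0) RR n = {(n, (τ n).length)} := by
      intro n
      induction n with
      | zero => rfl
      | succ n ih =>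
        ext ⟨m, o⟩
        show (∃ y ∈ Sr (0, 0) RR n, RR y (m, o)) ↔ _
        rw [ih]
        simp only [Set.mem_singleton_iff, exists_eq_left, RR, uniq, Prod.mk.injEq]
        constructor
        · rintro ⟨s, ⟨h1, h2⟩, h3⟩
          rw [h3] at h2
          exact ⟨h1, by rw [w5]; exact h2⟩
        · rintro ⟨h1, h2⟩
          exact ⟨_, ⟨h1, by rw [h2, w5]⟩, rfl⟩
    have sSr := sig_Sr (x₀ := (0, 0)) sRR
    rw [turingLE_iff]
    refine (Sig.ex (p := fun (x : ℕ × Bool) (y : ℕ × ℕ) => (x.1, y.1) ∈ Sr (0,0) RR x.1 ∧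
      firB f (strPrefix A y.2) (strPrefix X (y.1 + bb (jj x.1) y.2)) (jj x.1) y.1 y.2 = true ∧
      hz x.1 y.2 = x.2) (Sig.and ?_ (Sig.and ?_ (Sig.dec (by fun_prop))))).of_eq ?_
    · exact sSr.comp (f := fun z : (ℕ × Bool) × ℕ × ℕ => (z.1.1, (z.1.1, z.2.1))) (by fun_prop)
    · exact sfir.comp (f := fun z : (ℕ × Bool) × ℕ × ℕ => (z.1.1, z.2.1, z.2.2)) (by fun_prop)
    · rintro ⟨n, b⟩
      have hbit : hz n (w n).2.2 = zeroJump n := by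
        rcases w2 n with h | h
        · rw [h]
          by_contra hc
          rw [Bool.not_eq_false] at hc
          rw [(hzz n).2 ⟨_, hc⟩] at h; cases h
        · rw [(hzz n).2 ⟨_, h⟩]
          exact hzm _ _ _ (w3 n) h
      simp only [hSr, Set.mem_singleton_iff, Prod.mk.injEq, true_and]
      constructor
      · rintro ⟨⟨o, s⟩, h1, h2, h3⟩
        simp only at h1 h2 h3
        subst h1
        rw [uniq] at h2
        rw [← hbit, ← h2, h3]
      · intro h
        exact ⟨((τ n).length, (w n).2.2), rfl, (uniq n _).2 rfl, by rw [← h]; exact hbit⟩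

end Dir2c

end

section
open MeasureTheory ENNReal

/-! ### The decanter game -/
section Game

/-- a record: use string, exponent, numerator, start, end, dead flag -/
abbrev GRec := List Bool × ℕ × ℕ × ℕ × ℕ × Bool
/-- a frame: level, goal, start, exponent, numerator, active string, records, finished flag -/
abbrev GFrame := ℕ × ℕ × ℕ × ℕ × ℕ × List Bool × List GRec × Bool

def upd (β : List Bool) (rs : List GRec) : List GRec :=
  rs.map fun x => (x.1, x.2.1, x.2.2.1, x.2.2.2.1, x.2.2.2.2.1,
    x.2.2.2.2.2 || decide (β.take x.1.length ≠ x.1))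

def dsum (n : ℕ) (rs : List GRec) : ℕ :=
  ((rs.filter fun x => x.2.2.2.2.2).map fun x => 2 ^ (n - x.2.1)).sum

def cand (κ : ℕ) (β : List Bool) (s n a : ℕ) : Option ℕ :=
  (List.range (s+1)).find? fun ℓ => (strs ℓ).any fun ρ =>
    decide (num ρ = a * 2 ^ ℓ / 2 ^ (n+2)) && univ κ (β.take ℓ) ρ

def comb0 (κ s lev g start n a : ℕ) (β τ : List Bool) (rs : List GRec) (acc : List GFrame) : List GFrame :=
  (acc.head?).elim
    ((cand κ β s n a).elim [(lev, g, start, n, a, τ, rs, false)] fun ℓ =>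
      [(lev, g, start, max n ℓ, a * 2 ^ (max n ℓ - n), β.take ℓ, rs, false),
       (lev - 1, g + max n ℓ, s, κ, 0, [], [], false)])
    fun ch => if β.take τ.length ≠ τ then [(lev, g, start, n+1, 2*a, τ, rs, false)]
      else if ch.2.2.2.2.2.2.2 = true then
        [(lev, g, start, n, a+1, τ, rs ++ [(τ, n, a, ch.2.2.1, s, false)], false)]
      else (lev, g, start, n, a, τ, rs, false) :: acc

def comb (κ s : ℕ) (β : List Bool) (fr : GFrame) (acc : List GFrame) : List GFrame :=
  if fr.1 = 0 then [(fr.1, fr.2.1, fr.2.2.1, fr.2.2.2.1, fr.2.2.2.2.1, fr.2.2.2.2.2.1, fr.2.2.2.2.2.2.1, true)]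
  else if fr.2.2.2.2.2.2.2 = true then [fr]
  else if 2 ^ fr.2.2.2.1 ≤ dsum fr.2.2.2.1 (upd β fr.2.2.2.2.2.2.1) then
    [(fr.1, fr.2.1, fr.2.2.1, fr.2.2.2.1, fr.2.2.2.2.1, fr.2.2.2.2.2.1, upd β fr.2.2.2.2.2.2.1, true)]
  else comb0 κ s fr.1 fr.2.1 fr.2.2.1 fr.2.2.2.1 fr.2.2.2.2.1 β fr.2.2.2.2.2.1
    (upd β fr.2.2.2.2.2.2.1) acc

def gstep (κ s : ℕ) (β : List Bool) (st : List GFrame) : List GFrame :=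
  st.reverse.foldl (fun acc fr => comb κ s β fr acc) []

theorem gstep_cons (κ s : ℕ) (β : List Bool) (fr : GFrame) (st : List GFrame) :
    gstep κ s β (fr :: st) = comb κ s β fr (gstep κ s β st) := by
  simp [gstep, List.foldl_append]
theorem gstep_nil (κ s : ℕ) (β : List Bool) : gstep κ s β [] = [] := rfl

def ginit (κ lev g s : ℕ) : GFrame := (lev, g, s, κ, 0, [], [], false)

def grun (κ : ℕ) (β : ℕ → List Bool) (lev g s0 : ℕ) : ℕ → List GFrame
  | 0 => [ginit κ lev g s0]
  | s+1 => if s + 1 ≤ s0 then [ginit κ lev g s0] else gstep κ (s+1) (β (s+1)) (grun κ β lev g s0 s)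

/-- investment made by a state at stage `u` -/
def ginv (st : List GFrame) (u : ℕ) : Option ℕ :=
  st.reverse.head?.elim none fun fr => if fr.1 = 0 ∧ fr.2.2.1 = u then some fr.2.1 else none

@[fun_prop]
theorem cUpd {α : Type} [Primcodable α] {f : α → List Bool} {g : α → List GRec} (hf : Computable f)
    (hg : Computable g) : Computable (fun x => upd (f x) (g x)) := by
  simp only [upd]; fun_prop
@[fun_prop]
theorem cDsum {α : Type} [Primcodable α] {f : α → ℕ} {g : α → List GRec} (hf : Computable f)
    (hg : Computable g) : Computable (fun x => dsum (f x) (g x)) := by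
  simp only [dsum]; fun_prop
@[fun_prop]
theorem cCand {α : Type} [Primcodable α] {k s n a : α → ℕ} {f : α → List Bool} (hf : Computable f)
    (hk : Computable k) (hs : Computable s) (hn : Computable n) (ha : Computable a) :
    Computable (fun x => cand (k x) (f x) (s x) (n x) (a x)) := by
  simp only [cand]; fun_prop


@[fun_prop]
theorem cComb0 {α : Type} [Primcodable α] {k s lev g st n a : α → ℕ} {f τ : α → List Bool}
    {rs : α → List GRec} {acc : α → List GFrame} (hk : Computable k) (hs : Computable s)
    (hl : Computable lev) (hg : Computable g) (hst : Computable st) (hn : Computable n)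
    (ha : Computable a) (hf : Computable f) (hτ : Computable τ) (hrs : Computable rs)
    (hacc : Computable acc) : Computable (fun x => comb0 (k x) (s x) (lev x) (g x) (st x) (n x)
      (a x) (f x) (τ x) (rs x) (acc x)) := by
  simp only [comb0]; fun_prop
@[fun_prop]
theorem cComb {α : Type} [Primcodable α] {k s : α → ℕ} {f : α → List Bool}
    {fr : α → GFrame} {acc : α → List GFrame} (hk : Computable k) (hs : Computable s)
    (hf : Computable f) (hfr : Computable fr) 
    (hacc : Computable acc) : Computable (fun x => comb (k x) (s x) (f x) (fr x) (acc x)) := by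
  simp only [comb]; fun_prop
@[fun_prop]
theorem cGstep {α : Type} [Primcodable α] {k s : α → ℕ} {f : α → List Bool}
    {acc : α → List GFrame} (hk : Computable k) (hs : Computable s)
    (hf : Computable f) 
    (hacc : Computable acc) : Computable (fun x => gstep (k x) (s x) (f x) (acc x)) := by
  simp only [gstep]; fun_prop
@[fun_prop]
theorem cGinv {α : Type} [Primcodable α] {s : α → ℕ} 
    {acc : α → List GFrame} (hs : Computable s)
    (hacc : Computable acc) : Computable (fun x => ginv (acc x) (s x)) := by
  simp only [ginv]; fun_prop
theorem cGrun {κ : ℕ} {β : ℕ → List Bool} (hβ : Computable β) (lev g s0 : ℕ) :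
    Computable (grun κ β lev g s0) := by
  have : grun κ β lev g s0 = fun s => Nat.rec (motive := fun _ => List GFrame) [ginit κ lev g s0]
     (fun s r => if s + 1 ≤ s0 then [ginit κ lev g s0] else gstep κ (s+1) (β (s+1)) r) s := by
    funext s
    induction s with
    | zero => rfl
    | succ s ih => simp only [grun, ih]
  rw [this]
  fun_prop
end Game

end

section
open MeasureTheory ENNReal

section GameInv

theorem comb_active (κ s i g s0 n a : ℕ) (β τ : List Bool) (rs : List GRec) (acc : List GFrame) :
    comb κ s β (i+1, g, s0, n, a, τ, rs, false) acc =
      if 2 ^ n ≤ dsum n (upd β rs) then [(i+1, g, s0, n, a, τ, upd β rs, true)] else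
        comb0 κ s (i+1) g s0 n a β τ (upd β rs) acc := by
  simp [comb]

theorem comb_fin (κ s i g s0 n a : ℕ) (β τ : List Bool) (rs : List GRec) (acc : List GFrame) :
    comb κ s β (i+1, g, s0, n, a, τ, rs, true) acc = [(i+1, g, s0, n, a, τ, rs, true)] := by
  simp [comb]

theorem grun_le {κ : ℕ} {β : ℕ → List Bool} {lev g s0 s : ℕ} (h : s ≤ s0) :
    grun κ β lev g s0 s = [ginit κ lev g s0] := by
  cases s with
  | zero => rfl
  | succ s => simp [grun, h]

theorem grun_succ {κ : ℕ} {β : ℕ → List Bool} {lev g s0 s : ℕ} (h : s0 ≤ s) :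
    grun κ β lev g s0 (s+1) = gstep κ (s+1) (β (s+1)) (grun κ β lev g s0 s) := by
  rw [grun, if_neg (by omega)]

/-- number of different values of `β t ↾ u` for `u < t ≤ s` -/
def cc (β : ℕ → List Bool) (s u : ℕ) : ℕ := ((Finset.Ioc u s).image fun t => (β t).take u).card

theorem cc_mono {β : ℕ → List Bool} {s s' u : ℕ} (h : s ≤ s') : cc β s u ≤ cc β s' u :=
  Finset.card_le_card (Finset.image_subset_image (Finset.Ioc_subset_Ioc_right h))

theorem cc_new {β : ℕ → List Bool} {τ : List Bool} {t0 t1 s u t : ℕ} (hτ : τ.length ≤ u)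
    (h0 : t0 ≤ u) (hag : ∀ t, t0 ≤ t → t ≤ t1 → (β t).take τ.length = τ) (ht : t1 < t) (hu : u ≤ t1)
    (hts : t ≤ s) (hne : (β t).take τ.length ≠ τ) : cc β t1 u + 1 ≤ cc β s u := by
  unfold cc
  rw [← Finset.card_insert_of_notMem (a := (β t).take u)]
  · apply Finset.card_le_card
    intro x hx
    rw [Finset.mem_insert] at hx
    rcases hx with rfl | hx
    · exact Finset.mem_image_of_mem _ (Finset.mem_Ioc.2 ⟨by omega, hts⟩)
    · exact Finset.image_subset_image (Finset.Ioc_subset_Ioc_right (by omega)) hx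
  · intro hx
    obtain ⟨t', ht', he⟩ := Finset.mem_image.1 hx
    rw [Finset.mem_Ioc] at ht'
    apply hne
    have := congrArg (List.take τ.length) he
    simp only [List.take_take, min_eq_left hτ] at this
    rw [← this]
    exact hag t' (by omega) ht'.2

/-- invested weight -/
noncomputable def gW (κ : ℕ) (β : ℕ → List Bool) (lev g s0 u : ℕ) : ℝ :=
  (ginv (grun κ β lev g s0 u) u).elim 0 fun g => (1/2) ^ g

theorem gW_nonneg (κ : ℕ) (β : ℕ → List Bool) (lev g s0 u : ℕ) : 0 ≤ gW κ β lev g s0 u := by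
  unfold gW
  cases ginv (grun κ β lev g s0 u) u <;> simp

theorem ginv_single {i g s0 n a u : ℕ} {τ : List Bool} {rs : List GRec} {b : Bool} :
    ginv [(i+1, g, s0, n, a, τ, rs, b)] u = none := by simp [ginv]

theorem ginv_cons {fr : GFrame} {st : List GFrame} (h : st ≠ []) (u : ℕ) :
    ginv (fr :: st) u = ginv st u := by
  have : (fr :: st).reverse.head? = st.reverse.head? := by
    rw [List.reverse_cons, List.head?_append_of_ne_nil]
    simpa using h
  simp only [ginv, this]

/-- capture -/
def Capt (κ : ℕ) (τ : List Bool) (m a : ℕ) : Prop :=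
  ∀ Y : ℕ → Bool, num (strPrefix Y (m+2)) = a → univ κ τ (strPrefix Y τ.length) = true

structure RecOK (κ : ℕ) (β : ℕ → List Bool) (W : ℕ → ℝ) (i g s0 s n a : ℕ) (x : GRec) : Prop where
  m_le : x.2.1 ≤ n
  len : x.1.length ≤ x.2.2.2.1
  agree : ∀ t, x.2.2.2.1 ≤ t → t ≤ x.2.2.2.2.1 → (β t).take x.1.length = x.1
  live : x.2.2.2.2.2 = false → ∀ t, x.2.2.2.1 ≤ t → t ≤ s → (β t).take x.1.length = x.1
  dead : x.2.2.2.2.2 = true → ∃ t, x.2.2.2.2.1 < t ∧ t ≤ s ∧ (β t).take x.1.length ≠ x.1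
  cap : Capt κ x.1 x.2.1 x.2.2.1
  val : (1/2 : ℝ) ^ (g + x.2.1) ≤ ∑ u ∈ Finset.Ico x.2.2.2.1 x.2.2.2.2.1,
    if i + 1 ≤ cc β x.2.2.2.2.1 u then W u else 0
  h0 : s0 ≤ x.2.2.2.1
  h1 : x.2.2.2.1 ≤ x.2.2.2.2.1
  h2 : x.2.2.2.2.1 ≤ s
  pos : (x.2.2.1 + 1) * 2 ^ n ≤ a * 2 ^ x.2.1

def RecR (x y : GRec) : Prop :=
  x.2.2.2.2.1 ≤ y.2.2.2.1 ∧ (x.2.2.1 + 1) * 2 ^ y.2.1 ≤ y.2.2.1 * 2 ^ x.2.1 ∧ x.2.1 ≤ y.2.1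

structure Core (κ : ℕ) (β : ℕ → List Bool) (W : ℕ → ℝ) (i g s0 s n a : ℕ) (rs : List GRec) : Prop where
  kn : κ ≤ n
  ok : ∀ x ∈ rs, RecOK κ β W i g s0 s n a x
  pw : rs.Pairwise RecR
  sum : (rs.map fun x => (1/2 : ℝ) ^ x.2.1).sum = a * (1/2) ^ n
  bd : a * (1/2 : ℝ) ^ n ≤ 1 + 5 * (1/2) ^ κ

/-- moving to the next stage -/
theorem Core.next {κ : ℕ} {β : ℕ → List Bool} {W : ℕ → ℝ} {i g s0 s n a : ℕ} {rs : List GRec}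
    (h : Core κ β W i g s0 s n a rs) : Core κ β W i g s0 (s+1) n a (upd (β (s+1)) rs) := by
  refine ⟨h.kn, ?_, ?_, ?_, h.bd⟩
  · intro x hx
    simp only [upd, List.mem_map] at hx
    obtain ⟨y, hy, rfl⟩ := hx
    have := h.ok y hy
    refine ⟨this.m_le, this.len, this.agree, ?_, ?_, this.cap, this.val, this.h0, this.h1, ?_, this.pos⟩
    · intro hd t ht1 ht2
      simp only [Bool.or_eq_false_iff, decide_eq_false_iff_not, not_not] at hd
      rcases Nat.lt_or_ge s t with h' | h'
      · rw [show t = s + 1 by omega]; exact hd.2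
      · exact this.live hd.1 t ht1 h'
    · intro hd
      simp only [Bool.or_eq_true, decide_eq_true_eq] at hd
      rcases hd with hd | hd
      · obtain ⟨t, h1, h2, h3⟩ := this.dead hd
        exact ⟨t, h1, by omega, h3⟩
      · exact ⟨s+1, by have := this.h2; simp only; omega, le_rfl, hd⟩
    · have := this.h2; simp only; omega
  · simp only [upd, List.pairwise_map]
    exact h.pw.imp fun h => h
  · rw [← h.sum]
    simp only [upd, List.map_map]
    rfl

/-- changing the exponent -/
theorem Core.scale {κ : ℕ} {β : ℕ → List Bool} {W : ℕ → ℝ} {i g s0 s n a : ℕ} {rs : List GRec}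
    (h : Core κ β W i g s0 s n a rs) (d : ℕ) : Core κ β W i g s0 s (n+d) (a * 2 ^ d) rs := by
  have e : ((a * 2 ^ d : ℕ) : ℝ) * (1/2) ^ (n+d) = a * (1/2) ^ n := by
    push_cast
    rw [pow_add, one_div, inv_pow, inv_pow]
    field_simp
  refine ⟨h.kn.trans (by omega), ?_, h.pw, ?_, ?_⟩
  · intro x hx
    have := h.ok x hx
    refine ⟨this.m_le.trans (by omega), this.len, this.agree, this.live, this.dead, this.cap, this.val,
      this.h0, this.h1, this.h2, ?_⟩
    have := this.pos
    rw [pow_add]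
    nlinarith [Nat.pos_of_ne_zero (pow_ne_zero d (two_ne_zero (α := ℕ)))]
  · rw [e, h.sum]
  · rw [e]; exact h.bd

theorem mu_num {n a : ℕ} (h : a < 2 ^ n) : μCantor {Y | num (strPrefix Y n) = a} = 2⁻¹ ^ n := by
  obtain ⟨σ, hσ, hn⟩ := exists_num h
  have : {Y | num (strPrefix Y n) = a} = cylinder σ := by
    ext Y
    rw [mem_cyl, Set.mem_ofPred_eq, hσ]
    constructor
    · intro h'
      exact num_inj (by simp [sp_length, hσ]) (by rw [h', hn])
    · intro h'; rw [h', hn]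
  rw [this, mu_cyl, hσ]

theorem list_disj_sum {α : Type} {l : List α} {S : α → Set (ℕ → Bool)} {U : Set (ℕ → Bool)}
    (hm : ∀ x, MeasurableSet (S x)) (hp : l.Pairwise fun x y => Disjoint (S x) (S y))
    (hU : ∀ x ∈ l, S x ⊆ U) : (l.map fun x => μCantor (S x)).sum ≤ μCantor U := by
  have : ∀ l : List α, l.Pairwise (fun x y => Disjoint (S x) (S y)) →
      (l.map fun x => μCantor (S x)).sum = μCantor (⋃ x ∈ l, S x) := by
    intro l
    induction l with
    | nil => simp
    | cons x l ih =>
      intro h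
      rw [List.pairwise_cons] at h
      rw [List.map_cons, List.sum_cons, ih h.2]
      have : (⋃ y ∈ x :: l, S y) = S x ∪ ⋃ y ∈ l, S y := by
        ext Y; simp
      rw [this, measure_union']
      · rw [Set.disjoint_iUnion₂_right]; exact h.1
      · exact hm x
  rw [this l hp]
  exact measure_mono (Set.iUnion₂_subset hU)

theorem Core.pending {κ : ℕ} {β : ℕ → List Bool} {W : ℕ → ℝ} {i g s0 s n a : ℕ} {rs : List GRec}
    (hβ : ∀ s, (β s).length = s) (hκ : 3 ≤ κ)
    (h : Core κ β W i g s0 s n a rs) :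
    ((rs.filter fun x => !x.2.2.2.2.2).map fun x => (1/2 : ℝ) ^ x.2.1).sum ≤ 4 * (1/2) ^ κ := by
  set l := rs.filter fun x => !x.2.2.2.2.2 with hl
  set A : ℕ → Bool := fun j => (β s).getD j false
  set S : GRec → Set (ℕ → Bool) := fun x => {Y | num (strPrefix Y (x.2.1+2)) = x.2.2.1}
  have hall : ∀ x ∈ l, RecOK κ β W i g s0 s n a x ∧ x.2.2.2.2.2 = false := by
    intro x hx
    rw [hl, List.mem_filter] at hx
    exact ⟨h.ok x hx.1, by simpa using hx.2⟩
  have hA : ∀ m ≤ s, strPrefix A m = (β s).take m := by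
    intro m hm
    apply List.ext_getElem
    · simp [sp_length, hβ, hm]
    · intro j h1 h2
      simp only [sp_getElem, List.getElem_take, A]
      rw [List.getD_eq_getElem _ _ (by simp [sp_length] at h1; rw [hβ]; omega)]
  have key := list_disj_sum (l := l) (S := S)
    (U := {Y | ∃ L, univ κ (strPrefix A L) (strPrefix Y L) = true})
    (fun x => measurableSet_sp (fun σ => num σ = x.2.2.1) _) ?_ ?_
  · have h2 := key.trans (mu_univ κ A)
    have h3 : (l.map fun x => μCantor (S x)) = l.map fun x => ENNReal.ofReal ((1/2 : ℝ) ^ x.2.1 * (1/4)) := by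
      apply List.map_congr_left
      intro x hx
      have ok := (hall x hx).1
      rw [show S x = {Y | num (strPrefix Y (x.2.1+2)) = x.2.2.1} from rfl, mu_num]
      · rw [show (1/2 : ℝ) ^ x.2.1 * (1/4) = (2⁻¹) ^ (x.2.1 + 2) by rw [pow_add]; norm_num,
          ENNReal.ofReal_pow (by norm_num), ENNReal.ofReal_inv_of_pos (by norm_num)]
        norm_num
      · have b1 := ok.pos
        have b2 := h.bd
        have b3 : (1/2 : ℝ) ^ κ ≤ (1/2) ^ 3 := pow_le_pow_of_le_one (by norm_num) (by norm_num) hκ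
        have b4 : (a : ℝ) < 4 * 2 ^ n := by
          rw [one_div, inv_pow, ← div_eq_mul_inv, div_le_iff₀ (by positivity)] at b2
          rw [one_div] at b3
          have : (0 : ℝ) < 2 ^ n := by positivity
          norm_num at b2 b3
          nlinarith
        have b5 : a < 4 * 2 ^ n := by exact_mod_cast b4
        have b6 : (x.2.2.1 + 1) * 2 ^ n < (2 ^ (x.2.1 + 2)) * 2 ^ n := by
          calc _ ≤ _ := b1
            _ < (4 * 2 ^ n) * 2 ^ x.2.1 := by
              apply Nat.mul_lt_mul_of_pos_right b5; positivity
            _ = _ := by ring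
        have := Nat.lt_of_mul_lt_mul_right b6
        omega
    rw [h3] at h2
    have h4 : (l.map fun x => ENNReal.ofReal ((1/2 : ℝ) ^ x.2.1 * (1/4))).sum =
        ENNReal.ofReal ((l.map fun x => (1/2 : ℝ) ^ x.2.1).sum * (1/4)) := by
      clear_value l
      clear h3 h2 key hall hl
      induction l with
      | nil => simp
      | cons x l ih =>
        simp only [List.map_cons, List.sum_cons]
        rw [ih, ← ENNReal.ofReal_add (by positivity), add_mul]
        have : 0 ≤ (l.map fun x => (1/2 : ℝ) ^ x.2.1).sum :=
          List.sum_nonneg (by intro y hy; rw [List.mem_map] at hy; obtain ⟨z, _, rfl⟩ := hy; positivity)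
        positivity
    rw [h4, show (2⁻¹ : ℝ≥0∞) ^ κ = ENNReal.ofReal ((1/2) ^ κ) by
      rw [one_div, ENNReal.ofReal_pow (by norm_num), ENNReal.ofReal_inv_of_pos (by norm_num)]; norm_num,
      ENNReal.ofReal_le_ofReal_iff (by positivity)] at h2
    linarith
  · have : l.Pairwise RecR := h.pw.sublist (List.filter_sublist)
    refine this.imp ?_
    rintro x y ⟨-, h1, h2⟩
    rw [Set.disjoint_left]
    intro Y (hx : _ = _) (hy : _ = _)
    have e := num_take (strPrefix Y (y.2.1 + 2)) (x.2.1+2) (by rw [sp_length]; omega)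
    rw [sp_take, min_eq_left (by omega), hx, hy, sp_length,
      show y.2.1 + 2 - (x.2.1 + 2) = y.2.1 - x.2.1 by omega] at e
    have : y.2.2.1 < (x.2.2.1 + 1) * 2 ^ (y.2.1 - x.2.1) := by
      rw [e, ← Nat.div_lt_iff_lt_mul (by positivity)]; omega
    have h4 : 2 ^ y.2.1 = 2 ^ (y.2.1 - x.2.1) * 2 ^ x.2.1 := by rw [← pow_add]; congr 1; omega
    rw [h4, ← mul_assoc] at h1
    have := Nat.le_of_mul_le_mul_right h1 (by positivity)
    omega
  · intro x hx Y (hY : _ = _)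
    obtain ⟨ok, hd⟩ := hall x hx
    refine ⟨x.1.length, ?_⟩
    have := ok.len; have := ok.h1; have := ok.h2
    rw [hA _ (by omega), ok.live hd s (by omega) le_rfl]
    exact ok.cap Y hY

theorem dsum_eq {n : ℕ} {rs : List GRec} (h : ∀ x ∈ rs, x.2.1 ≤ n) :
    (dsum n rs : ℝ) * (1/2) ^ n = ((rs.filter fun x => x.2.2.2.2.2).map fun x => (1/2 : ℝ) ^ x.2.1).sum := by
  have : ∀ l : List GRec, (∀ x ∈ l, x.2.1 ≤ n) → (((l.map fun x => 2 ^ (n - x.2.1)).sum : ℕ) : ℝ) * (1/2) ^ n =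
      (l.map fun x => (1/2 : ℝ) ^ x.2.1).sum := by
    intro l
    induction l with
    | nil => simp
    | cons x l ih =>
      intro h
      simp only [List.map_cons, List.sum_cons]
      rw [Nat.cast_add, add_mul, ih fun y hy => h y (List.mem_cons_of_mem _ hy)]
      congr 1
      have := h x List.mem_cons_self
      push_cast
      rw [show (1/2 : ℝ) ^ n = (1/2) ^ (n - x.2.1) * (1/2) ^ x.2.1 by rw [← pow_add]; congr 1; omega,
        ← mul_assoc, ← mul_pow]
      norm_num
  exact this _ fun x hx => h x (List.mem_filter.1 hx).1

theorem filter_split (rs : List GRec) (f : GRec → ℝ) : (rs.map f).sum =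
    ((rs.filter fun x => x.2.2.2.2.2).map f).sum + ((rs.filter fun x => !x.2.2.2.2.2).map f).sum := by
  induction rs with
  | nil => simp
  | cons x l ih =>
    rw [List.map_cons, List.sum_cons, ih]
    cases hx : x.2.2.2.2.2 <;> simp [hx] <;> ring

theorem Core.room {κ : ℕ} {β : ℕ → List Bool} {W : ℕ → ℝ} {i g s0 s n a : ℕ} {rs : List GRec}
    (hβ : ∀ s, (β s).length = s) (hκ : 3 ≤ κ)
    (h : Core κ β W i g s0 s n a rs) (hd : ¬ 2 ^ n ≤ dsum n rs) :
    ((a + 1 : ℕ) : ℝ) * (1/2 : ℝ) ^ n ≤ 1 + 5 * (1/2) ^ κ := by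
  have h1 := h.pending hβ hκ
  have h2 := dsum_eq (n := n) (rs := rs) fun x hx => (h.ok x hx).m_le
  have h3 := filter_split rs fun x => (1/2 : ℝ) ^ x.2.1
  rw [h.sum] at h3
  have h4 : (dsum n rs : ℝ) * (1/2) ^ n ≤ 1 := by
    have : (dsum n rs : ℝ) ≤ 2 ^ n := by push Not at hd; exact_mod_cast hd.le
    rw [one_div, inv_pow, ← div_eq_mul_inv, div_le_iff₀ (by positivity)]; linarith
  have h5 : (1/2 : ℝ) ^ n ≤ (1/2) ^ κ := pow_le_pow_of_le_one (by norm_num) (by norm_num) h.kn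
  push_cast
  nlinarith

theorem list_ico_sum {l : List GRec} {s0 s : ℕ} {f : ℕ → ℝ} (hf : ∀ u, 0 ≤ f u)
    (hp : l.Pairwise fun x y => x.2.2.2.2.1 ≤ y.2.2.2.1)
    (hx : ∀ x ∈ l, s0 ≤ x.2.2.2.1 ∧ x.2.2.2.1 ≤ x.2.2.2.2.1 ∧ x.2.2.2.2.1 ≤ s) :
    (l.map fun x => ∑ u ∈ Finset.Ico x.2.2.2.1 x.2.2.2.2.1, f u).sum ≤ ∑ u ∈ Finset.Ico s0 s, f u := by
  induction l generalizing s0 with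
  | nil => simpa using Finset.sum_nonneg fun u _ => hf u
  | cons x l ih =>
    rw [List.pairwise_cons] at hp
    obtain ⟨h1, h2, h3⟩ := hx x List.mem_cons_self
    rw [List.map_cons, List.sum_cons]
    have := ih (s0 := x.2.2.2.2.1) hp.2 fun y hy =>
      ⟨hp.1 y hy, (hx y (List.mem_cons_of_mem _ hy)).2⟩
    rw [← Finset.sum_Ico_consecutive f (h1.trans h2) h3]
    gcongr
    · intros; exact hf _

theorem Core.finish {κ : ℕ} {β : ℕ → List Bool} {W : ℕ → ℝ} {i g s0 s n a : ℕ} {rs : List GRec}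
    (hW : ∀ u, 0 ≤ W u)
    (h : Core κ β W i g s0 s n a rs) (hd : 2 ^ n ≤ dsum n rs) :
    (1/2 : ℝ) ^ g ≤ ∑ u ∈ Finset.Ico s0 s, if i + 2 ≤ cc β s u then W u else 0 := by
  have h2 := dsum_eq (n := n) (rs := rs) fun x hx => (h.ok x hx).m_le
  set l := rs.filter fun x => x.2.2.2.2.2 with hl
  have hall : ∀ x ∈ l, RecOK κ β W i g s0 s n a x ∧ x.2.2.2.2.2 = true := by
    intro x hx
    rw [hl, List.mem_filter] at hx
    exact ⟨h.ok x hx.1, hx.2⟩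
  have h3 : 1 ≤ (dsum n rs : ℝ) * (1/2) ^ n := by
    have : (2 : ℝ) ^ n ≤ dsum n rs := by exact_mod_cast hd
    rw [one_div, inv_pow, ← div_eq_mul_inv, le_div_iff₀ (by positivity)]; linarith
  rw [h2] at h3
  have h4 := list_ico_sum (l := l) (s0 := s0) (s := s) (f := fun u => if i + 2 ≤ cc β s u then W u else 0)
    (fun u => by split_ifs; exact hW u; exact le_rfl)
    ((h.pw.sublist List.filter_sublist).imp fun h => h.1)
    (fun x hx => ⟨(hall x hx).1.h0, (hall x hx).1.h1, (hall x hx).1.h2⟩)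
  refine le_trans ?_ h4
  calc (1/2 : ℝ) ^ g ≤ (1/2) ^ g * (l.map fun x => (1/2 : ℝ) ^ x.2.1).sum := by
        apply le_mul_of_one_le_right (by positivity) h3
    _ = (l.map fun x => (1/2 : ℝ) ^ (g + x.2.1)).sum := by
        rw [← List.sum_map_mul_left]; simp only [pow_add]
    _ ≤ _ := by
      apply List.sum_le_sum
      intro x hx
      obtain ⟨ok, hd⟩ := hall x hx
      refine ok.val.trans (Finset.sum_le_sum fun u hu => ?_)
      rw [Finset.mem_Ico] at hu
      obtain ⟨t, ht1, ht2, ht3⟩ := ok.dead hd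
      have := cc_new (ok.len.trans hu.1) hu.1 ok.agree ht1 hu.2.le ht2 ht3
      split_ifs
      · exact le_rfl
      · omega
      · exact hW u
      · exact le_rfl

theorem capt_of_cand {κ s n a ℓ : ℕ} {β : List Bool} (hβ : β.length = s) (h : cand κ β s n a = some ℓ) :
    ℓ ≤ s ∧ Capt κ (β.take ℓ) (max n ℓ) (a * 2 ^ (max n ℓ - n)) := by
  unfold cand at h
  have h1 := List.mem_of_find?_eq_some h
  have h2 := List.find?_some h
  rw [List.mem_range] at h1
  rw [List.any_eq_true] at h2
  obtain ⟨ρ, hρ, h3⟩ := h2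
  rw [mem_strs] at hρ
  simp only [Bool.and_eq_true, decide_eq_true_eq] at h3
  refine ⟨by omega, ?_⟩
  intro Y hY
  have hl : (β.take ℓ).length = ℓ := by simp; omega
  rw [hl]
  have : strPrefix Y ℓ = ρ := by
    apply num_inj (by rw [sp_length, hρ])
    have e := num_take (strPrefix Y (max n ℓ + 2)) ℓ (by rw [sp_length]; omega)
    rw [sp_take, min_eq_left (by omega), hY, sp_length] at e
    rw [e, h3.1]
    have e1 : 2 ^ (n+2) * 2 ^ (max n ℓ - n) = 2 ^ ℓ * 2 ^ (max n ℓ + 2 - ℓ) := by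
      rw [← pow_add, ← pow_add]; congr 1; omega
    rw [← Nat.mul_div_mul_left (a * 2 ^ (max n ℓ - n)) (2 ^ (max n ℓ + 2 - ℓ)) (show 0 < 2 ^ ℓ by positivity),
      ← e1, ← Nat.mul_div_mul_right (a * 2 ^ ℓ) (2 ^ (n+2)) (show 0 < 2 ^ (max n ℓ - n) by positivity)]
    congr 1; ring
  rw [this]; exact h3.2

end GameInv

end

section
open MeasureTheory ENNReal

section GameInv2

theorem idle_step {κ : ℕ} {β : ℕ → List Bool} {i g s0 s n a : ℕ} {τ : List Bool} {rs : List GRec}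
    (h : s0 ≤ s) (st : grun κ β (i+1) g s0 s = [(i+1, g, s0, n, a, τ, rs, false)]) :
    grun κ β (i+1) g s0 (s+1) = if 2 ^ n ≤ dsum n (upd (β (s+1)) rs) then
        [(i+1, g, s0, n, a, τ, upd (β (s+1)) rs, true)] else
      (cand κ (β (s+1)) (s+1) n a).elim [(i+1, g, s0, n, a, τ, upd (β (s+1)) rs, false)] fun ℓ =>
        (i+1, g, s0, max n ℓ, a * 2 ^ (max n ℓ - n), (β (s+1)).take ℓ, upd (β (s+1)) rs, false) ::
          grun κ β i (g + max n ℓ) (s+1) (s+1) := by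
  rw [grun_succ h, st, gstep_cons, gstep_nil, comb_active]
  congr 1
  simp only [comb0, List.head?_nil, Option.elim_none]
  congr 1
  funext ℓ
  rw [grun_le le_rfl]; rfl

theorem act_step {κ : ℕ} {β : ℕ → List Bool} {i g s0 s n a t0 : ℕ} {τ : List Bool} {rs : List GRec}
    (h : s0 ≤ s) (h' : t0 ≤ s)
    (st : grun κ β (i+1) g s0 s = (i+1, g, s0, n, a, τ, rs, false) :: grun κ β i (g+n) t0 s)
    {g' n' a' : ℕ} {τ' : List Bool} {rs' : List GRec} {b : Bool} {tl : List GFrame}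
    (ch : grun κ β i (g+n) t0 (s+1) = (i, g', t0, n', a', τ', rs', b) :: tl) :
    grun κ β (i+1) g s0 (s+1) = if 2 ^ n ≤ dsum n (upd (β (s+1)) rs) then
        [(i+1, g, s0, n, a, τ, upd (β (s+1)) rs, true)] else
      if (β (s+1)).take τ.length ≠ τ then [(i+1, g, s0, n+1, 2*a, τ, upd (β (s+1)) rs, false)]
      else if b = true then
        [(i+1, g, s0, n, a+1, τ, upd (β (s+1)) rs ++ [(τ, n, a, t0, s+1, false)], false)]
      else (i+1, g, s0, n, a, τ, upd (β (s+1)) rs, false) :: grun κ β i (g+n) t0 (s+1) := by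
  rw [grun_succ h, st, gstep_cons, comb_active, ← grun_succ h', ch]
  congr 1

noncomputable def Cc (κ i : ℕ) : ℝ := 1 + 14 * i * (1/2) ^ κ

theorem Cc_pos (κ i : ℕ) : 0 < Cc κ i := by unfold Cc; positivity

theorem Cc_step {κ i : ℕ} (h : 14 * (i : ℝ) * (1/2) ^ κ ≤ 1) :
    Cc κ i * (1 + 7 * (1/2) ^ κ) ≤ Cc κ (i+1) := by
  unfold Cc
  push_cast
  have : (0 : ℝ) < (1/2) ^ κ := by positivity
  nlinarith

/-- the promise of a run at level `i` -/
def GP (κ : ℕ) (β : ℕ → List Bool) (i : ℕ) : Prop := ∀ g s0 s, s0 ≤ s → ∃ n a τ rs b tl,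
  grun κ β i g s0 s = (i, g, s0, n, a, τ, rs, b) :: tl ∧
  (b = true → tl = [] ∧ (1/2 : ℝ) ^ g ≤ ∑ u ∈ Finset.Ico s0 s,
    if i + 1 ≤ cc β s u then gW κ β i g s0 u else 0) ∧
  ∑ u ∈ Finset.Ico s0 (s+1), gW κ β i g s0 u ≤ Cc κ i * (1/2) ^ g

inductive GInv (κ : ℕ) (β : ℕ → List Bool) (i g s0 s : ℕ) : Prop
  | idle (n a : ℕ) (τ : List Bool) (rs : List GRec)
    (st : grun κ β (i+1) g s0 s = [(i+1, g, s0, n, a, τ, rs, false)])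
    (core : Core κ β (gW κ β (i+1) g s0) i g s0 s n a rs)
    (acc : ∑ u ∈ Finset.Ico s0 (s+1), gW κ β (i+1) g s0 u ≤
      Cc κ i * (1/2) ^ g * (a * (1/2) ^ n + 2 * (1/2) ^ κ - 2 * (1/2) ^ n))
  | act (n a : ℕ) (τ : List Bool) (rs : List GRec) (t0 : ℕ)
    (st : grun κ β (i+1) g s0 s = (i+1, g, s0, n, a, τ, rs, false) :: grun κ β i (g+n) t0 s)
    (h0 : s0 ≤ t0) (h1 : t0 ≤ s) (len : τ.length ≤ t0) (len' : τ.length ≤ n) (cap : Capt κ τ n a)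
    (ag : ∀ t, t0 ≤ t → t ≤ s → (β t).take τ.length = τ)
    (hW : ∀ u, t0 ≤ u → u ≤ s → gW κ β (i+1) g s0 u = gW κ β i (g+n) t0 u)
    (t1s : ∀ x ∈ rs, x.2.2.2.2.1 ≤ t0)
    (core : Core κ β (gW κ β (i+1) g s0) i g s0 s n a rs)
    (acc : ∑ u ∈ Finset.Ico s0 t0, gW κ β (i+1) g s0 u ≤
      Cc κ i * (1/2) ^ g * (a * (1/2) ^ n + 2 * (1/2) ^ κ - 2 * (1/2) ^ n))
  | fin (n a : ℕ) (τ : List Bool) (rs : List GRec)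
    (st : grun κ β (i+1) g s0 s = [(i+1, g, s0, n, a, τ, rs, true)])
    (val : (1/2 : ℝ) ^ g ≤ ∑ u ∈ Finset.Ico s0 s,
      if i + 2 ≤ cc β s u then gW κ β (i+1) g s0 u else 0)
    (acc : ∑ u ∈ Finset.Ico s0 (s+1), gW κ β (i+1) g s0 u ≤ Cc κ (i+1) * (1/2) ^ g)

theorem gW_single {κ : ℕ} {β : ℕ → List Bool} {i g s0 s n a : ℕ} {τ : List Bool} {rs : List GRec} {b : Bool}
    {x y z : ℕ}
    (st : grun κ β (i+1) g s0 s = [(x+1, y, z, n, a, τ, rs, b)]) : gW κ β (i+1) g s0 s = 0 := by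
  simp [gW, st, ginv_single]

theorem finC {κ i : ℕ} (h : 14 * (i : ℝ) * (1/2) ^ κ ≤ 1) {x y : ℝ} (hx : 0 ≤ x)
    (hy : y ≤ 1 + 7 * (1/2) ^ κ) : Cc κ i * x * y ≤ Cc κ (i+1) * x := by
  have := Cc_step h
  have := Cc_pos κ i
  calc Cc κ i * x * y ≤ Cc κ i * x * (1 + 7 * (1/2) ^ κ) := by gcongr
    _ = Cc κ i * (1 + 7 * (1/2) ^ κ) * x := by ring
    _ ≤ _ := by gcongr

theorem scale_real (a n d : ℕ) : ((a * 2 ^ d : ℕ) : ℝ) * (1/2) ^ (n+d) = a * (1/2) ^ n := by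
  push_cast
  rw [pow_add, one_div, inv_pow, inv_pow]
  field_simp

theorem ginv_next {κ : ℕ} {β : ℕ → List Bool} {i g s0 s : ℕ} (hβ : ∀ s, (β s).length = s) (hκ : 3 ≤ κ)
    (hi : 14 * (i : ℝ) * (1/2) ^ κ ≤ 1) (ih : GP κ β i) (hs : s0 ≤ s)
    (h : GInv κ β i g s0 s) : GInv κ β i g s0 (s+1) := by
  have hW0 := fun u => gW_nonneg κ β (i+1) g s0 u
  have hC := Cc_pos κ i
  have hg : (0 : ℝ) < (1/2) ^ g := by positivity
  cases h with
  | idle n a τ rs st core acc =>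
    have e := idle_step hs st
    have hn : (0 : ℝ) < (1/2) ^ n := by positivity
    split_ifs at e with hd
    · refine .fin _ _ _ _ e (core.next.finish hW0 hd) ?_
      rw [Finset.sum_Ico_succ_top (by omega), gW_single e, add_zero]
      refine acc.trans (finC hi hg.le ?_)
      have := core.bd
      linarith
    · cases hc : cand κ (β (s+1)) (s+1) n a with
      | none =>
        rw [hc, Option.elim_none] at e
        refine .idle _ _ _ _ e core.next ?_
        rw [Finset.sum_Ico_succ_top (by omega), gW_single e, add_zero]
        exact acc
      | some ℓ =>
        rw [hc, Option.elim_some] at e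
        obtain ⟨h1, h2⟩ := capt_of_cand (hβ _) hc
        have hl : ((β (s+1)).take ℓ).length = ℓ := by simp [hβ]; omega
        have ex : max n ℓ = n + (max n ℓ - n) := by omega
        refine .act _ _ _ _ (s+1) e (by omega) le_rfl (by omega) (by omega) h2 ?_ ?_ ?_ ?_ ?_
        · intro t ht1 ht2
          rw [show t = s + 1 by omega, hl]
        · intro u hu1 hu2
          obtain rfl : u = s + 1 := by omega
          rw [gW, gW, e, ginv_cons]
          rw [grun_le le_rfl]; simp
        · intro x hx
          exact (core.next.ok x hx).h2
        · have := core.next.scale (max n ℓ - n)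
          rwa [← ex] at this
        · refine acc.trans ?_
          have e2 := scale_real a n (max n ℓ - n)
          rw [← ex] at e2
          rw [e2]
          have : (1/2 : ℝ) ^ (max n ℓ) ≤ (1/2) ^ n :=
            pow_le_pow_of_le_one (by norm_num) (by norm_num) (by omega)
          gcongr
  | act n a τ rs t0 st h0 h1 len len' cap ag hW t1s core acc =>
    obtain ⟨n', a', τ', rs', b, tl, hch, hb, -⟩ := ih (g+n) t0 (s+1) (by omega)
    have bdI : ∑ u ∈ Finset.Ico t0 (s+1), gW κ β i (g+n) t0 u ≤ Cc κ i * (1/2) ^ (g+n) := by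
      obtain ⟨_, _, _, _, _, _, -, -, h⟩ := ih (g+n) t0 s h1
      exact h
    have e := act_step hs h1 st hch
    have hn : (0 : ℝ) < (1/2) ^ n := by positivity
    have tot : ∑ u ∈ Finset.Ico s0 (s+1), gW κ β (i+1) g s0 u ≤
        Cc κ i * (1/2) ^ g * (a * (1/2) ^ n + 2 * (1/2) ^ κ - (1/2) ^ n) := by
      rw [← Finset.sum_Ico_consecutive _ h0 (show t0 ≤ s + 1 by omega)]
      have : ∑ u ∈ Finset.Ico t0 (s+1), gW κ β (i+1) g s0 u ≤ Cc κ i * (1/2) ^ (g+n) := by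
        rw [Finset.sum_congr rfl fun u hu => hW u (Finset.mem_Ico.1 hu).1
          (by have := (Finset.mem_Ico.1 hu).2; omega)]
        exact bdI
      rw [pow_add] at this
      linarith
    split_ifs at e with hd hτ hb'
    · refine .fin _ _ _ _ e (core.next.finish hW0 hd) ?_
      rw [Finset.sum_Ico_succ_top (by omega), gW_single e, add_zero]
      refine tot.trans (finC hi hg.le ?_)
      have := core.bd
      linarith
    · refine .idle _ _ _ _ e ?_ ?_
      · have := core.next.scale 1
        rwa [pow_one, mul_comm a] at this
      · rw [Finset.sum_Ico_succ_top (by omega), gW_single e, add_zero]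
        refine tot.trans (le_of_eq ?_)
        have := scale_real a n 1
        rw [pow_one, mul_comm a] at this
        rw [this, pow_succ]
        ring
    · push Not at hτ
      have hz := gW_single e
      refine .idle _ _ _ _ e ?_ ?_
      · have room := core.next.room hβ hκ hd
        have cn := core.next
        have ag' : ∀ t, t0 ≤ t → t ≤ s + 1 → (β t).take τ.length = τ := by
          intro t ht1 ht2
          rcases Nat.lt_or_ge s t with h' | h'
          · rw [show t = s + 1 by omega]; exact hτ
          · exact ag t ht1 h'
        have hval : (1/2 : ℝ) ^ (g + n) ≤ ∑ u ∈ Finset.Ico t0 (s+1),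
            if i + 1 ≤ cc β (s+1) u then gW κ β (i+1) g s0 u else 0 := by
          refine (hb hb').2.trans (le_of_eq (Finset.sum_congr rfl fun u hu => ?_))
          rw [Finset.mem_Ico] at hu
          rw [hW u hu.1 (by omega)]
        refine ⟨core.kn, ?_, ?_, ?_, room⟩
        · intro x hx
          rw [List.mem_append, List.mem_singleton] at hx
          rcases hx with hx | rfl
          · have ok := cn.ok x hx
            refine ⟨ok.m_le, ok.len, ok.agree, ok.live, ok.dead, ok.cap, ok.val, ok.h0, ok.h1, ok.h2, ?_⟩
            refine ok.pos.trans (Nat.mul_le_mul_right _ (by omega))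
          · exact ⟨le_rfl, len, ag', fun _ => ag', by simp, cap, hval, h0, by simp only; omega, le_rfl, le_rfl⟩
        · rw [List.pairwise_append]
          refine ⟨cn.pw, by simp, ?_⟩
          intro x hx y hy
          rw [List.mem_singleton] at hy
          subst hy
          have ok := cn.ok x hx
          refine ⟨?_, ok.pos, ok.m_le⟩
          simp only [upd, List.mem_map] at hx
          obtain ⟨z, hz, rfl⟩ := hx
          exact t1s z hz
        · rw [List.map_append, List.sum_append, cn.sum]
          simp only [List.map_cons, List.map_nil, List.sum_cons, List.sum_nil]
          push_cast; ring
      · rw [Finset.sum_Ico_succ_top (by omega), hz, add_zero]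
        refine tot.trans (le_of_eq ?_)
        push_cast; ring
    · push Not at hτ
      refine .act _ _ _ _ t0 e h0 (by omega) len len' cap ?_ ?_ ?_ core.next acc
      · intro t ht1 ht2
        rcases Nat.lt_or_ge s t with h' | h'
        · rw [show t = s + 1 by omega]; exact hτ
        · exact ag t ht1 h'
      · intro u hu1 hu2
        rcases Nat.lt_or_ge s u with h' | h'
        · obtain rfl : u = s + 1 := by omega
          rw [gW, gW, e, ginv_cons]
          rw [hch]; simp
        · exact hW u hu1 h'
      · intro x hx
        simp only [upd, List.mem_map] at hx
        obtain ⟨z, hz, rfl⟩ := hx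
        exact t1s z hz
  | fin n a τ rs st val acc =>
    have e : grun κ β (i+1) g s0 (s+1) = [(i+1, g, s0, n, a, τ, rs, true)] := by
      rw [grun_succ hs, st, gstep_cons, comb_fin]
    refine .fin _ _ _ _ e ?_ ?_
    · rw [Finset.sum_Ico_succ_top (by omega), gW_single st]
      simp only [ite_self, add_zero]
      refine val.trans (Finset.sum_le_sum fun u hu => ?_)
      have := cc_mono (β := β) (u := u) (show s ≤ s + 1 by omega)
      split_ifs
      · exact le_rfl
      · omega
      · exact hW0 u
      · exact le_rfl
    · rw [Finset.sum_Ico_succ_top (by omega), gW_single e, add_zero]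
      exact acc

theorem ginv_all {κ : ℕ} {β : ℕ → List Bool} {i g s0 s : ℕ} (hβ : ∀ s, (β s).length = s) (hκ : 3 ≤ κ)
    (hi : 14 * (i : ℝ) * (1/2) ^ κ ≤ 1) (ih : GP κ β i) (hs : s0 ≤ s) : GInv κ β i g s0 s := by
  induction s, hs using Nat.le_induction with
  | base =>
    have e : grun κ β (i+1) g s0 s0 = [(i+1, g, s0, κ, 0, [], [], false)] := by
      rw [grun_le le_rfl]; rfl
    refine .idle _ _ _ _ e ⟨le_rfl, by simp, by simp, by simp, ?_⟩ ?_
    · simp; positivity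
    · simp [gW_single e]
  | succ s hs h => exact ginv_next hβ hκ hi ih hs h

theorem gp_zero (κ : ℕ) (β : ℕ → List Bool) : GP κ β 0 := by
  intro g s0 s hs
  have h0 : grun κ β 0 g s0 s0 = [(0, g, s0, κ, 0, [], [], false)] := by rw [grun_le le_rfl]; rfl
  have h1 : ∀ s, s0 < s → grun κ β 0 g s0 s = [(0, g, s0, κ, 0, [], [], true)] := by
    intro s hs
    induction s, hs using Nat.le_induction with
    | base => rw [grun_succ le_rfl, h0, gstep_cons]; simp [comb]
    | succ s hs ih => rw [grun_succ (by omega), ih, gstep_cons]; simp [comb]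
  have w0 : gW κ β 0 g s0 s0 = (1/2) ^ g := by simp [gW, h0, ginv]
  have w1 : ∀ s, s0 < s → gW κ β 0 g s0 s = 0 := by
    intro s hs
    have : s0 ≠ s := by omega
    simp [gW, h1 s hs, ginv, this]
  have sm : ∑ u ∈ Finset.Ico s0 (s+1), gW κ β 0 g s0 u ≤ Cc κ 0 * (1/2) ^ g := by
    rw [Finset.sum_eq_single s0]
    · simp [w0, Cc]
    · intro u hu hne
      rw [Finset.mem_Ico] at hu
      exact w1 u (by omega)
    · intro h; exact absurd (Finset.mem_Ico.2 ⟨le_rfl, by omega⟩) h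
  rcases Nat.eq_or_lt_of_le hs with rfl | hs
  · exact ⟨_, _, _, _, _, _, h0, by simp, sm⟩
  · refine ⟨_, _, _, _, _, _, h1 s hs, fun _ => ⟨rfl, ?_⟩, sm⟩
    rw [← w0]
    have : 0 + 1 ≤ cc β s s0 := by
      have : (Finset.Ioc s0 s).Nonempty := ⟨s, Finset.mem_Ioc.2 ⟨hs, le_rfl⟩⟩
      exact Finset.card_pos.2 (this.image _)
    have h3 := Finset.single_le_sum (f := fun u => if 0 + 1 ≤ cc β s u then gW κ β 0 g s0 u else 0)
      (s := Finset.Ico s0 s) (fun u _ => by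
        split_ifs; exact gW_nonneg _ _ _ _ _ _; exact le_rfl)
      (Finset.mem_Ico.2 ⟨le_rfl, hs⟩)
    simp only [this, if_true] at h3
    exact h3

theorem gp_succ {κ : ℕ} {β : ℕ → List Bool} {i : ℕ} (hβ : ∀ s, (β s).length = s) (hκ : 3 ≤ κ)
    (hi : 14 * (i : ℝ) * (1/2) ^ κ ≤ 1) (ih : GP κ β i) : GP κ β (i+1) := by
  intro g s0 s hs
  have hC := Cc_pos κ i
  have hg : (0 : ℝ) < (1/2) ^ g := by positivity
  cases ginv_all (g := g) hβ hκ hi ih hs with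
  | idle n a τ rs st core acc =>
    refine ⟨_, _, _, _, _, _, st, by simp, acc.trans (finC hi hg.le ?_)⟩
    have := core.bd
    have hn : (0 : ℝ) < (1/2) ^ n := by positivity
    linarith
  | act n a τ rs t0 st h0 h1 len len' cap ag hW t1s core acc =>
    refine ⟨_, _, _, _, _, _, st, by simp, ?_⟩
    obtain ⟨_, _, _, _, _, _, -, -, h⟩ := ih (g+n) t0 s h1
    rw [← Finset.sum_Ico_consecutive _ h0 (show t0 ≤ s + 1 by omega),
      Finset.sum_congr rfl fun u hu => hW u (Finset.mem_Ico.1 hu).1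
          (by have := (Finset.mem_Ico.1 hu).2; omega)]
    rw [pow_add] at h
    have h5 : Cc κ i * (1/2) ^ g * (a * (1/2) ^ n + 2 * (1/2) ^ κ - (1/2) ^ n) ≤ Cc κ (i+1) * (1/2) ^ g := by
      apply finC hi hg.le
      have := core.bd
      have hn : (0 : ℝ) < (1/2) ^ n := by positivity
      linarith
    linarith
  | fin n a τ rs st val acc => exact ⟨_, _, _, _, _, _, st, fun _ => ⟨rfl, val⟩, acc⟩

theorem gp_all {κ k : ℕ} {β : ℕ → List Bool} (hβ : ∀ s, (β s).length = s) (hκ : 3 ≤ κ)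
    (hk : 14 * (k : ℝ) * (1/2) ^ κ ≤ 1) : ∀ i ≤ k, GP κ β i := by
  intro i
  induction i with
  | zero => intro _; exact gp_zero κ β
  | succ i ih =>
    intro h
    refine gp_succ hβ hκ (le_trans ?_ hk) (ih (by omega))
    have : (i : ℝ) ≤ k := by exact_mod_cast (by omega : i ≤ k)
    gcongr

end GameInv2

end

section
open MeasureTheory ENNReal

section GameLive

theorem grun_zero {κ : ℕ} {β : ℕ → List Bool} {g s0 s : ℕ} (hs : s0 < s) :
    grun κ β 0 g s0 s = [(0, g, s0, κ, 0, [], [], true)] := by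
  have h0 : grun κ β 0 g s0 s0 = [(0, g, s0, κ, 0, [], [], false)] := by rw [grun_le le_rfl]; rfl
  induction s, hs using Nat.le_induction with
  | base => rw [grun_succ le_rfl, h0, gstep_cons]; simp [comb]
  | succ s hs ih => rw [grun_succ (by omega), ih, gstep_cons]; simp [comb]

theorem fin_persist {κ : ℕ} {β : ℕ → List Bool} {i g s0 s s' n a : ℕ} {τ : List Bool} {rs : List GRec}
    (h : s0 ≤ s) (hs : s ≤ s') (st : grun κ β i g s0 s = [(i, g, s0, n, a, τ, rs, true)]) :
    grun κ β i g s0 s' = [(i, g, s0, n, a, τ, rs, true)] := by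
  induction s', hs using Nat.le_induction with
  | base => exact st
  | succ s' hs ih =>
    rw [grun_succ (by omega), ih, gstep_cons]
    cases i with
    | zero => simp [comb]
    | succ i => rw [comb_fin]

/-- a left-c.e. real -/
def LCE (X : ℕ → Bool) : Prop := ∃ a : ℕ → ℕ → ℕ, Computable (fun q : ℕ × ℕ => a q.1 q.2) ∧
  (∀ t t' n, t ≤ t' → a t n ≤ a t' n) ∧ ∀ n, ∃ t₀, ∀ t ≥ t₀, a t n = num (strPrefix X n)

def GFin (κ : ℕ) (β : ℕ → List Bool) (i g s0 s : ℕ) : Prop :=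
  ∃ n a τ rs, grun κ β i g s0 s = [(i, g, s0, n, a, τ, rs, true)]

def GIdle (κ : ℕ) (β : ℕ → List Bool) (i g s0 s n a : ℕ) : Prop :=
  ∃ τ rs, grun κ β (i+1) g s0 s = [(i+1, g, s0, n, a, τ, rs, false)]

def GAct (κ : ℕ) (β : ℕ → List Bool) (i g s0 s n a t0 : ℕ) (τ : List Bool) : Prop :=
  t0 ≤ s ∧ ∃ rs, grun κ β (i+1) g s0 s = (i+1, g, s0, n, a, τ, rs, false) :: grun κ β i (g+n) t0 s

theorem act_next {κ : ℕ} {β : ℕ → List Bool} {i g s0 s n a t0 : ℕ} {τ : List Bool} (ih : GP κ β i)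
    (hs : s0 ≤ s) (hnf : ¬ GFin κ β (i+1) g s0 (s+1)) (h : GAct κ β i g s0 s n a t0 τ) :
    GIdle κ β i g s0 (s+1) n (a+1) ∨
    (GIdle κ β i g s0 (s+1) (n+1) (2*a) ∧ (β (s+1)).take τ.length ≠ τ) ∨
    (GAct κ β i g s0 (s+1) n a t0 τ ∧ ¬ GFin κ β i (g+n) t0 (s+1)) := by
  obtain ⟨ht, rs, st⟩ := h
  obtain ⟨n', a', τ', rs', b, tl, hch, hb, -⟩ := ih (g+n) t0 (s+1) (by omega)
  have e := act_step hs ht st hch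
  split_ifs at e with hd hτ hb'
  · exact absurd ⟨_, _, _, _, e⟩ hnf
  · exact Or.inr (Or.inl ⟨⟨_, _, e⟩, hτ⟩)
  · exact Or.inl ⟨_, _, e⟩
  · refine Or.inr (Or.inr ⟨⟨by omega, _, e⟩, ?_⟩)
    rintro ⟨n2, a2, τ2, rs2, h2⟩
    rw [hch] at h2
    apply hb'
    simp only [List.cons.injEq, Prod.mk.injEq] at h2
    exact h2.1.2.2.2.2.2.2.2

theorem act_end {κ : ℕ} {β : ℕ → List Bool} {i g s0 s n a t0 : ℕ} {τ : List Bool} (ih : GP κ β i)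
    (ihl : ∀ g s0, ∃ s ≥ s0, GFin κ β i g s0 s)
    (hs : s0 ≤ s) (hnf : ∀ s ≥ s0, ¬ GFin κ β (i+1) g s0 s) (h : GAct κ β i g s0 s n a t0 τ) :
    ∃ s' > s, GIdle κ β i g s0 s' n (a+1) ∨
    (GIdle κ β i g s0 s' (n+1) (2*a) ∧ (β s').take τ.length ≠ τ) := by
  by_contra hcon
  push Not at hcon
  obtain ⟨s1, h1, n1, a1, τ1, rs1, hf⟩ := ihl (g+n) t0
  have step : ∀ s' ≥ s, GAct κ β i g s0 s' n a t0 τ →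
      (GAct κ β i g s0 (s'+1) n a t0 τ ∧ ¬ GFin κ β i (g+n) t0 (s'+1)) := by
    intro s' hs' h'
    rcases act_next ih (by omega) (hnf _ (by omega)) h' with h2 | h2 | h2
    · exact absurd h2 (hcon (s'+1) (by omega)).1
    · exact absurd ((hcon (s'+1) (by omega)).2 h2.1) h2.2
    · exact h2
  have all : ∀ s' ≥ s, GAct κ β i g s0 s' n a t0 τ := by
    intro s' hs'
    induction s', hs' using Nat.le_induction with
    | base => exact h
    | succ s' hs' ih' => exact (step s' hs' ih').1
  refine (step (max s s1) (by omega) (all _ (by omega))).2 ⟨_, _, _, _, fin_persist h1 (by omega) hf⟩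

theorem idle_next {κ : ℕ} {β : ℕ → List Bool} {i g s0 s n a : ℕ}
    (hs : s0 ≤ s) (hnf : ¬ GFin κ β (i+1) g s0 (s+1)) (h : GIdle κ β i g s0 s n a) :
    (GIdle κ β i g s0 (s+1) n a ∧ cand κ (β (s+1)) (s+1) n a = none) ∨
    ∃ ℓ, cand κ (β (s+1)) (s+1) n a = some ℓ ∧
      GAct κ β i g s0 (s+1) (max n ℓ) (a * 2 ^ (max n ℓ - n)) (s+1) ((β (s+1)).take ℓ) := by
  obtain ⟨τ, rs, st⟩ := h
  have e := idle_step hs st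
  split_ifs at e with hd
  · exact absurd ⟨_, _, _, _, e⟩ hnf
  · cases hc : cand κ (β (s+1)) (s+1) n a with
    | none => rw [hc] at e; exact Or.inl ⟨⟨_, _, e⟩, rfl⟩
    | some ℓ => rw [hc] at e; exact Or.inr ⟨ℓ, rfl, le_rfl, _, e⟩

def hN (κ : ℕ) (β : ℕ → List Bool) (i g s0 s : ℕ) : ℕ :=
  (grun κ β i g s0 s).head?.elim 0 fun fr => fr.2.2.2.1
def hA (κ : ℕ) (β : ℕ → List Bool) (i g s0 s : ℕ) : ℕ :=
  (grun κ β i g s0 s).head?.elim 0 fun fr => fr.2.2.2.2.1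

theorem GIdle.hN {κ : ℕ} {β : ℕ → List Bool} {i g s0 s n a : ℕ} (h : GIdle κ β i g s0 s n a) :
    hN κ β (i+1) g s0 s = n ∧ hA κ β (i+1) g s0 s = a := by
  obtain ⟨_, _, e⟩ := h
  simp [_root_.hN, _root_.hA, e]
theorem GAct.hN {κ : ℕ} {β : ℕ → List Bool} {i g s0 s n a t0 : ℕ} {τ : List Bool}
    (h : GAct κ β i g s0 s n a t0 τ) :
    hN κ β (i+1) g s0 s = n ∧ hA κ β (i+1) g s0 s = a := by
  obtain ⟨_, _, e⟩ := h
  simp [_root_.hN, _root_.hA, e]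

theorem cand_le {κ s n a L : ℕ} {β ρ : List Bool} (hL : L ≤ s) (hρ : ρ.length = L)
    (hn : num ρ = a * 2 ^ L / 2 ^ (n+2)) (hu : univ κ (β.take L) ρ = true) :
    ∃ ℓ ≤ L, cand κ β s n a = some ℓ := by
  unfold cand
  set p : ℕ → Bool := fun ℓ => (strs ℓ).any fun ρ =>
    decide (num ρ = a * 2 ^ ℓ / 2 ^ (n+2)) && univ κ (β.take ℓ) ρ with hp
  have hpL : p L = true := by
    rw [hp]; simp only [List.any_eq_true, Bool.and_eq_true, decide_eq_true_eq]
    exact ⟨ρ, mem_strs.2 hρ, hn, hu⟩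
  have e : List.range (s+1) = List.range (L+1) ++ (List.range (s - L)).map (L + 1 + ·) := by
    rw [← List.range_add]; congr 1; omega
  rw [e, List.find?_append]
  cases h : (List.range (L+1)).find? p with
  | none =>
    rw [List.find?_eq_none] at h
    exact absurd hpL (h L (by simp))
  | some ℓ =>
    have := List.mem_of_find?_eq_some h
    rw [List.mem_range] at this
    exact ⟨ℓ, by omega, by simp⟩

theorem real_of_V {V : ℕ → ℕ} (h2 : ∀ ℓ, V (ℓ+1) / 2 = V ℓ) (h0 : V 0 = 0) :
    ∀ ℓ, num (strPrefix (fun n => decide (V (n+1) % 2 = 1)) ℓ) = V ℓ := by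
  intro ℓ
  induction ℓ with
  | zero => simp [strPrefix, num, h0]
  | succ ℓ ih =>
    rw [sp_succ, num_concat, ih, ← h2]
    have := Nat.mod_two_eq_zero_or_one (V (ℓ+1))
    rcases this with h | h
    · simp [h]; omega
    · simp [h]; omega

theorem mono_bdd_const {f : ℕ → ℕ} {B : ℕ} (hm : ∀ s, f s ≤ f (s+1)) (hb : ∀ s, f s ≤ B) :
    ∃ c s₁, ∀ s ≥ s₁, f s = c := by
  have hm' := monotone_nat_of_le_succ hm
  have hbd : BddAbove (Set.range f) := ⟨B, by rintro _ ⟨s, rfl⟩; exact hb s⟩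
  obtain ⟨s₁, h1⟩ := Nat.sSup_mem (Set.range_nonempty f) hbd
  refine ⟨sSup (Set.range f), s₁, fun s hs => le_antisymm (le_csSup hbd ⟨s, rfl⟩) ?_⟩
  rw [← h1]; exact hm' hs

theorem live_succ {κ i : ℕ} {A : ℕ → Bool} {β : ℕ → List Bool} (hβ : ∀ s, (β s).length = s) (hκ : 3 ≤ κ)
    (hi : 14 * (i : ℝ) * (1/2) ^ κ ≤ 1) (ih : GP κ β i)
    (ihl : ∀ g s0, ∃ s ≥ s0, GFin κ β i g s0 s)
    (hc : Computable β) (hconv : ∀ n, ∃ t, ∀ s ≥ t, (β s).take n = strPrefix A n)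
    (hno : ∀ X, LCE X → ¬ MLRandomIn A X) (g s0 : ℕ) : ∃ s ≥ s0, GFin κ β (i+1) g s0 s := by
  by_contra hcon
  have hnf : ∀ s ≥ s0, ¬ GFin κ β (i+1) g s0 s := by
    intro s hs h; exact hcon ⟨s, hs, h⟩
  set N := hN κ β (i+1) g s0
  set Av := hA κ β (i+1) g s0
  have shape : ∀ s ≥ s0, (∃ n a, GIdle κ β i g s0 s n a) ∨ ∃ n a t0 τ, GAct κ β i g s0 s n a t0 τ := by
    intro s hs
    cases ginv_all (g := g) hβ hκ hi ih hs with
    | idle n a τ rs st core acc => exact Or.inl ⟨_, _, _, _, st⟩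
    | act n a τ rs t0 st h0 h1 => exact Or.inr ⟨_, _, _, _, h1, _, st⟩
    | fin n a τ rs st => exact absurd ⟨_, _, _, _, st⟩ (hnf s hs)
  have bound : ∀ s ≥ s0, Av s < 2 ^ (N s + 2) := by
    intro s hs
    have core : ∃ rs, Core κ β (gW κ β (i+1) g s0) i g s0 s (N s) (Av s) rs := by
      cases ginv_all (g := g) hβ hκ hi ih hs with
      | idle n a τ rs st core acc =>
        obtain ⟨e1, e2⟩ := GIdle.hN ⟨_, _, st⟩
        rw [← e1, ← e2] at core; exact ⟨_, core⟩
      | act n a τ rs t0 st h0 h1 _ _ _ _ _ _ core =>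
        obtain ⟨e1, e2⟩ := GAct.hN ⟨h1, _, st⟩
        rw [← e1, ← e2] at core; exact ⟨_, core⟩
      | fin n a τ rs st => exact absurd ⟨_, _, _, _, st⟩ (hnf s hs)
    obtain ⟨rs, core⟩ := core
    have b2 := core.bd
    have b3 : (1/2 : ℝ) ^ κ ≤ (1/2) ^ 3 := pow_le_pow_of_le_one (by norm_num) (by norm_num) hκ
    have b4 : (Av s : ℝ) < 2 ^ (N s + 2) := by
      rw [one_div, inv_pow, ← div_eq_mul_inv, div_le_iff₀ (by positivity)] at b2
      rw [one_div] at b3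
      have : (0 : ℝ) < 2 ^ N s := by positivity
      norm_num at b2 b3
      rw [pow_add]
      nlinarith
    exact_mod_cast b4
  have mono : ∀ s ≥ s0, ∃ d, N (s+1) = N s + d ∧ Av s * 2 ^ d ≤ Av (s+1) := by
    intro s hs
    rcases shape s hs with ⟨n, a, h⟩ | ⟨n, a, t0, τ, h⟩
    · obtain ⟨e1, e2⟩ := h.hN
      rcases idle_next hs (hnf _ (by omega)) h with ⟨h', -⟩ | ⟨ℓ, -, h'⟩
      · obtain ⟨f1, f2⟩ := h'.hN
        exact ⟨0, by simp [N, e1, f1], by simp [Av, e2, f2]⟩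
      · obtain ⟨f1, f2⟩ := h'.hN
        exact ⟨max n ℓ - n, by simp [N, e1, f1], by simp [Av, e2, f2]⟩
    · obtain ⟨e1, e2⟩ := h.hN
      rcases act_next ih hs (hnf _ (by omega)) h with h' | ⟨h', -⟩ | ⟨h', -⟩
      · obtain ⟨f1, f2⟩ := h'.hN
        exact ⟨0, by simp [N, e1, f1], by simp [Av, e2, f2]⟩
      · obtain ⟨f1, f2⟩ := h'.hN
        exact ⟨1, by simp [N, e1, f1], by simp [Av, e2, f2]; omega⟩
      · obtain ⟨f1, f2⟩ := h'.hN
        exact ⟨0, by simp [N, e1, f1], by simp [Av, e2, f2]⟩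
  set v : ℕ → ℕ → ℕ := fun t ℓ => Av (s0 + t) * 2 ^ ℓ / 2 ^ (N (s0 + t) + 2) with hv
  have vmono : ∀ ℓ t, v t ℓ ≤ v (t+1) ℓ := by
    intro ℓ t
    obtain ⟨d, h1, h2⟩ := mono (s0 + t) (by omega)
    simp only [hv]
    rw [← Nat.mul_div_mul_right _ _ (show 0 < 2 ^ d by positivity), ← add_assoc s0, h1,
      show N (s0 + t) + d + 2 = N (s0 + t) + 2 + d by ring, pow_add _ _ d]
    apply Nat.div_le_div_right
    calc _ = Av (s0 + t) * 2 ^ d * 2 ^ ℓ := by ring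
      _ ≤ _ := Nat.mul_le_mul_right _ h2
  have vlt : ∀ ℓ t, v t ℓ < 2 ^ ℓ := by
    intro ℓ t
    simp only [hv]
    rw [Nat.div_lt_iff_lt_mul (by positivity), mul_comm]
    exact Nat.mul_lt_mul_of_pos_left (bound _ (by omega)) (by positivity)
  choose V T hV using fun ℓ => mono_bdd_const (f := fun t => v t ℓ) (vmono ℓ) (fun t => (vlt ℓ t).le)
  set X : ℕ → Bool := fun n => decide (V (n+1) % 2 = 1) with hX
  have hnum : ∀ ℓ, num (strPrefix X ℓ) = V ℓ := by
    apply real_of_V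
    · intro ℓ
      rw [← hV (ℓ+1) (max (T ℓ) (T (ℓ+1))) (by simp), ← hV ℓ (max (T ℓ) (T (ℓ+1))) (by simp)]
      simp only [hv]
      rw [pow_succ, ← mul_assoc, Nat.div_div_eq_div_mul, Nat.mul_div_mul_right _ _ (by norm_num)]
    · have := vlt 0 (T 0)
      rw [hV 0 (T 0) le_rfl] at this
      simpa using this
  have hlce : LCE X := by
    refine ⟨v, ?_, ?_, ?_⟩
    · have hr := cGrun (κ := κ) hc (i+1) g s0
      have cN : Computable N := by
        show Computable fun s => hN κ β (i+1) g s0 s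
        unfold hN; fun_prop
      have cA : Computable Av := by
        show Computable fun s => hA κ β (i+1) g s0 s
        unfold hA; fun_prop
      simp only [hv]
      fun_prop
    · intro t t' n h
      exact monotone_nat_of_le_succ (vmono n) h
    · intro n
      exact ⟨T n, fun t ht => by rw [hnum]; exact hV n t ht⟩
  obtain ⟨L, hL⟩ := univ_complete κ (hno X hlce)
  obtain ⟨t1, ht1⟩ := hconv L
  set S1 := s0 + max (T L) (max t1 L) with hS1
  have vL : ∀ s ≥ S1, Av s * 2 ^ L / 2 ^ (N s + 2) = num (strPrefix X L) := by
    intro s hs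
    rw [hnum, ← hV L (s - s0) (by omega)]
    simp only [hv]
    rw [show s0 + (s - s0) = s by omega]
  have good : ∀ s ≥ S1, ∀ n a, GIdle κ β i g s0 s n a → ∃ ℓ ≤ L, ∃ s' > s,
      GIdle κ β i g s0 s' (max n ℓ) (a * 2 ^ (max n ℓ - n) + 1) := by
    intro s hs n a h
    obtain ⟨e1, e2⟩ := h.hN
    have e3 := vL s hs
    have e1' : N s = n := e1
    have e2' : Av s = a := e2
    rw [e1', e2'] at e3
    obtain ⟨ℓ, hℓ, hcd⟩ := cand_le (κ := κ) (s := s + 1) (β := β (s+1)) (n := n) (a := a) (L := L)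
      (ρ := strPrefix X L) (by omega) (by rw [sp_length]) e3.symm
      (by rw [ht1 (s+1) (by omega)]; exact hL)
    rcases idle_next (by omega) (hnf _ (by omega)) h with ⟨-, h'⟩ | ⟨ℓ', h', hact⟩
    · rw [hcd] at h'; cases h'
    · rw [hcd] at h'; cases h'
      obtain ⟨s', hs', h3⟩ := act_end ih ihl (by omega) hnf hact
      refine ⟨ℓ, hℓ, s', by omega, ?_⟩
      rcases h3 with h3 | ⟨-, h3⟩
      · exact h3
      · exfalso; apply h3
        have hl : ((β (s+1)).take ℓ).length = ℓ := by simp [hβ]; omega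
        rw [hl]
        have q1 := congrArg (List.take ℓ) (ht1 (s+1) (by omega))
        have q2 := congrArg (List.take ℓ) (ht1 s' (by omega))
        rw [List.take_take, min_eq_left hℓ] at q1 q2
        rw [q1, q2]
  obtain ⟨S2, hS2, n2, a2, hid⟩ : ∃ s ≥ S1, ∃ n a, GIdle κ β i g s0 s n a := by
    rcases shape S1 (by omega) with ⟨n, a, h⟩ | ⟨n, a, t0, τ, h⟩
    · exact ⟨_, le_rfl, _, _, h⟩
    · obtain ⟨s', hs', h3⟩ := act_end ih ihl (by omega) hnf h
      rcases h3 with h3 | ⟨h3, -⟩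
      · exact ⟨s', by omega, _, _, h3⟩
      · exact ⟨s', by omega, _, _, h3⟩
  set M := max n2 L
  have grow : ∀ j, ∃ s ≥ S1, ∃ n a, GIdle κ β i g s0 s n a ∧ n ≤ M ∧ j ≤ a * 2 ^ (M - n) := by
    intro j
    induction j with
    | zero => exact ⟨S2, hS2, n2, a2, hid, by omega, by omega⟩
    | succ j ihj =>
      obtain ⟨s, hs, n, a, h, hn, hj⟩ := ihj
      obtain ⟨ℓ, hℓ, s', hs', h'⟩ := good s hs n a h
      refine ⟨s', by omega, _, _, h', by omega, ?_⟩
      rw [add_mul, mul_assoc, ← pow_add, show max n ℓ - n + (M - max n ℓ) = M - n by omega]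
      have : 0 < 2 ^ (M - max n ℓ) := by positivity
      omega
  obtain ⟨s, hs, n, a, h, hn, hj⟩ := grow (2 ^ (M+2))
  obtain ⟨e1, e2⟩ := h.hN
  have b := bound s (by omega)
  have e1' : N s = n := e1
  have e2' : Av s = a := e2
  rw [e1', e2'] at b
  have : a * 2 ^ (M - n) < 2 ^ (n+2) * 2 ^ (M - n) := Nat.mul_lt_mul_of_pos_right b (by positivity)
  rw [← pow_add, show n + 2 + (M - n) = M + 2 by omega] at this
  omega

theorem live_all {κ k : ℕ} {A : ℕ → Bool} {β : ℕ → List Bool} (hβ : ∀ s, (β s).length = s) (hκ : 3 ≤ κ)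
    (hk : 14 * (k : ℝ) * (1/2) ^ κ ≤ 1) 
    (hc : Computable β) (hconv : ∀ n, ∃ t, ∀ s ≥ t, (β s).take n = strPrefix A n)
    (hno : ∀ X, LCE X → ¬ MLRandomIn A X) : ∀ i ≤ k, ∀ g s0, ∃ s ≥ s0, GFin κ β i g s0 s := by
  intro i
  induction i with
  | zero => intro _ g s0; exact ⟨s0+1, by omega, _, _, _, _, grun_zero (by omega)⟩
  | succ i ih =>
    intro h
    refine live_succ hβ hκ (le_trans ?_ hk) (gp_all hβ hκ hk i (by omega)) (ih (by omega)) hc hconv hno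
    have : (i : ℝ) ≤ k := by exact_mod_cast (by omega : i ≤ k)
    gcongr

end GameLive

end

section
open MeasureTheory ENNReal

section Wrapper

def gtop (d : ℕ) (β : ℕ → List Bool) (u : ℕ) : List GFrame := grun (2*d+5) β (2^(2*d+1)) 1 0 u

theorem gtop_eq (d : ℕ) (β : ℕ → List Bool) (u : ℕ) : gtop d β u =
    Nat.rec (motive := fun _ => List GFrame) [ginit (2*d+5) (2^(2*d+1)) 1 0]
     (fun s r => gstep (2*d+5) (s+1) (β (s+1)) r) u := by
  induction u with
  | zero => rfl
  | succ s ih => rw [gtop, grun_succ (by omega), ← gtop, ih]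

def invs (d : ℕ) (bs : List (List Bool)) : List (ℕ × ℕ) :=
  (List.range bs.length).flatMap fun u => (ginv (gtop d (fun t => bs.getD t []) u) u).elim []
    fun r => [(r, u)]

theorem mem_invs {d : ℕ} {bs : List (List Bool)} {r u : ℕ} : (r, u) ∈ invs d bs ↔ u < bs.length ∧
    ginv (gtop d (fun t => bs.getD t []) u) u = some r := by
  simp only [invs, List.mem_flatMap, List.mem_range]
  constructor
  · rintro ⟨v, hv, h⟩
    cases hg : ginv (gtop d (fun t => bs.getD t []) v) v with
    | none => rw [hg] at h; simp at h
    | some r' =>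
      rw [hg] at h
      simp only [Option.elim_some, List.mem_singleton, Prod.mk.injEq] at h
      obtain ⟨rfl, rfl⟩ := h
      exact ⟨hv, hg⟩
  · rintro ⟨h1, h2⟩
    exact ⟨u, h1, by rw [h2]; simp⟩

theorem cGtop : Computable (fun q : ℕ × List (List Bool) × ℕ =>
    gtop q.1 (fun t => q.2.1.getD t []) q.2.2) := by
  simp only [gtop_eq, ginit]
  fun_prop

@[fun_prop]
theorem cInvs {α : Type} [Primcodable α] {d : α → ℕ} {f : α → List (List Bool)} (hd : Computable d)
    (hf : Computable f) : Computable (fun x => invs (d x) (f x)) := by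
  have h : Computable (fun q : α × ℕ => gtop (d q.1) (fun t => (f q.1).getD t []) q.2) :=
    cGtop.comp (f := fun q : ℕ × List (List Bool) × ℕ => gtop q.1 (fun t => q.2.1.getD t []) q.2.2)
      (g := fun q : α × ℕ => (d q.1, f q.1, q.2)) (by fun_prop)
  simp only [invs]
  fun_prop

def ready (a : ℕ → ℕ → Bool) (z : ℕ × ℕ → ℕ → Bool) (d T : ℕ) (bs : List (List Bool)) : Bool :=
  (invs d bs).all fun p => (List.range (p.1 + 2*d + 1)).any fun k =>
    z (k, Encodable.encode ((List.range p.2).map (a T))) T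

theorem ready_iff {a : ℕ → ℕ → Bool} {z : ℕ × ℕ → ℕ → Bool} {d T : ℕ} {bs : List (List Bool)} :
    ready a z d T bs = true ↔ ∀ r u, (r, u) ∈ invs d bs → ∃ k ≤ r + 2 * d,
      z (k, Encodable.encode (strPrefix (a T) u)) T = true := by
  simp only [ready, List.all_eq_true, List.any_eq_true, List.mem_range, Nat.lt_succ_iff, Prod.forall]
  rfl

def wrun (a : ℕ → ℕ → Bool) (z : ℕ × ℕ → ℕ → Bool) (d : ℕ) : ℕ → List (List Bool)
  | 0 => [[]]
  | T+1 => if ready a z d T (wrun a z d T) = true then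
      wrun a z d T ++ [(List.range (wrun a z d T).length).map (a T)] else wrun a z d T

theorem cReady {a : ℕ → ℕ → Bool} {z : ℕ × ℕ → ℕ → Bool} (ac : Computable (fun q : ℕ × ℕ => a q.1 q.2))
    (zc : Computable (fun q : (ℕ × ℕ) × ℕ => z q.1 q.2)) :
    Computable (fun q : ℕ × ℕ × List (List Bool) => ready a z q.1 q.2.1 q.2.2) := by
  simp only [ready]; fun_prop

theorem cWrun {a : ℕ → ℕ → Bool} {z : ℕ × ℕ → ℕ → Bool} (ac : Computable (fun q : ℕ × ℕ => a q.1 q.2))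
    (zc : Computable (fun q : (ℕ × ℕ) × ℕ => z q.1 q.2)) :
    Computable (fun q : ℕ × ℕ => wrun a z q.1 q.2) := by
  have e : ∀ d T, wrun a z d T = Nat.rec (motive := fun _ => List (List Bool)) [[]]
     (fun T r => if ready a z d T r = true then r ++ [(List.range r.length).map (a T)] else r) T := by
    intro d T
    induction T with
    | zero => rfl
    | succ T ih => rw [wrun, ih]
  have h := cReady ac zc
  have h' : Computable (fun q : (ℕ × ℕ) × ℕ × List (List Bool) => ready a z q.1.1 q.2.1 q.2.2) :=
    h.comp (f := fun q : ℕ × ℕ × List (List Bool) => ready a z q.1 q.2.1 q.2.2)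
     (g := fun q : (ℕ × ℕ) × ℕ × List (List Bool) => (q.1.1, q.2.1, q.2.2)) (by fun_prop)
  simp only [e]
  fun_prop

variable {a : ℕ → ℕ → Bool} {z : ℕ × ℕ → ℕ → Bool} {d : ℕ}

theorem wrun_succ (T : ℕ) : wrun a z d (T+1) = if ready a z d T (wrun a z d T) = true then
      wrun a z d T ++ [strPrefix (a T) (wrun a z d T).length] else wrun a z d T := rfl

theorem wrun_prefix {T T' : ℕ} (h : T ≤ T') : wrun a z d T <+: wrun a z d T' := by
  induction T', h using Nat.le_induction with
  | base => exact List.prefix_rfl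
  | succ T' h ih =>
    refine ih.trans ?_
    rw [wrun_succ]
    split_ifs
    · exact List.prefix_append _ _
    · exact List.prefix_rfl

theorem wrun_len (T : ℕ) : (wrun a z d T).length ≤ T + 1 := by
  induction T with
  | zero => simp [wrun]
  | succ T ih =>
    rw [wrun_succ]
    split_ifs
    · simp; omega
    · omega

theorem wrun_agree {T T' s : ℕ} (h : s < (wrun a z d T).length) (h' : s < (wrun a z d T').length) :
    (wrun a z d T).getD s [] = (wrun a z d T').getD s [] := by
  have key : ∀ T T', T ≤ T' → s < (wrun a z d T).length →
      (wrun a z d T).getD s [] = (wrun a z d T').getD s [] := by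
    intro T T' hT h
    obtain ⟨l, hl⟩ := wrun_prefix (a := a) (z := z) (d := d) hT
    rw [← hl, List.getD_append _ _ _ _ h]
  rcases le_total T T' with hT | hT
  · exact key T T' hT h
  · exact (key T' T hT h').symm

open Classical in
noncomputable def wβ (a : ℕ → ℕ → Bool) (z : ℕ × ℕ → ℕ → Bool) (d s : ℕ) : List Bool :=
  if h : ∃ T, s < (wrun a z d T).length then (wrun a z d h.choose).getD s [] else List.replicate s false

theorem wβ_eq {T s : ℕ} (h : s < (wrun a z d T).length) : (wrun a z d T).getD s [] = wβ a z d s := by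
  have h' : ∃ T, s < (wrun a z d T).length := ⟨T, h⟩
  rw [wβ, dif_pos h']
  exact wrun_agree h h'.choose_spec

/-- every reached positive stage was appended at some moment -/
theorem wrun_append {s T : ℕ} (h : s + 1 < (wrun a z d T).length) : ∃ T, (wrun a z d T).length = s + 1 ∧
    ready a z d T (wrun a z d T) = true ∧ wβ a z d (s+1) = strPrefix (a T) (s+1) := by
  induction T with
  | zero => simp [wrun] at h
  | succ T ih =>
    by_cases h2 : s + 1 < (wrun a z d T).length
    · exact ih h2
    · have e := wrun_succ (a := a) (z := z) (d := d) T
      split_ifs at e with hr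
      · have h3 : (wrun a z d T).length = s + 1 := by
          rw [e] at h; simp at h; omega
        refine ⟨T, h3, hr, ?_⟩
        rw [← wβ_eq h, e, h3, List.getD_append_right _ _ _ _ (by omega), h3]
        simp
      · rw [e] at h; exact absurd h h2

theorem wβ_len (s : ℕ) : (wβ a z d s).length = s := by
  by_cases h : ∃ T, s < (wrun a z d T).length
  · obtain ⟨T, h⟩ := h
    cases s with
    | zero =>
      rw [← wβ_eq (T := 0) (by simp [wrun])]; simp [wrun]
    | succ s =>
      obtain ⟨T', -, -, h3⟩ := wrun_append h
      rw [h3, sp_length]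
  · rw [wβ, dif_neg h, List.length_replicate]

theorem grun_congr {κ : ℕ} {β β' : ℕ → List Bool} {i g s0 s : ℕ} (h : ∀ t ≤ s, β t = β' t) :
    grun κ β i g s0 s = grun κ β' i g s0 s := by
  induction s with
  | zero => rfl
  | succ s ih => rw [grun, grun, ih fun t ht => h t (by omega), h (s+1) le_rfl]

theorem mem_invs_wrun {T r u : ℕ} : (r, u) ∈ invs d (wrun a z d T) ↔
    u < (wrun a z d T).length ∧ ginv (gtop d (wβ a z d) u) u = some r := by
  rw [mem_invs]
  refine and_congr_right fun hu => ?_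
  rw [gtop, grun_congr (β' := wβ a z d), gtop]
  intro t ht
  exact wβ_eq (by omega)

theorem top_eps (d : ℕ) : 14 * ((2^(2*d+1) : ℕ) : ℝ) * (1/2) ^ (2*d+5) ≤ 1 := by
  push_cast
  rw [show 2*d+5 = (2*d+1) + 4 by ring, pow_add (1/2 : ℝ), show 14 * (2 : ℝ) ^ (2*d+1) * ((1/2) ^ (2*d+1) * (1/2)^4) =
    14 * (2 * (1/2)) ^ (2*d+1) * (1/2)^4 by rw [mul_pow 2]; ring]
  norm_num

/-- the requests -/
def reqSet (a : ℕ → ℕ → Bool) (z : ℕ × ℕ → ℕ → Bool) : Set (ℕ × ℕ) :=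
  {x | ∃ p : ℕ × ℕ × ℕ × ℕ, (p.2.2.1, p.2.2.2) ∈ invs p.1 (wrun a z p.1 p.2.1) ∧
    x = (p.2.2.1 + p.1 + 1, Encodable.encode (List.replicate p.2.2.2 true))}

theorem sig_reqSet (ac : Computable (fun q : ℕ × ℕ => a q.1 q.2))
    (zc : Computable (fun q : (ℕ × ℕ) × ℕ => z q.1 q.2)) : Sig emptyOracle (fun x => x ∈ reqSet a z) := by
  have h := cWrun ac zc
  have h1 : Computable (fun q : (ℕ × ℕ) × ℕ × ℕ × ℕ × ℕ => wrun a z q.2.1 q.2.2.1) :=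
    h.comp (f := fun q : ℕ × ℕ => wrun a z q.1 q.2)
      (g := fun q : (ℕ × ℕ) × ℕ × ℕ × ℕ × ℕ => (q.2.1, q.2.2.1)) (by fun_prop)
  refine Sig.ex (p := fun (x : ℕ × ℕ) (p : ℕ × ℕ × ℕ × ℕ) =>
    (p.2.2.1, p.2.2.2) ∈ invs p.1 (wrun a z p.1 p.2.1) ∧
    x = (p.2.2.1 + p.1 + 1, Encodable.encode (List.replicate p.2.2.2 true))) ?_
  have h2 : Computable (fun q : (ℕ × ℕ) × ℕ × ℕ × ℕ × ℕ =>
      ((invs q.2.1 (wrun a z q.2.1 q.2.2.1)).any fun y => decide (y = (q.2.2.2.1, q.2.2.2.2))) &&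
      decide (q.1 = (q.2.2.2.1 + q.2.1 + 1, Encodable.encode (List.replicate q.2.2.2.2 true)))) := by
    fun_prop
  refine Sig.dec (ComputablePred.computable_iff.2 ⟨_, h2, ?_⟩)
  funext q
  simp only [Bool.and_eq_true, List.any_eq_true, decide_eq_true_eq, exists_eq_right]

theorem sum_gW (β : ℕ → List Bool) (hβ : ∀ s, (β s).length = s) (s : ℕ) :
    ∑ u ∈ Finset.range s, gW (2*d+5) β (2^(2*d+1)) 1 0 u ≤ 1 := by
  obtain ⟨_, _, _, _, _, _, -, -, h⟩ := gp_all hβ (show 3 ≤ 2*d+5 by omega) (top_eps d) _ le_rfl 1 0 s (by omega)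
  rw [Finset.sum_Ico_succ_top (by omega), ← Finset.range_eq_Ico] at h
  have h1 := gW_nonneg (2*d+5) β (2^(2*d+1)) 1 0 s
  have h2 : Cc (2*d+5) (2^(2*d+1)) * (1/2) ^ 1 ≤ 1 := by
    have := top_eps d
    unfold Cc; linarith
  linarith

theorem wt_reqSet : wt (reqSet a z) < ⊤ := by
  set P : ℕ → ℕ → Set (ℕ × ℕ) := fun d u => {x | ∃ r, ginv (gtop d (wβ a z d) u) u = some r ∧
    x = (r + d + 1, Encodable.encode (List.replicate u true))} with hP
  have sub : reqSet a z ⊆ ⋃ d, ⋃ u, P d u := by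
    rintro x ⟨⟨d, T, r, u⟩, h1, rfl⟩
    rw [mem_invs_wrun] at h1
    exact Set.mem_iUnion₂.2 ⟨d, u, r, h1.2, rfl⟩
  have hw : ∀ d u, wt (P d u) ≤ ENNReal.ofReal (gW (2*d+5) (wβ a z d) (2^(2*d+1)) 1 0 u) * 2⁻¹ ^ (d+1) := by
    intro d u
    cases hg : ginv (gtop d (wβ a z d) u) u with
    | none =>
      have : P d u = ∅ := by
        ext x; simp [hP, hg]
      rw [this]; simp [wt]
    | some r =>
      have : P d u = {(r + d + 1, Encodable.encode (List.replicate u true))} := by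
        ext x; simp [hP, hg]
      have e : gW (2*d+5) (wβ a z d) (2^(2*d+1)) 1 0 u = (1/2) ^ r := by
        rw [gW, show grun (2*d+5) (wβ a z d) (2^(2*d+1)) 1 0 u = gtop d (wβ a z d) u from rfl, hg]; rfl
      rw [this, wt, e, one_div, ENNReal.ofReal_pow (by norm_num), ENNReal.ofReal_inv_of_pos (by norm_num)]
      rw [tsum_singleton (f := fun x : ℕ × ℕ => (2⁻¹ : ℝ≥0∞) ^ x.1)]
      rw [add_assoc, pow_add]
      norm_num
  refine (wt_mono sub).trans_lt (lt_of_le_of_lt ?_ (ENNReal.one_lt_top))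
  calc wt (⋃ d, ⋃ u, P d u) ≤ ∑' d, wt (⋃ u, P d u) :=
        ENNReal.tsum_iUnion_le_tsum (fun x : ℕ × ℕ => (2⁻¹ : ℝ≥0∞) ^ x.1) _
    _ ≤ ∑' d, ∑' u, wt (P d u) := ENNReal.tsum_le_tsum fun d =>
        ENNReal.tsum_iUnion_le_tsum (fun x : ℕ × ℕ => (2⁻¹ : ℝ≥0∞) ^ x.1) _
    _ ≤ ∑' d, ∑' u, ENNReal.ofReal (gW (2*d+5) (wβ a z d) (2^(2*d+1)) 1 0 u) * 2⁻¹ ^ (d+1) :=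
        ENNReal.tsum_le_tsum fun d => ENNReal.tsum_le_tsum fun u => hw d u
    _ ≤ ∑' d : ℕ, 2⁻¹ ^ (d+1) := by
        refine ENNReal.tsum_le_tsum fun d => ?_
        rw [ENNReal.tsum_mul_right]
        refine mul_le_of_le_one_left (by positivity) ?_
        rw [ENNReal.tsum_eq_iSup_nat]
        refine iSup_le fun n => ?_
        rw [← ENNReal.ofReal_sum_of_nonneg fun u _ => gW_nonneg _ _ _ _ _ _]
        exact ENNReal.ofReal_le_one.2 (sum_gW _ wβ_len n)
    _ ≤ 1 := by
        rw [tsum_half, pow_one]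
        exact le_of_eq (ENNReal.mul_inv_cancel (by norm_num) (by norm_num))


theorem sp_lim {A : ℕ → Bool} (al : ∀ n, ∃ t₀, ∀ t ≥ t₀, a t n = A n) (n : ℕ) :
    ∃ t₀, ∀ t ≥ t₀, strPrefix (a t) n = strPrefix A n := by
  induction n with
  | zero => exact ⟨0, fun t _ => rfl⟩
  | succ n ih =>
    obtain ⟨t1, h1⟩ := ih
    obtain ⟨t2, h2⟩ := al n
    exact ⟨max t1 t2, fun t ht => by rw [sp_succ, sp_succ, h1 t (by omega), h2 t (by omega)]⟩

theorem ready_ev {A : ℕ → Bool} (al : ∀ n, ∃ t₀, ∀ t ≥ t₀, a t n = A n)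
    (zm : ∀ x s t, s ≤ t → z x s = true → z x t = true) {bs : List (List Bool)}
    (hz : ∀ r u, (r, u) ∈ invs d bs → ∃ k ≤ r + 2 * d, ∃ t, z (k, Encodable.encode (strPrefix A u)) t = true) :
    ∃ t₀, ∀ t ≥ t₀, ready a z d t bs = true := by
  have key : ∀ l : List (ℕ × ℕ), (∀ r u, (r, u) ∈ l → ∃ k ≤ r + 2 * d, ∃ t,
      z (k, Encodable.encode (strPrefix A u)) t = true) → ∃ t₀, ∀ t ≥ t₀, ∀ r u, (r, u) ∈ l →
        ∃ k ≤ r + 2 * d, z (k, Encodable.encode (strPrefix (a t) u)) t = true := by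
    intro l
    induction l with
    | nil => intro _; exact ⟨0, by simp⟩
    | cons x l ih =>
      intro h
      obtain ⟨t1, h1⟩ := ih fun r u hx => h r u (List.mem_cons_of_mem _ hx)
      obtain ⟨r, u⟩ := x
      obtain ⟨k, hk, t2, h2⟩ := h r u List.mem_cons_self
      obtain ⟨t3, h3⟩ := sp_lim al u
      refine ⟨max t1 (max t2 t3), fun t ht r' u' hx => ?_⟩
      rw [List.mem_cons, Prod.mk.injEq] at hx
      rcases hx with ⟨rfl, rfl⟩ | hx
      · refine ⟨k, hk, ?_⟩
        rw [h3 t (by omega)]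
        exact zm _ _ _ (by omega) h2
      · exact h1 t (by omega) r' u' hx
  obtain ⟨t₀, h⟩ := key _ hz
  exact ⟨t₀, fun t ht => ready_iff.2 (h t ht)⟩

theorem computable_find {f : ℕ → ℕ → Bool} (hf : Computable (fun q : ℕ × ℕ => f q.1 q.2))
    (h : ∀ s, ∃ t, f s t = true) : ∃ g : ℕ → ℕ, Computable g ∧ ∀ s, f s (g s) = true := by
  refine ⟨fun s => Nat.find (h s), ?_, fun s => Nat.find_spec (h s)⟩
  have : Partrec (fun s => Nat.rfind (fun t => (Part.some (f s t) : Part Bool))) :=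
    Partrec.rfind (p := fun s t => (Part.some (f s t) : Part Bool)) hf
  refine this.of_eq fun s => ?_
  exact Part.eq_some_iff.2 ((mem_rfind_some _ _).2
    ⟨Nat.find_spec (h s), fun i hi => by simpa using Nat.find_min (h s) hi⟩)

theorem count_contra {Z : Set (ℕ × ℕ)} (hZ : wt Z ≤ 1) {β : ℕ → List Bool} (hβ : ∀ s, (β s).length = s)
    {s k b : ℕ} {w : ℕ → Option ℕ}
    (hd : ∀ u r, w u = some r → ∀ t, u < t → t ≤ s → ∃ k' ≤ r + b,
      (k', Encodable.encode ((β t).take u)) ∈ Z)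
    (hs : (1/2 : ℝ) ≤ ∑ u ∈ Finset.Ico 0 s, if k + 1 ≤ cc β s u then (w u).elim 0 fun r => (1/2) ^ r else 0) :
    ((k : ℝ) + 1) * (1/2) ^ (b+1) ≤ 1 := by
  classical
  set I : ℕ → Finset (List Bool) := fun u => (Finset.Ioc u s).image fun t => (β t).take u with hI
  have hIl : ∀ u, ∀ σ ∈ I u, σ.length = u := by
    intro u σ hσ
    obtain ⟨t, ht, rfl⟩ := Finset.mem_image.1 hσ
    rw [Finset.mem_Ioc] at ht
    simp [hβ]; omega
  set U : Finset ℕ := (Finset.Ico 0 s).filter fun u => k + 1 ≤ cc β s u ∧ (w u).isSome = true with hU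
  have hk : ∀ σ : List Bool, ∃ k', ∀ u ∈ U, σ ∈ I u → ∀ r, w u = some r → k' ≤ r + b ∧
      (k', Encodable.encode σ) ∈ Z := by
    intro σ
    by_cases h : ∃ u r, u ∈ U ∧ σ ∈ I u ∧ w u = some r
    · obtain ⟨u, r, hu, hσ, hw⟩ := h
      obtain ⟨t, ht, e⟩ := Finset.mem_image.1 hσ
      rw [Finset.mem_Ioc] at ht
      obtain ⟨k', h1, h2⟩ := hd u r hw t ht.1 ht.2
      refine ⟨k', fun u' _ hσ' r' hw' => ?_⟩
      have : u' = u := by rw [← hIl u' σ hσ', hIl u σ hσ]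
      subst this
      rw [hw] at hw'
      cases hw'
      rw [← e]
      exact ⟨h1, h2⟩
    · exact ⟨0, fun u hu hσ r hw => absurd ⟨u, r, hu, hσ, hw⟩ h⟩
  choose f hf using hk
  set E : Finset (List Bool) := U.biUnion I with hE
  have hdis : ∀ u ∈ U, ∀ u' ∈ U, u ≠ u' → Disjoint (I u) (I u') := by
    intro u _ u' _ hne
    rw [Finset.disjoint_left]
    intro σ h1 h2
    exact hne (by rw [← hIl u σ h1, hIl u' σ h2])
  have sumE : ∑ σ ∈ E, (2⁻¹ : ℝ≥0∞) ^ f σ ≤ 1 := by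
    refine le_trans ?_ hZ
    have inj : Function.Injective (fun σ : List Bool => (f σ, Encodable.encode σ)) := by
      intro σ τ h
      exact Encodable.encode_injective (Prod.mk.inj h).2
    rw [wt, tsum_subtype Z (fun x : ℕ × ℕ => (2⁻¹ : ℝ≥0∞) ^ x.1)]
    refine le_trans (le_of_eq ?_) (ENNReal.sum_le_tsum (E.image fun σ => (f σ, Encodable.encode σ)))
    rw [Finset.sum_image inj.injOn]
    refine Finset.sum_congr rfl fun σ hσ => ?_
    rw [Finset.mem_biUnion] at hσ
    obtain ⟨u, hu, hσ⟩ := hσ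
    obtain ⟨r, hr⟩ := Option.isSome_iff_exists.1 (Finset.mem_filter.1 hu).2.2
    rw [Set.indicator_of_mem (hf σ u hu hσ r hr).2]
  have sumE' : ∑ σ ∈ E, (1/2 : ℝ) ^ f σ ≤ 1 := by
    rw [← ENNReal.ofReal_le_one, ENNReal.ofReal_sum_of_nonneg fun _ _ => by positivity]
    refine le_trans (le_of_eq (Finset.sum_congr rfl fun σ _ => ?_)) sumE
    rw [one_div, ENNReal.ofReal_pow (by norm_num), ENNReal.ofReal_inv_of_pos (by norm_num)]
    norm_num
  have low : ∑ u ∈ U, ((k : ℝ) + 1) * (1/2) ^ b * ((w u).elim 0 fun r => (1/2) ^ r) ≤ ∑ σ ∈ E, (1/2 : ℝ) ^ f σ := by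
    rw [hE, Finset.sum_biUnion hdis]
    refine Finset.sum_le_sum fun u hu => ?_
    obtain ⟨h1, h2, h3⟩ := Finset.mem_filter.1 hu
    obtain ⟨r, hr⟩ := Option.isSome_iff_exists.1 h3
    rw [hr, Option.elim_some]
    calc ((k : ℝ) + 1) * (1/2) ^ b * (1/2) ^ r = ((k + 1 : ℕ) : ℝ) * (1/2) ^ (r + b) := by
          push_cast; rw [pow_add]; ring
      _ ≤ (I u).card * (1/2) ^ (r+b) := by
          have : ((k + 1 : ℕ) : ℝ) ≤ (I u).card := by exact_mod_cast h2
          gcongr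
      _ = ∑ σ ∈ I u, (1/2 : ℝ) ^ (r+b) := by rw [Finset.sum_const, nsmul_eq_mul]
      _ ≤ _ := Finset.sum_le_sum fun σ hσ =>
          pow_le_pow_of_le_one (by norm_num) (by norm_num) (hf σ u hu hσ r hr).1
  have e : (∑ u ∈ Finset.Ico 0 s, if k + 1 ≤ cc β s u then (w u).elim 0 fun r => (1/2 : ℝ) ^ r else 0) =
      ∑ u ∈ U, (w u).elim 0 fun r => (1/2 : ℝ) ^ r := by
    rw [hU, Finset.sum_filter]
    refine Finset.sum_congr rfl fun u _ => ?_
    cases hw : w u <;> simp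
  rw [e] at hs
  rw [← Finset.mul_sum] at low
  have : (0 : ℝ) < ((k : ℝ) + 1) * (1/2) ^ b := by positivity
  rw [pow_succ]
  nlinarith

theorem exists_lce {A : ℕ → Bool} (hA : TuringLE A zeroJump) (hK : KTrivial A) :
    ∃ X, LCE X ∧ MLRandomIn A X := by
  by_contra hcon
  have hno : ∀ X, LCE X → ¬ MLRandomIn A X := fun X h1 h2 => hcon ⟨X, h1, h2⟩
  obtain ⟨a, ac, al⟩ := limit_lemma hA
  obtain ⟨Z, hZ, hZ1, hZK⟩ := exZ
  obtain ⟨z, zc, zm, hz⟩ := sig_empty_iff.1 hZ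
  obtain ⟨c, hc⟩ := KC (sig_reqSet ac zc) (wt_reqSet (a := a) (z := z))
  obtain ⟨c2, hc2⟩ := hK
  set d := 1 + c + c2 with hd
  have hlong : ∀ T, ∃ T', (wrun a z d T).length < (wrun a z d T').length := by
    intro T
    have h1 : ∀ r u, (r, u) ∈ invs d (wrun a z d T) → ∃ k ≤ r + 2 * d, ∃ t,
        z (k, Encodable.encode (strPrefix A u)) t = true := by
      intro r u h
      have h2 := hc (r + d + 1, Encodable.encode (List.replicate u true)) ⟨(d, T, r, u), h, rfl⟩
      have h3 := hc2 u
      unfold KofNat at h3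
      simp only at h2
      exact ⟨_, by omega, (hz _).1 (hZK (Encodable.encode (strPrefix A u)))⟩
    obtain ⟨t₀, ht⟩ := ready_ev al zm h1
    have hp := wrun_prefix (a := a) (z := z) (d := d) (show T ≤ max T t₀ by omega)
    by_cases e : wrun a z d T = wrun a z d (max T t₀)
    · refine ⟨max T t₀ + 1, ?_⟩
      rw [wrun_succ, ← e, if_pos (ht _ (by omega))]
      simp
    · refine ⟨max T t₀, lt_of_le_of_ne hp.length_le fun h => e (hp.eq_of_length h)⟩
  have hall : ∀ s, ∃ T, s < (wrun a z d T).length := by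
    intro s
    induction s with
    | zero => exact ⟨0, by simp [wrun]⟩
    | succ s ih =>
      obtain ⟨T, hT⟩ := ih
      obtain ⟨T', hT'⟩ := hlong T
      exact ⟨T', by omega⟩
  set β := wβ a z d with hβ
  have cβ : Computable β := by
    have hw := cWrun ac zc
    have hw' : Computable (fun T : ℕ => wrun a z d T) :=
      hw.comp (f := fun q : ℕ × ℕ => wrun a z q.1 q.2) (g := fun T : ℕ => (d, T)) (by fun_prop)
    obtain ⟨g, gc, hg⟩ := computable_find (f := fun s T => decide (s < (wrun a z d T).length))
      (by fun_prop) (by simpa using hall)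
    have : β = fun s => (wrun a z d (g s)).getD s [] := by
      funext s
      rw [wβ_eq (by simpa using hg s)]
    rw [this]
    fun_prop
  have hap : ∀ s, ∃ T, (wrun a z d T).length = s + 1 ∧
    ready a z d T (wrun a z d T) = true ∧ β (s+1) = strPrefix (a T) (s+1) := by
    intro s
    obtain ⟨T, hT⟩ := hall (s+1)
    exact wrun_append hT
  have hconv : ∀ n, ∃ t, ∀ s ≥ t, (β s).take n = strPrefix A n := by
    intro n
    obtain ⟨t₀, ht⟩ := sp_lim al n
    refine ⟨max n t₀ + 1, fun s hs => ?_⟩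
    obtain ⟨s, rfl⟩ : ∃ s', s = s' + 1 := ⟨s - 1, by omega⟩
    obtain ⟨T, h1, -, h3⟩ := hap s
    have := wrun_len (a := a) (z := z) (d := d) T
    rw [h3, sp_take, min_eq_left (by omega), ht T (by omega)]
  obtain ⟨s, -, n1, a1, τ1, rs1, hfin⟩ := live_all (A := A) (κ := 2*d+5) (k := 2^(2*d+1)) wβ_len (by omega)
    (top_eps d) cβ hconv hno _ le_rfl 1 0
  obtain ⟨n', a', τ', rs', b, tl, hch, hb, -⟩ := gp_all (β := β) wβ_len (show 3 ≤ 2*d+5 by omega)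
    (top_eps d) _ le_rfl 1 0 s (by omega)
  have hb' : b = true := by
    rw [hfin] at hch
    simp only [List.cons.injEq, Prod.mk.injEq] at hch
    exact hch.1.2.2.2.2.2.2.2.symm
  have hval := (hb hb').2
  have := count_contra hZ1 (β := β) wβ_len (s := s) (k := 2^(2*d+1)) (b := 2*d)
    (w := fun u => ginv (gtop d β u) u) ?_ ?_
  · have h5 : ((2^(2*d+1) : ℕ) : ℝ) * (1/2) ^ (2*d+1) = 1 := by
      push_cast; rw [← mul_pow]; norm_num
    have h6 : (0 : ℝ) < (1/2) ^ (2*d+1) := by positivity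
    rw [add_mul, h5] at this
    linarith
  · intro u r hu t hut hts
    obtain ⟨t, rfl⟩ : ∃ s', t = s' + 1 := ⟨t - 1, by omega⟩
    obtain ⟨T, h1, h2, h3⟩ := hap t
    obtain ⟨k', hk, hk2⟩ := ready_iff.1 h2 r u (mem_invs_wrun.2 ⟨by omega, hu⟩)
    refine ⟨k', hk, ?_⟩
    rw [h3, sp_take, min_eq_left (by omega)]
    exact (hz _).2 ⟨_, hk2⟩
  · rw [pow_one] at hval
    exact hval

end Wrapper

end
open MeasureTheory ENNReal

theorem dir1 {A : ℕ → Bool} (hA : TuringLE A zeroJump) (hK : KTrivial A) : ¬ MLCuppable A := by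
  rintro ⟨X, hX, hX0, hXn, hj⟩
  obtain ⟨Y, ⟨a, ac, am, aX⟩, hY⟩ := exists_lce hA hK
  have h1 : TuringLE zeroJump Y := lce_complete hY.toRandom a ac am aX
  have hL : LProp A := lprop_of_base hY (hA.trans' h1)
  have hXA := hL.random hX
  obtain ⟨S, hS, hXS, hd⟩ := part8 hXA (fun B hB => (hL.ce_le hA hB).trans' hj)
  obtain ⟨S', hS', hXS', hsub⟩ := hL.cover hX hS hXS
  exact hXn (low_density hX hS' hXS' fun k => (hd k).imp fun n hn =>
    (measure_mono (Set.inter_subset_inter_right _ (Set.compl_subset_compl.2 hsub))).trans hn)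

/-- a set below `∅′` is ML-cuppable iff it is not K-trivial. -/
theorem stmt13 (A : ℕ → Bool) (hA : TuringLE A zeroJump) :
    MLCuppable A ↔ ¬ KTrivial A := by
  exact ⟨fun h hK => dir1 hA hK h, dir2 hA⟩
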